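/- Under the standing assumptions, the pairing (h^𝔹, ·) extends to functions of finite Green energy: if f is a measurable function on 𝔹 with ∬ |f(x)| G^𝔹(x, y) |f(y)| dx dy < ∞ and (f_n) is any sequence of smooth compactly supported functions on 𝔹 with ∬ (f − f_n)(x) G^𝔹(x, y) (f − f_n)(y) dx dy → 0, then ((h^𝔹, f_n))_n converges in L²(P), and the limit is almost surely the same for any two such approximating sequences. -/

import Mathlib

open MeasureTheory ProbabilityTheory Metric Filter Topology Set

noncomputable section

abbrev Euc (d : ℕ) : Type := EuclideanSpace ℝ (Fin d)

/-- The scaling function `s`: `s(r) = -log r` if `d = 2`, and `s(r) = r^(2-d)` if `d ≥ 3`. -/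
noncomputable def sFun (d : ℕ) (r : ℝ) : ℝ :=
  if d = 2 then -Real.log r else r ^ ((2 : ℝ) - (d : ℝ))

open Classical in
/-- The zero boundary Green's function of the open unit ball in `ℝ^d`:
`G(x,y) = s(|x-y|) - s(|x|·|y - x/|x|²|)`, interpreted by continuity at `x = 0`. -/
noncomputable def greenBall (d : ℕ) (x y : Euc d) : ℝ :=
  if x = 0 then sFun d ‖y‖ - sFun d 1
  else sFun d ‖x - y‖ - sFun d (‖x‖ * ‖y - (‖x‖ ^ 2)⁻¹ • x‖)

/-- Smooth compactly supported test functions. -/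
def IsTestFun {d : ℕ} (f : Euc d → ℝ) : Prop :=
  ContDiff ℝ (⊤ : ℕ∞) f ∧ HasCompactSupport f

/-- The Laplacian of `u : ℝ^d → ℝ` at `x`, as the sum of pure second derivatives in the
coordinate directions. -/
noncomputable def lap {d : ℕ} (u : Euc d → ℝ) (x : Euc d) : ℝ :=
  ∑ i : Fin d, iteratedFDeriv ℝ 2 u x ![EuclideanSpace.single i 1, EuclideanSpace.single i 1]

/-- A function is harmonic on a set if it is twice continuously differentiable there with
vanishing Laplacian. -/
def IsHarmonicOn {d : ℕ} (u : Euc d → ℝ) (s : Set (Euc d)) : Prop :=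
  ContDiffOn ℝ 2 u s ∧ ∀ x ∈ s, lap u x = 0

/-- A real random variable is a (possibly degenerate) centered Gaussian. -/
def IsCenteredGaussianRV {Ω : Type} [MeasurableSpace Ω] (P : Measure Ω) (Y : Ω → ℝ) : Prop :=
  ∃ v : NNReal, Measure.map Y P = ProbabilityTheory.gaussianReal 0 v

/-- The standing assumptions: a collection of stochastic processes `h a r` (thought of as
`h^{a + r𝔹}`) indexed by test functions, which is centered, a.s. linear, zero outside the ball,
translation/scaling covariant, satisfies the domain Markov property (with the decomposition
recorded as data `H`, `Φ`, `φharm`), has fourth moments, a (sequentially) continuous covariance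
bilinear form on `C_c^∞(𝔹)`, and zero boundary conditions. -/
structure GFF (d : ℕ) (Ω : Type) [MeasurableSpace Ω] where
  P : Measure Ω
  prob : IsProbabilityMeasure P
  /-- the field `h^{a+r𝔹}` tested against `f` -/
  h : Euc d → ℝ → (Euc d → ℝ) → Ω → ℝ
  meas_h : ∀ a r f, Measurable (h a r f)
  integrable_h : ∀ a r f, IsTestFun f → Integrable (h a r f) P
  /-- centered -/
  centered : ∀ a r f, IsTestFun f → ∫ ω, h a r f ω ∂P = 0
  /-- (1) a.s. linearity in the test function -/
  lin_add : ∀ f g : Euc d → ℝ, IsTestFun f → IsTestFun g →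
    ∀ᵐ ω ∂P, h 0 1 (f + g) ω = h 0 1 f ω + h 0 1 g ω
  lin_smul : ∀ (c : ℝ) (f : Euc d → ℝ), IsTestFun f →
    ∀ᵐ ω ∂P, h 0 1 (c • f) ω = c * h 0 1 f ω
  /-- (2) the field vanishes on test functions supported outside the ball -/
  zero_outside : ∀ f : Euc d → ℝ, IsTestFun f → tsupport f ⊆ (ball (0 : Euc d) 1)ᶜ →
    ∀ᵐ ω ∂P, h 0 1 f ω = 0
  /-- (3) translation and scaling: `(h^{a+r𝔹}, f((·-a)/r)) = r^{1+d/2} (h^𝔹, f)` in law,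
  as processes (equality of finite dimensional distributions) -/
  scaling : ∀ (a : Euc d) (r : ℝ), 0 < r → ∀ (k : ℕ) (f : Fin k → Euc d → ℝ),
    (∀ i, IsTestFun (f i)) →
    Measure.map (fun ω (i : Fin k) => h a r (fun x => f i (r⁻¹ • (x - a))) ω) P
      = Measure.map (fun ω (i : Fin k) => r ^ (1 + (d : ℝ) / 2) * h 0 1 (f i) ω) P
  /-- (4) domain Markov property: the decomposition data. `H a r` is the independent copy of
  `h^{a+r𝔹}`, `Φ a r` is the harmonic part as a process, `φharm a r ω` is the harmonic function. -/
  H : Euc d → ℝ → (Euc d → ℝ) → Ω → ℝ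
  Φ : Euc d → ℝ → (Euc d → ℝ) → Ω → ℝ
  φharm : Euc d → ℝ → Ω → Euc d → ℝ
  meas_H : ∀ a r f, Measurable (H a r f)
  meas_Φ : ∀ a r f, Measurable (Φ a r f)
  meas_φharm : ∀ a r z, Measurable fun ω => φharm a r ω z
  dmp_decomp : ∀ (a : Euc d) (r : ℝ), 0 < r → ball a r ⊆ ball (0 : Euc d) 1 →
    ∀ f : Euc d → ℝ, IsTestFun f → ∀ᵐ ω ∂P, h 0 1 f ω = H a r f ω + Φ a r f ω
  dmp_indep : ∀ (a : Euc d) (r : ℝ), 0 < r → ball a r ⊆ ball (0 : Euc d) 1 →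
    ProbabilityTheory.Indep
      (⨆ f : {f : Euc d → ℝ // IsTestFun f}, MeasurableSpace.comap (H a r f.1) inferInstance)
      ((⨆ f : {f : Euc d → ℝ // IsTestFun f}, MeasurableSpace.comap (Φ a r f.1) inferInstance) ⊔
        (⨆ z : Euc d, MeasurableSpace.comap (fun ω => φharm a r ω z) inferInstance)) P
  dmp_law : ∀ (a : Euc d) (r : ℝ), 0 < r → ball a r ⊆ ball (0 : Euc d) 1 →
    ∀ (k : ℕ) (f : Fin k → Euc d → ℝ), (∀ i, IsTestFun (f i)) →
    Measure.map (fun ω (i : Fin k) => H a r (f i) ω) P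
      = Measure.map (fun ω (i : Fin k) => h a r (f i) ω) P
  dmp_harm : ∀ (a : Euc d) (r : ℝ), 0 < r → ball a r ⊆ ball (0 : Euc d) 1 →
    ∀ᵐ ω ∂P, IsHarmonicOn (φharm a r ω) (ball a r) ∧
      ∀ f : Euc d → ℝ, IsTestFun f → tsupport f ⊆ ball a r →
        Φ a r f ω = ∫ x in ball a r, φharm a r ω x * f x
  /-- (5) fourth moments -/
  mom4 : ∀ f : Euc d → ℝ, IsTestFun f → Integrable (fun ω => (h 0 1 f ω) ^ 4) P
  /-- (6) sequential continuity of the covariance bilinear form on `C_c^∞(𝔹)` -/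
  K2_cont : ∀ (f : ℕ → Euc d → ℝ) (f₀ g : Euc d → ℝ) (K : Set (Euc d)),
    IsCompact K → K ⊆ ball (0 : Euc d) 1 →
    (∀ n, IsTestFun (f n)) → IsTestFun f₀ → IsTestFun g → tsupport g ⊆ ball (0 : Euc d) 1 →
    (∀ n, tsupport (f n) ⊆ K) → tsupport f₀ ⊆ K →
    (∀ m : ℕ, TendstoUniformly (fun n => iteratedFDeriv ℝ m (f n)) (iteratedFDeriv ℝ m f₀) atTop) →
    Tendsto (fun n => ∫ ω, h 0 1 (f n) ω * h 0 1 g ω ∂P) atTop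
      (𝓝 (∫ ω, h 0 1 f₀ ω * h 0 1 g ω ∂P))
  /-- (7) zero boundary conditions -/
  zero_bdry : ∀ f : ℕ → Euc d → ℝ,
    (∀ n, IsTestFun (f n)) → (∀ n x, 0 ≤ f n x) →
    (∃ C : ℝ, ∀ n, ∫ x, f n x ≤ C) →
    Tendsto (fun n => Metric.infDist (0 : Euc d) (tsupport (f n))) atTop (𝓝 1) →
    (∃ C : ℝ, ∀ (n : ℕ) (x y : Euc d), ‖x‖ = ‖y‖ → ‖x‖ < 1 → f n x ≤ C * f n y) →
    Tendsto (fun n => ∫ ω, (h 0 1 (f n) ω) ^ 2 ∂P) atTop (𝓝 0)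

instance {d : ℕ} {Ω : Type} [MeasurableSpace Ω] (X : GFF d Ω) : IsProbabilityMeasure X.P :=
  X.prob

/-- The Green energy `∬_{𝔹×𝔹} u(x) G^𝔹(x,y) u(y) dx dy` of a function `u`. -/
noncomputable def greenEnergy (d : ℕ) (u : Euc d → ℝ) : ℝ :=
  ∫ x in ball (0 : Euc d) 1, ∫ y in ball (0 : Euc d) 1, u x * greenBall d x y * u y

section Calculus

variable {d : ℕ}

/-- The partial derivative in the `i`-th coordinate direction. -/
def pd (i : Fin d) (u : Euc d → ℝ) (x : Euc d) : ℝ := fderiv ℝ u x (EuclideanSpace.single i 1)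

lemma ContDiffAt.pd {n m : WithTop ℕ∞} {u : Euc d → ℝ} {x : Euc d} (hu : ContDiffAt ℝ n u x)
    (hmn : m + 1 ≤ n) (i : Fin d) : ContDiffAt ℝ m (pd i u) x :=
  (hu.fderiv_right hmn).clm_apply contDiffAt_const

lemma ContDiff.pd {n m : WithTop ℕ∞} {u : Euc d → ℝ} (hu : ContDiff ℝ n u)
    (hmn : m + 1 ≤ n) (i : Fin d) : ContDiff ℝ m (pd i u) :=
  (hu.fderiv_right hmn).clm_apply contDiff_const

lemma lap_eq_sum_pd {u : Euc d → ℝ} {x : Euc d} (hu : ContDiffAt ℝ 2 u x) :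
    lap u x = ∑ i, pd i (pd i u) x := by
  unfold lap
  refine Finset.sum_congr rfl fun i _ => ?_
  rw [iteratedFDeriv_two_apply]
  have h1 : DifferentiableAt ℝ (fderiv ℝ u) x :=
    (hu.fderiv_right (m := 1) (by norm_num)).differentiableAt (by norm_num)
  unfold pd
  rw [fderiv_clm_apply h1 (differentiableAt_const _)]
  simp

lemma lap_congr {u v : Euc d → ℝ} {x : Euc d} (h : u =ᶠ[𝓝 x] v) : lap u x = lap v x := by
  unfold lap
  rw [(h.iteratedFDeriv ℝ 2).eq_of_nhds]

lemma pd_congr {u v : Euc d → ℝ} {x : Euc d} (i : Fin d) (h : u =ᶠ[𝓝 x] v) :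
    pd i u x = pd i v x := by
  unfold pd; rw [h.fderiv_eq]

lemma pd_add (i : Fin d) {u v : Euc d → ℝ} {x : Euc d} (hu : DifferentiableAt ℝ u x)
    (hv : DifferentiableAt ℝ v x) : pd i (fun y => u y + v y) x = pd i u x + pd i v x := by
  unfold pd; rw [fderiv_fun_add hu hv]; simp

lemma pd_mul (i : Fin d) {u v : Euc d → ℝ} {x : Euc d} (hu : DifferentiableAt ℝ u x)
    (hv : DifferentiableAt ℝ v x) :
    pd i (fun y => u y * v y) x = u x * pd i v x + pd i u x * v x := by
  unfold pd; rw [fderiv_fun_mul hu hv]; simp; ring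

lemma pd_comp (i : Fin d) {S : ℝ → ℝ} {q : Euc d → ℝ} {x : Euc d}
    (hS : DifferentiableAt ℝ S (q x)) (hq : DifferentiableAt ℝ q x) :
    pd i (fun y => S (q y)) x = deriv S (q x) * pd i q x := by
  unfold pd
  have := (hS.hasDerivAt.comp_hasFDerivAt x hq.hasFDerivAt).fderiv
  simp only [Function.comp_def] at this
  rw [this]; simp

lemma lap_add {u v : Euc d → ℝ} {x : Euc d} (hu : ContDiffAt ℝ 2 u x) (hv : ContDiffAt ℝ 2 v x) :
    lap (fun y => u y + v y) x = lap u x + lap v x := by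
  unfold lap
  rw [← Finset.sum_add_distrib]
  refine Finset.sum_congr rfl fun i _ => ?_
  have := iteratedFDeriv_add_apply (𝕜 := ℝ) (i := 2) (f := u) (g := v) (x := x) hu hv
  rw [show (fun y => u y + v y) = u + v from rfl, this]
  rfl

lemma lap_const_mul {u : Euc d → ℝ} {x : Euc d} (c : ℝ) (hu : ContDiffAt ℝ 2 u x) :
    lap (fun y => c * u y) x = c * lap u x := by
  unfold lap
  rw [Finset.mul_sum]
  refine Finset.sum_congr rfl fun i _ => ?_
  rw [show (fun y => c * u y) = c • u from rfl, iteratedFDeriv_const_smul_apply hu]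
  rfl

lemma lap_sub {u v : Euc d → ℝ} {x : Euc d} (hu : ContDiffAt ℝ 2 u x) (hv : ContDiffAt ℝ 2 v x) :
    lap (fun y => u y - v y) x = lap u x - lap v x := by
  have : (fun y => u y - v y) = fun y => u y + (-1) * v y := by ext; ring
  rw [this, lap_add hu (contDiffAt_const.mul hv), lap_const_mul _ hv]; ring

lemma eventually_differentiableAt {u : Euc d → ℝ} {x : Euc d} (hu : ContDiffAt ℝ 2 u x) :
    ∀ᶠ y in 𝓝 x, DifferentiableAt ℝ u y :=
  (hu.eventually (by simp)).mono fun _ hy => hy.differentiableAt (by norm_num)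

lemma lap_mul {u v : Euc d → ℝ} {x : Euc d} (hu : ContDiffAt ℝ 2 u x) (hv : ContDiffAt ℝ 2 v x) :
    lap (fun y => u y * v y) x = u x * lap v x + 2 * ∑ i, pd i u x * pd i v x + lap u x * v x := by
  rw [lap_eq_sum_pd (hu.mul hv), lap_eq_sum_pd hu, lap_eq_sum_pd hv, Finset.mul_sum,
    Finset.mul_sum, Finset.sum_mul, ← Finset.sum_add_distrib, ← Finset.sum_add_distrib]
  refine Finset.sum_congr rfl fun i _ => ?_
  have h1 : pd i (fun y => u y * v y) =ᶠ[𝓝 x] fun y => u y * pd i v y + pd i u y * v y := by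
    filter_upwards [eventually_differentiableAt hu, eventually_differentiableAt hv] with y h1 h2
      using pd_mul i h1 h2
  have hu0 := hu.differentiableAt (by norm_num)
  have hv0 := hv.differentiableAt (by norm_num)
  have hu1 := (hu.pd (m := 1) (by norm_num) i).differentiableAt (by norm_num)
  have hv1 := (hv.pd (m := 1) (by norm_num) i).differentiableAt (by norm_num)
  rw [pd_congr i h1]
  refine (pd_add i (hu0.mul hv1) (hu1.mul hv0)).trans ?_
  erw [pd_mul i hu0 hv1, pd_mul i hu1 hv0]
  ring

lemma lap_comp {S : ℝ → ℝ} {q : Euc d → ℝ} {x : Euc d}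
    (hS : ContDiffAt ℝ 2 S (q x)) (hq : ContDiffAt ℝ 2 q x) :
    lap (fun y => S (q y)) x
      = deriv (deriv S) (q x) * ∑ i, pd i q x ^ 2 + deriv S (q x) * lap q x := by
  have hSq : ContDiffAt ℝ 2 (fun y => S (q y)) x := hS.comp x hq
  rw [lap_eq_sum_pd hSq, lap_eq_sum_pd hq, Finset.mul_sum, Finset.mul_sum,
    ← Finset.sum_add_distrib]
  refine Finset.sum_congr rfl fun i _ => ?_
  have hSev : ∀ᶠ t in 𝓝 (q x), DifferentiableAt ℝ S t :=
    (hS.eventually (by simp)).mono fun _ hy => hy.differentiableAt (by norm_num)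
  have h1 : pd i (fun y => S (q y)) =ᶠ[𝓝 x] fun y => deriv S (q y) * pd i q y := by
    filter_upwards [eventually_differentiableAt hq, hq.continuousAt.eventually hSev] with y h1 h2
      using pd_comp i h2 h1
  have hq0 := hq.differentiableAt (by norm_num)
  have hq1 := (hq.pd (m := 1) (by norm_num) i).differentiableAt (by norm_num)
  have hS1 : DifferentiableAt ℝ (deriv S) (q x) := by
    have : ContDiffAt ℝ 1 (fun t => fderiv ℝ S t 1) (q x) :=
      (hS.fderiv_right (by norm_num)).clm_apply contDiffAt_const
    exact this.differentiableAt (by norm_num)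
  have hS1q : DifferentiableAt ℝ (fun y => deriv S (q y)) x := hS1.comp x hq0
  rw [pd_congr i h1, pd_mul i hS1q hq1, pd_comp i hS1 hq0]
  ring

/-- The quadratic polynomial `α + ⟨b, x⟩ + β |x|²`. -/
def quadPoly (α β : ℝ) (b x : Euc d) : ℝ := α + inner ℝ b x + β * ‖x‖ ^ 2

lemma contDiff_quadPoly {n : WithTop ℕ∞} (α β : ℝ) (b : Euc d) :
    ContDiff ℝ n (quadPoly α β b) := by
  unfold quadPoly
  exact (contDiff_const.add (contDiff_const.inner ℝ contDiff_id)).add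
    (contDiff_const.mul (contDiff_norm_sq ℝ))

lemma pd_quadPoly (α β : ℝ) (b x : Euc d) (i : Fin d) :
    pd i (quadPoly α β b) x = b i + 2 * β * x i := by
  have h1 : HasFDerivAt (fun x : Euc d => ‖x‖ ^ 2) (2 • (innerSL ℝ x)) x :=
    (hasStrictFDerivAt_norm_sq x).hasFDerivAt
  have h2 : HasFDerivAt (fun x : Euc d => inner ℝ b x) (innerSL ℝ b) x :=
    (innerSL ℝ b).hasFDerivAt
  have h3 := ((h2.const_add α).add (h1.const_mul β)).fderiv
  unfold pd quadPoly
  erw [h3]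
  simp [innerSL_apply_apply, EuclideanSpace.inner_single_right]
  ring

lemma lap_quadPoly (α β : ℝ) (b x : Euc d) : lap (quadPoly α β b) x = 2 * d * β := by
  rw [lap_eq_sum_pd (contDiff_quadPoly α β b).contDiffAt]
  have : ∀ i : Fin d, pd i (pd i (quadPoly α β b)) x = 2 * β := by
    intro i
    have : pd i (quadPoly α β b)
        = quadPoly (b i) 0 ((2 * β) • EuclideanSpace.single i (1 : ℝ)) := by
      ext y
      rw [pd_quadPoly, quadPoly, inner_smul_left, EuclideanSpace.inner_single_left]
      simp
    rw [this, pd_quadPoly]; simp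
  simp [this]; ring

lemma sum_pd_quadPoly_sq (α β : ℝ) (b x : Euc d) :
    ∑ i, pd i (quadPoly α β b) x ^ 2
      = 4 * β * quadPoly α β b x + (‖b‖ ^ 2 - 4 * α * β) := by
  simp_rw [pd_quadPoly, quadPoly, EuclideanSpace.norm_sq_eq, PiLp.inner_apply]
  simp only [Real.norm_eq_abs, sq_abs, RCLike.inner_apply, conj_trivial, mul_add,
    Finset.mul_sum]
  have : ∀ i, (b i + 2 * β * x i) ^ 2
      = b i ^ 2 + 4 * β * (x i * b i) + 4 * β * (β * x i ^ 2) := by intro i; ring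
  simp_rw [this, Finset.sum_add_distrib]
  ring

lemma lap_comp_quadPoly {S : ℝ → ℝ} {α β : ℝ} {b x : Euc d}
    (hS : ContDiffAt ℝ 2 S (quadPoly α β b x)) :
    lap (fun y => S (quadPoly α β b y)) x
      = β * (4 * quadPoly α β b x * deriv (deriv S) (quadPoly α β b x)
          + 2 * d * deriv S (quadPoly α β b x))
        + (‖b‖ ^ 2 - 4 * α * β) * deriv (deriv S) (quadPoly α β b x) := by
  rw [lap_comp hS (contDiff_quadPoly α β b).contDiffAt, sum_pd_quadPoly_sq, lap_quadPoly]
  ring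

lemma lap_comp_affine {u : Euc d → ℝ} (hu : ContDiff ℝ 2 u) (a : Euc d) (r : ℝ) (x : Euc d) :
    lap (fun y => u (a + r • y)) x = r ^ 2 * lap u (a + r • x) := by
  have hA : ∀ z, HasFDerivAt (fun y : Euc d => a + r • y) (r • ContinuousLinearMap.id ℝ (Euc d)) z :=
    fun z => ((hasFDerivAt_id z).const_smul r).const_add a
  have hpd : ∀ (v : Euc d → ℝ), Differentiable ℝ v → ∀ i,
      pd i (fun y => v (a + r • y)) = fun y => r * pd i v (a + r • y) := by
    intro v hv i
    ext y
    unfold pd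
    have := ((hv _).hasFDerivAt.comp y (hA y)).fderiv
    simp only [Function.comp_def] at this
    rw [this]; simp
  have hc : ContDiff ℝ 2 (fun y => u (a + r • y)) :=
    hu.comp (contDiff_const.add (contDiff_id.const_smul r))
  rw [lap_eq_sum_pd hc.contDiffAt, lap_eq_sum_pd hu.contDiffAt, Finset.mul_sum]
  refine Finset.sum_congr rfl fun i _ => ?_
  have hd : Differentiable ℝ (pd i u) := (hu.pd (m := 1) (by norm_num) i).differentiable (by norm_num)
  rw [hpd u (hu.differentiable (by norm_num)) i]
  have h2 : pd i (fun y => r * pd i u (a + r • y)) x = r * pd i (fun y => pd i u (a + r • y)) x := by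
    have hdd : DifferentiableAt ℝ (fun y => pd i u (a + r • y)) x :=
      (hd _).comp x (hA x).differentiableAt
    unfold pd at hdd ⊢
    rw [fderiv_const_mul hdd]; simp
  rw [h2, hpd _ hd i]; ring

lemma lap_eq_clm {u : Euc d → ℝ} : lap u = fun x =>
    (∑ i : Fin d, ((ContinuousLinearMap.apply ℝ ℝ (EuclideanSpace.single i (1 : ℝ))).comp
      (ContinuousLinearMap.apply ℝ (Euc d →L[ℝ] ℝ) (EuclideanSpace.single i (1 : ℝ)))))
      (fderiv ℝ (fderiv ℝ u) x) := by
  ext x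
  unfold lap
  simp_rw [iteratedFDeriv_two_apply]
  simp

lemma ContDiff.lap {n m : WithTop ℕ∞} {u : Euc d → ℝ} (hu : ContDiff ℝ n u) (h : m + 2 ≤ n) :
    ContDiff ℝ m (lap u) := by
  have h1 : ContDiff ℝ (m + 1) (fderiv ℝ u) := hu.fderiv_right (by
    rw [add_assoc, one_add_one_eq_two]; exact h)
  have h2 : ContDiff ℝ m (fderiv ℝ (fderiv ℝ u)) := h1.fderiv_right le_rfl
  rw [lap_eq_clm]
  exact (ContinuousLinearMap.contDiff _).comp h2

/-- Derivatives of the Laplacian are controlled by derivatives of order two higher. -/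
lemma norm_iteratedFDeriv_lap_le (d : ℕ) : ∃ C : ℝ, 0 ≤ C ∧ ∀ (u : Euc d → ℝ),
    ContDiff ℝ (⊤ : ℕ∞) u → ∀ (m : ℕ) (x : Euc d),
    ‖iteratedFDeriv ℝ m (lap u) x‖ ≤ C * ‖iteratedFDeriv ℝ (m + 2) u x‖ := by
  refine ⟨_, norm_nonneg (∑ i : Fin d,
    ((ContinuousLinearMap.apply ℝ ℝ (EuclideanSpace.single i (1 : ℝ))).comp
      (ContinuousLinearMap.apply ℝ (Euc d →L[ℝ] ℝ) (EuclideanSpace.single i (1 : ℝ))))),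
      fun u hu m x => ?_⟩
  have h2 : ContDiff ℝ (⊤ : ℕ∞) (fderiv ℝ (fderiv ℝ u)) :=
    (hu.fderiv_right (m := (⊤ : ℕ∞)) (by simp)).fderiv_right (by simp)
  have := ContinuousLinearMap.norm_iteratedFDeriv_comp_left (∑ i : Fin d,
    ((ContinuousLinearMap.apply ℝ ℝ (EuclideanSpace.single i (1 : ℝ))).comp
      (ContinuousLinearMap.apply ℝ (Euc d →L[ℝ] ℝ) (EuclideanSpace.single i (1 : ℝ)))))
      (f := fderiv ℝ (fderiv ℝ u)) (x := x) (n := m) h2.contDiffAt (by exact_mod_cast le_top)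
  rw [norm_iteratedFDeriv_fderiv, norm_iteratedFDeriv_fderiv] at this
  rw [lap_eq_clm]
  exact this

lemma tsupport_lap_subset (u : Euc d → ℝ) : tsupport (lap u) ⊆ tsupport u := by
  refine closure_minimal (fun x hx => ?_) (isClosed_tsupport u)
  by_contra hxu
  refine hx ?_
  unfold lap
  have : iteratedFDeriv ℝ 2 u x = 0 := by
    by_contra h
    exact hxu (support_iteratedFDeriv_subset (𝕜 := ℝ) 2 h)
  simp [this]

lemma hasCompactSupport_pd {u : Euc d → ℝ} (hu : HasCompactSupport u) (i : Fin d) :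
    HasCompactSupport (pd i u) :=
  (hu.fderiv ℝ).comp_left (g := fun L : Euc d →L[ℝ] ℝ => L (EuclideanSpace.single i 1)) (by simp)

lemma integral_mul_pd {u v : Euc d → ℝ} (hu : ContDiff ℝ 1 u) (hv : ContDiff ℝ 1 v)
    (hc : HasCompactSupport u) (i : Fin d) :
    ∫ x, u x * pd i v x = - ∫ x, pd i u x * v x := by
  have hu' := (hu.pd (m := 0) (by norm_num) i).continuous
  have hv' := (hv.pd (m := 0) (by norm_num) i).continuous
  refine integral_mul_fderiv_eq_neg_fderiv_mul_of_integrable ?_ ?_ ?_ ?_ ?_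
  · exact (hu'.mul hv.continuous).integrable_of_hasCompactSupport
      ((hasCompactSupport_pd hc i).mul_right)
  · exact (hu.continuous.mul hv').integrable_of_hasCompactSupport hc.mul_right
  · exact (hu.continuous.mul hv.continuous).integrable_of_hasCompactSupport hc.mul_right
  · exact fun x _ => hu.differentiable (by norm_num) x
  · exact fun x _ => hv.differentiable (by norm_num) x

/-- Green's second identity for a compactly supported function. -/
lemma integral_mul_lap {u v : Euc d → ℝ} (hu : ContDiff ℝ 2 u) (hv : ContDiff ℝ 2 v)
    (hc : HasCompactSupport u) : ∫ x, u x * lap v x = ∫ x, lap u x * v x := by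
  have hpu : ∀ i, ContDiff ℝ 1 (pd i u) := fun i => hu.pd (by norm_num) i
  have hpv : ∀ i, ContDiff ℝ 1 (pd i v) := fun i => hv.pd (by norm_num) i
  have hppu : ∀ i, Continuous (pd i (pd i u)) := fun i =>
    ((hpu i).pd (m := 0) (by norm_num) i).continuous
  have hppv : ∀ i, Continuous (pd i (pd i v)) := fun i =>
    ((hpv i).pd (m := 0) (by norm_num) i).continuous
  simp_rw [lap_eq_sum_pd hu.contDiffAt, lap_eq_sum_pd hv.contDiffAt, Finset.mul_sum,
    Finset.sum_mul]
  rw [integral_finsetSum, integral_finsetSum]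
  · refine Finset.sum_congr rfl fun i _ => ?_
    rw [integral_mul_pd (hu.of_le (by norm_num)) (hpv i) hc i,
      integral_mul_pd (hpu i) (hv.of_le (by norm_num)) (hasCompactSupport_pd hc i) i, neg_neg]
  · intro i _
    exact ((hppu i).mul hv.continuous).integrable_of_hasCompactSupport
      (hasCompactSupport_pd (hasCompactSupport_pd hc i) i).mul_right
  · intro i _
    exact (hu.continuous.mul (hppv i)).integrable_of_hasCompactSupport hc.mul_right

namespace IsTestFun

variable {f g : Euc d → ℝ}

lemma add (hf : IsTestFun f) (hg : IsTestFun g) : IsTestFun (f + g) :=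
  ⟨hf.1.add hg.1, hf.2.add hg.2⟩

lemma smul (c : ℝ) (hf : IsTestFun f) : IsTestFun (c • f) :=
  ⟨contDiff_const.smul hf.1, hf.2.smul_left (f := fun _ => c)⟩

lemma mul_left (hf : ContDiff ℝ (⊤ : ℕ∞) f) (hg : IsTestFun g) : IsTestFun (f * g) :=
  ⟨hf.mul hg.1, hg.2.mul_left⟩

lemma mul_right (hf : IsTestFun f) (hg : ContDiff ℝ (⊤ : ℕ∞) g) : IsTestFun (f * g) :=
  ⟨hf.1.mul hg, hf.2.mul_right⟩

lemma zero : IsTestFun (0 : Euc d → ℝ) := ⟨contDiff_const, HasCompactSupport.zero⟩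

lemma sub (hf : IsTestFun f) (hg : IsTestFun g) : IsTestFun (f - g) := by
  have := hf.add (hg.smul (-1))
  rwa [neg_one_smul, ← sub_eq_add_neg] at this

lemma sum {ι : Type*} (s : Finset ι) {F : ι → Euc d → ℝ} (hF : ∀ i ∈ s, IsTestFun (F i)) :
    IsTestFun (∑ i ∈ s, F i) := by
  classical
  induction s using Finset.induction_on with
  | empty => simpa using zero
  | insert a s ha ih =>
    rw [Finset.sum_insert ha]
    exact (hF a (by simp)).add (ih fun i hi => hF i (by simp [hi]))

lemma lap (hf : IsTestFun f) : IsTestFun (lap f) :=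
  ⟨hf.1.lap (by exact le_of_eq rfl), hf.2.of_isClosed_subset (isClosed_tsupport _) (tsupport_lap_subset f)⟩

lemma comp_affine (hf : IsTestFun f) (a : Euc d) {r : ℝ} (hr : r ≠ 0) :
    IsTestFun (fun y => f (a + r • y)) :=
  ⟨hf.1.comp (contDiff_const.add (contDiff_id.const_smul r)),
    hf.2.comp_homeomorph ((Homeomorph.smulOfNeZero r hr).trans (Homeomorph.addLeft a))⟩

lemma c2 (hf : IsTestFun f) : ContDiff ℝ 2 f := hf.1.of_le (WithTop.coe_le_coe.2 (le_top : (2 : ℕ∞) ≤ ⊤))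

lemma continuous (hf : IsTestFun f) : Continuous f := hf.1.continuous

end IsTestFun

end Calculus

namespace GFF

variable {d : ℕ} {Ω : Type} [MeasurableSpace Ω] (X : GFF d Ω)

/-- The covariance form `K₂`. -/
def cov (f g : Euc d → ℝ) : ℝ := ∫ ω, X.h 0 1 f ω * X.h 0 1 g ω ∂X.P

variable {X} {f g u v : Euc d → ℝ}

lemma memLp_h (hf : IsTestFun f) : MemLp (X.h 0 1 f) 2 X.P := by
  rw [memLp_two_iff_integrable_sq (X.meas_h 0 1 f).aestronglyMeasurable]
  have hm : Measurable fun ω => X.h 0 1 f ω ^ 2 := (X.meas_h 0 1 f).pow_const 2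
  have h2 : MemLp (fun ω => X.h 0 1 f ω ^ 2) 2 X.P := by
    rw [memLp_two_iff_integrable_sq hm.aestronglyMeasurable]
    refine (X.mom4 f hf).congr (ae_of_all _ fun ω => ?_)
    ring
  exact h2.integrable (by norm_num)

lemma integrable_mul_h (hf : IsTestFun f) (hg : IsTestFun g) :
    Integrable (fun ω => X.h 0 1 f ω * X.h 0 1 g ω) X.P :=
  (memLp_h hf).integrable_mul (memLp_h hg)

lemma cov_comm (f g : Euc d → ℝ) : X.cov f g = X.cov g f := by
  simp_rw [cov, mul_comm]

lemma cov_add_left (hf : IsTestFun f) (hg : IsTestFun g) (hu : IsTestFun u) :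
    X.cov (f + g) u = X.cov f u + X.cov g u := by
  unfold cov
  rw [← integral_add (integrable_mul_h hf hu) (integrable_mul_h hg hu)]
  refine integral_congr_ae ?_
  filter_upwards [X.lin_add f g hf hg] with ω h
  rw [h, add_mul]

lemma cov_smul_left (c : ℝ) (hf : IsTestFun f) : X.cov (c • f) u = c * X.cov f u := by
  unfold cov
  rw [← integral_const_mul]
  refine integral_congr_ae ?_
  filter_upwards [X.lin_smul c f hf] with ω h
  rw [h, mul_assoc]

lemma cov_add_right (hf : IsTestFun f) (hg : IsTestFun g) (hu : IsTestFun u) :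
    X.cov u (f + g) = X.cov u f + X.cov u g := by
  rw [cov_comm, cov_add_left hf hg hu, cov_comm f, cov_comm g]

lemma cov_smul_right (c : ℝ) (hf : IsTestFun f) : X.cov u (c • f) = c * X.cov u f := by
  rw [cov_comm, cov_smul_left c hf, cov_comm f]

lemma cov_zero_left : X.cov 0 u = 0 := by
  have := cov_smul_left (X := X) (u := u) 0 IsTestFun.zero
  simpa using this

lemma cov_sub_left (hf : IsTestFun f) (hg : IsTestFun g) (hu : IsTestFun u) :
    X.cov (f - g) u = X.cov f u - X.cov g u := by
  have := cov_add_left (X := X) hf (hg.smul (-1)) hu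
  rw [cov_smul_left _ hg, neg_one_smul, ← sub_eq_add_neg] at this
  rw [this]; ring

lemma cov_sub_right (hf : IsTestFun f) (hg : IsTestFun g) (hu : IsTestFun u) :
    X.cov u (f - g) = X.cov u f - X.cov u g := by
  rw [cov_comm, cov_sub_left hf hg hu, cov_comm f, cov_comm g]

lemma cov_sum_left {ι : Type*} (s : Finset ι) {F : ι → Euc d → ℝ} (hF : ∀ i ∈ s, IsTestFun (F i))
    (hu : IsTestFun u) : X.cov (∑ i ∈ s, F i) u = ∑ i ∈ s, X.cov (F i) u := by
  classical
  induction s using Finset.induction_on with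
  | empty => simp [cov_zero_left]
  | insert a s ha ih =>
    rw [Finset.sum_insert ha, Finset.sum_insert ha, cov_add_left (hF a (by simp))
      (IsTestFun.sum s fun i hi => hF i (by simp [hi])) hu, ih fun i hi => hF i (by simp [hi])]

lemma cov_self_nonneg (f : Euc d → ℝ) : 0 ≤ X.cov f f :=
  integral_nonneg fun _ => mul_self_nonneg _

lemma cov_sq_le (hf : IsTestFun f) (hg : IsTestFun g) :
    X.cov f g ^ 2 ≤ X.cov f f * X.cov g g := by
  have h : ∀ t : ℝ, 0 ≤ X.cov f f * (t * t) + (2 * X.cov f g) * t + X.cov g g := by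
    intro t
    have := cov_self_nonneg (X := X) (t • f + g)
    rw [cov_add_left (hf.smul t) hg ((hf.smul t).add hg), cov_add_right (hf.smul t) hg (hf.smul t),
      cov_add_right (hf.smul t) hg hg, cov_smul_left t hf, cov_smul_left t hf, cov_smul_right t hf,
      cov_smul_right t hf, cov_comm g f] at this
    linarith
  have := discrim_le_zero h
  unfold discrim at this
  nlinarith

lemma cov_eq_zero_of_tsupport (hg : IsTestFun g) (h : tsupport g ⊆ (ball (0 : Euc d) 1)ᶜ) :
    X.cov f g = 0 := by
  unfold cov
  refine integral_eq_zero_of_ae ?_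
  filter_upwards [X.zero_outside g hg h] with ω hω
  simp [hω]

section Markov

variable {a : Euc d} {r : ℝ}

lemma map_H_eq (hr : 0 < r) (hB : ball a r ⊆ ball (0 : Euc d) 1) {k : ℕ} {f : Fin k → Euc d → ℝ}
    (hf : ∀ i, IsTestFun (f i)) :
    Measure.map (fun ω (i : Fin k) => X.H a r (f i) ω) X.P
      = Measure.map (fun ω (i : Fin k) =>
          r ^ (1 + (d : ℝ) / 2) * X.h 0 1 (fun y => f i (a + r • y)) ω) X.P := by
  rw [X.dmp_law a r hr hB k f hf,
    ← X.scaling a r hr k (fun i y => f i (a + r • y)) fun i => (hf i).comp_affine a hr.ne']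
  congr 1
  ext ω i
  congr 1
  ext x
  rw [smul_smul, mul_inv_cancel₀ hr.ne', one_smul, add_sub_cancel]

lemma rpow_mul_rpow_eq (hr : 0 < r) (s t : ℝ) :
    r ^ (1 + (d : ℝ) / 2) * s * (r ^ (1 + (d : ℝ) / 2) * t) = r ^ (d + 2) * (s * t) := by
  have : r ^ (1 + (d : ℝ) / 2) * r ^ (1 + (d : ℝ) / 2) = r ^ (d + 2) := by
    rw [← Real.rpow_add hr, ← Real.rpow_natCast]
    congr 1; push_cast; ring
  rw [← this]; ring

lemma integral_H_mul_H (hr : 0 < r) (hB : ball a r ⊆ ball (0 : Euc d) 1)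
    (hf : IsTestFun f) (hg : IsTestFun g) :
    Integrable (fun ω => X.H a r f ω * X.H a r g ω) X.P ∧
    ∫ ω, X.H a r f ω * X.H a r g ω ∂X.P
      = r ^ (d + 2) * X.cov (fun y => f (a + r • y)) (fun y => g (a + r • y)) := by
  have hm := map_H_eq (X := X) hr hB (f := ![f, g])
    (by intro i; fin_cases i <;> simpa)
  have h1 : Measurable (fun ω (i : Fin 2) => X.H a r (![f, g] i) ω) :=
    measurable_pi_lambda _ fun i => X.meas_H _ _ _
  have h2 : Measurable (fun ω (i : Fin 2) => r ^ (1 + (d : ℝ) / 2) *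
      X.h 0 1 (fun y => ![f, g] i (a + r • y)) ω) :=
    measurable_pi_lambda _ fun i => (X.meas_h _ _ _).const_mul _
  have hφ : StronglyMeasurable (fun p : Fin 2 → ℝ => p 0 * p 1) :=
    (by fun_prop : Measurable (fun p : Fin 2 → ℝ => p 0 * p 1)).stronglyMeasurable
  have hf' := hf.comp_affine a hr.ne'
  have hg' := hg.comp_affine a hr.ne'
  constructor
  · have := (integrable_map_measure (μ := X.P) hφ.aestronglyMeasurable h1.aemeasurable)
    rw [hm, integrable_map_measure hφ.aestronglyMeasurable h2.aemeasurable] at this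
    refine this.1 ?_
    simp only [Function.comp_def, rpow_mul_rpow_eq hr]
    exact (integrable_mul_h hf' hg').const_mul _
  · have := integral_map (μ := X.P) h1.aemeasurable hφ.aestronglyMeasurable
    rw [hm, integral_map h2.aemeasurable hφ.aestronglyMeasurable] at this
    simp only [rpow_mul_rpow_eq hr, integral_const_mul] at this
    exact this.symm

lemma integral_H (hr : 0 < r) (hB : ball a r ⊆ ball (0 : Euc d) 1) (hf : IsTestFun f) :
    ∫ ω, X.H a r f ω ∂X.P = 0 := by
  have hm := map_H_eq (X := X) hr hB (f := ![f]) (by intro i; fin_cases i; simpa)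
  have h1 : Measurable (fun ω (i : Fin 1) => X.H a r (![f] i) ω) :=
    measurable_pi_lambda _ fun i => X.meas_H _ _ _
  have h2 : Measurable (fun ω (i : Fin 1) => r ^ (1 + (d : ℝ) / 2) *
      X.h 0 1 (fun y => ![f] i (a + r • y)) ω) :=
    measurable_pi_lambda _ fun i => (X.meas_h _ _ _).const_mul _
  have hφ : StronglyMeasurable (fun p : Fin 1 → ℝ => p 0) :=
    (measurable_pi_apply 0).stronglyMeasurable
  have := integral_map (μ := X.P) h1.aemeasurable hφ.aestronglyMeasurable
  rw [hm, integral_map h2.aemeasurable hφ.aestronglyMeasurable] at this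
  rw [integral_const_mul] at this
  have h3 := X.centered 0 1 _ (hf.comp_affine a hr.ne')
  simp only [Matrix.cons_val_fin_one] at this
  rw [h3, mul_zero] at this
  exact this.symm

lemma memLp_H (hr : 0 < r) (hB : ball a r ⊆ ball (0 : Euc d) 1) (hf : IsTestFun f) :
    MemLp (X.H a r f) 2 X.P := by
  rw [memLp_two_iff_integrable_sq (X.meas_H a r f).aestronglyMeasurable]
  simpa [sq] using (integral_H_mul_H hr hB hf hf).1

lemma exists_cutoff {K U : Set (Euc d)} (hK : IsCompact K) (hU : IsOpen U) (hKU : K ⊆ U) :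
    ∃ χ : Euc d → ℝ, IsTestFun χ ∧ tsupport χ ⊆ U ∧ (∀ᶠ x in 𝓝ˢ K, χ x = 1) ∧
      ∀ x, χ x ∈ Icc (0 : ℝ) 1 := by
  obtain ⟨L, hL, hKL, hLU⟩ := exists_compact_between hK hU hKU
  obtain ⟨M, hM, hLM, hMU⟩ := exists_compact_between hL hU hLU
  obtain ⟨χ, hχ⟩ := exists_contMDiff_support_eq_eq_one_iff (n := (⊤ : ℕ∞)) (modelWithCornersSelf ℝ (Euc d))
    (s := interior M) (t := L) isOpen_interior hL.isClosed hLM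
  have hs : tsupport χ ⊆ M := by
    rw [tsupport, hχ.2.2.1]
    exact closure_minimal interior_subset hM.isClosed
  refine ⟨χ, ⟨hχ.1.contDiff, hM.of_isClosed_subset (isClosed_tsupport _) hs⟩, hs.trans hMU, ?_, ?_⟩
  · have : interior L ∈ 𝓝ˢ K := (isOpen_interior.mem_nhdsSet).2 hKL
    filter_upwards [this] with x hx
    exact (hχ.2.2.2 x).1 (interior_subset hx)
  · exact fun x => hχ.2.1 (mem_range_self x)

/-- The harmonic part of the Markov decomposition does not see Laplacians. -/
lemma Phi_lap (hr : 0 < r) (hB : ball a r ⊆ ball (0 : Euc d) 1) (hu : IsTestFun u)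
    (hs : tsupport u ⊆ ball a r) : ∀ᵐ ω ∂X.P, X.Φ a r (lap u) ω = 0 := by
  obtain ⟨χ, hχ, hχs, hχ1, -⟩ := exists_cutoff hu.2 isOpen_ball hs
  filter_upwards [X.dmp_harm a r hr hB] with ω hω
  obtain ⟨⟨hc, hh⟩, h⟩ := hω
  rw [h _ hu.lap ((tsupport_lap_subset u).trans hs)]
  set φ := X.φharm a r ω
  have hw : ContDiff ℝ 2 fun x => χ x * φ x := by
    rw [contDiff_iff_contDiffAt]
    intro x
    by_cases hx : x ∈ tsupport χ
    · exact hχ.c2.contDiffAt.mul (hc.contDiffAt (isOpen_ball.mem_nhds (hχs hx)))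
    · refine contDiffAt_const (c := (0 : ℝ)) |>.congr_of_eventuallyEq ?_
      filter_upwards [(isClosed_tsupport χ).isOpen_compl.mem_nhds hx] with y hy
      rw [image_eq_zero_of_notMem_tsupport hy, zero_mul]
  have hwc : HasCompactSupport fun x => χ x * φ x := hχ.2.mul_right
  have key := integral_mul_lap hw hu.c2 hwc
  have h1 : ∫ x in ball a r, φ x * lap u x = ∫ x, χ x * φ x * lap u x := by
    rw [← integral_indicator measurableSet_ball]
    congr 1
    ext x
    by_cases hx : x ∈ tsupport u
    · rw [indicator_of_mem (hs hx), hχ1.self_of_nhdsSet x hx, one_mul]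
    · have : lap u x = 0 := image_eq_zero_of_notMem_tsupport fun h => hx (tsupport_lap_subset u h)
      simp [this, indicator]
  rw [h1, key]
  refine integral_eq_zero_of_ae (ae_of_all _ fun x => ?_)
  by_cases hx : x ∈ tsupport u
  · have : (fun x => χ x * φ x) =ᶠ[𝓝 x] φ := by
      filter_upwards [mem_nhdsSet_iff_forall.1 hχ1 x hx] with y hy
      rw [hy, one_mul]
    simp [lap_congr this, hh x (hs hx)]
  · simp [image_eq_zero_of_notMem_tsupport hx]

/-- The covariance of a Laplacian supported in a ball is the covariance of the field in that
ball. -/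
lemma cov_lap_eq (hr : 0 < r) (hB : ball a r ⊆ ball (0 : Euc d) 1) (hu : IsTestFun u)
    (hs : tsupport u ⊆ ball a r) (hg : IsTestFun g) :
    X.cov (lap u) g
      = r ^ d * X.cov (lap fun y => u (a + r • y)) fun y => g (a + r • y) := by
  have hl := hu.lap
  have hΦ : MemLp (X.Φ a r g) 2 X.P := by
    refine ((memLp_h hg).sub (memLp_H hr hB hg)).ae_eq ?_
    filter_upwards [X.dmp_decomp a r hr hB g hg] with ω h
    simp [h]
  have hind : IndepFun (X.H a r (lap u)) (X.Φ a r g) X.P := by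
    rw [IndepFun_iff_Indep]
    refine indep_of_indep_of_le_left (indep_of_indep_of_le_right (X.dmp_indep a r hr hB) ?_) ?_
    · refine le_trans ?_ le_sup_left
      exact le_iSup (fun f : {f : Euc d → ℝ // IsTestFun f} =>
        MeasurableSpace.comap (X.Φ a r f.1) inferInstance) ⟨g, hg⟩
    · exact le_iSup (fun f : {f : Euc d → ℝ // IsTestFun f} =>
        MeasurableSpace.comap (X.H a r f.1) inferInstance) ⟨lap u, hl⟩
  have h0 : ∫ ω, X.H a r (lap u) ω * X.Φ a r g ω ∂X.P = 0 := by
    have := hind.integral_mul_eq_mul_integral (X.meas_H _ _ _).aestronglyMeasurable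
      (X.meas_Φ _ _ _).aestronglyMeasurable
    simp only [Pi.mul_apply] at this
    rw [this, integral_H hr hB hl, zero_mul]
  have hcov : X.cov (lap u) g = ∫ ω, (X.H a r (lap u) ω * X.H a r g ω
      + X.H a r (lap u) ω * X.Φ a r g ω) ∂X.P := by
    unfold cov
    refine integral_congr_ae ?_
    filter_upwards [X.dmp_decomp a r hr hB g hg, X.dmp_decomp a r hr hB _ hl,
      Phi_lap hr hB hu hs] with ω h1 h2 h3
    rw [h1, h2, h3]; ring
  have hI : Integrable (fun ω => X.H a r (lap u) ω * X.Φ a r g ω) X.P :=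
    (memLp_H hr hB hl).integrable_mul hΦ
  rw [hcov, integral_add (integral_H_mul_H hr hB hl hg).1 hI, h0, add_zero, (integral_H_mul_H hr hB hl hg).2]
  have : (lap fun y => u (a + r • y)) = r ^ 2 • fun y => lap u (a + r • y) := by
    ext y
    simp [lap_comp_affine hu.c2]
  rw [this, cov_smul_left _ (hl.comp_affine a hr.ne')]
  ring

/-- Locality of the covariance of a Laplacian. -/
lemma cov_lap_eq_zero (hr : 0 < r) (hB : ball a r ⊆ ball (0 : Euc d) 1) (hu : IsTestFun u)
    (hs : tsupport u ⊆ ball a r) (hg : IsTestFun g) (hgs : tsupport g ⊆ (ball a r)ᶜ) :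
    X.cov (lap u) g = 0 := by
  rw [cov_lap_eq hr hB hu hs hg, cov_eq_zero_of_tsupport (hg.comp_affine a hr.ne'), mul_zero]
  have : tsupport (fun y => g (a + r • y)) ⊆ (fun y : Euc d => a + r • y) ⁻¹' tsupport g :=
    tsupport_comp_subset_preimage g (by fun_prop)
  intro y hy hyb
  refine hgs (this hy) ?_
  simp only [mem_ball, dist_eq_norm, sub_zero, add_sub_cancel_left, norm_smul] at hyb ⊢
  rw [Real.norm_of_nonneg hr.le]
  nlinarith

end Markov

end GFF

section Average

variable {d : ℕ} {Y : Type*} [MeasurableSpace Y] {μ : Measure Y} {a : Y → ℝ} {b b' : Y → Euc d}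
  {F : Type*} [NormedAddCommGroup F] [NormedSpace ℝ F]

lemma integrable_smul_translate (ha : Integrable a μ) (hb : Measurable b) {w : Euc d → F}
    (hw : Continuous w) (hwc : HasCompactSupport w) (x : Euc d) :
    Integrable (fun y => a y • w (x - b y)) μ := by
  obtain ⟨C, hC⟩ := hw.bounded_above_of_compact_support hwc
  refine ha.smul_bdd C ?_ (ae_of_all _ fun y => hC _)
  exact (hw.comp_stronglyMeasurable (measurable_const.sub hb).stronglyMeasurable).aestronglyMeasurable

lemma hasFDerivAt_average [CompleteSpace F] (ha : Integrable a μ) (hb : Measurable b)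
    {w : Euc d → F} (hw : ContDiff ℝ 1 w) (hwc : HasCompactSupport w) (x : Euc d) :
    HasFDerivAt (fun x => ∫ y, a y • w (x - b y) ∂μ) (∫ y, a y • fderiv ℝ w (x - b y) ∂μ) x := by
  have hw' : Continuous (fderiv ℝ w) := hw.continuous_fderiv one_ne_zero
  obtain ⟨C, hC⟩ := hw'.bounded_above_of_compact_support (hwc.fderiv ℝ)
  refine hasFDerivAt_integral_of_dominated_of_fderiv_le (s := univ) (bound := fun y => ‖a y‖ * C)
    (F' := fun x y => a y • fderiv ℝ w (x - b y))
    univ_mem (Eventually.of_forall fun x =>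
      (integrable_smul_translate ha hb hw.continuous hwc x).aestronglyMeasurable)
    (integrable_smul_translate ha hb hw.continuous hwc x)
    (integrable_smul_translate ha hb hw' (hwc.fderiv ℝ) x).aestronglyMeasurable
    (ae_of_all _ fun y z _ => ?_) (ha.norm.mul_const C) (ae_of_all _ fun y z _ => ?_)
  · rw [norm_smul]
    exact mul_le_mul_of_nonneg_left (hC _) (norm_nonneg _)
  · have h1 := ((hw.differentiable one_ne_zero) (z - b y)).hasFDerivAt
    have h2 := h1.comp z ((hasFDerivAt_id z).sub_const (b y))
    rw [ContinuousLinearMap.comp_id] at h2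
    exact h2.const_smul (a y)

variable {w : Euc d → ℝ}

lemma iteratedFDeriv_average (ha : Integrable a μ) (hb : Measurable b) (hw : IsTestFun w) (m : ℕ) :
    iteratedFDeriv ℝ m (fun x => ∫ y, a y * w (x - b y) ∂μ)
      = fun x => ∫ y, a y • iteratedFDeriv ℝ m w (x - b y) ∂μ := by
  induction m with
  | zero =>
    ext x v
    rw [ContinuousMultilinearMap.integral_apply (integrable_smul_translate ha hb
      (hw.1.continuous_iteratedFDeriv (by simp)) (hw.2.iteratedFDeriv 0) x)]
    simp
  | succ m ih =>
    have hc : ContDiff ℝ 1 (iteratedFDeriv ℝ m w) :=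
      hw.1.iteratedFDeriv_right (m := 1) (by exact_mod_cast le_top)
    ext x v
    rw [iteratedFDeriv_succ_apply_left, ih, (hasFDerivAt_average ha hb hc (hw.2.iteratedFDeriv m) x).fderiv,
      ContinuousLinearMap.integral_apply (integrable_smul_translate ha hb
        (hc.continuous_fderiv one_ne_zero) ((hw.2.iteratedFDeriv m).fderiv ℝ) x),
      ContinuousMultilinearMap.integral_apply, ContinuousMultilinearMap.integral_apply]
    · rfl
    · exact integrable_smul_translate ha hb (hw.1.continuous_iteratedFDeriv (by exact_mod_cast le_top))
        (hw.2.iteratedFDeriv (m + 1)) x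
    · exact (integrable_smul_translate ha hb
        (hc.continuous_fderiv one_ne_zero) ((hw.2.iteratedFDeriv m).fderiv ℝ) x).apply_continuousLinearMap _

lemma contDiff_average (ha : Integrable a μ) (hb : Measurable b) (hw : IsTestFun w) :
    ContDiff ℝ (⊤ : ℕ∞) (fun x => ∫ y, a y * w (x - b y) ∂μ) := by
  refine contDiff_of_differentiable_iteratedFDeriv fun m _ => ?_
  rw [iteratedFDeriv_average ha hb hw]
  exact fun x => (hasFDerivAt_average ha hb (hw.1.iteratedFDeriv_right (m := 1)
    (by exact_mod_cast le_top)) (hw.2.iteratedFDeriv m) x).differentiableAt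

lemma tendstoUniformly_average (ha : Integrable a μ) (hb : Measurable b) {s : ℕ → Y → Euc d}
    (hs : ∀ n, Measurable (s n))
    (hlim : ∀ ε > 0, ∀ᶠ n in atTop, ∀ᵐ y ∂μ, ‖s n y - b y‖ < ε) (hw : IsTestFun w) (m : ℕ) :
    TendstoUniformly (fun n => iteratedFDeriv ℝ m (fun x => ∫ y, a y * w (x - s n y) ∂μ))
      (iteratedFDeriv ℝ m (fun x => ∫ y, a y * w (x - b y) ∂μ)) atTop := by
  have hcont : Continuous (iteratedFDeriv ℝ m w) :=
    hw.1.continuous_iteratedFDeriv (by exact_mod_cast le_top)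
  have huc := (hw.2.iteratedFDeriv (𝕜 := ℝ) m).uniformContinuous_of_continuous hcont
  rw [Metric.tendstoUniformly_iff]
  intro ε hε
  set A := ∫ y, ‖a y‖ ∂μ
  have hA : 0 ≤ A := integral_nonneg fun _ => norm_nonneg _
  obtain ⟨δ, hδ, h⟩ := Metric.uniformContinuous_iff.1 huc (ε / (A + 1)) (by positivity)
  filter_upwards [hlim δ hδ] with n hn x
  rw [iteratedFDeriv_average ha hb hw, iteratedFDeriv_average ha (hs n) hw, dist_eq_norm,
    ← integral_sub (integrable_smul_translate ha hb hcont (hw.2.iteratedFDeriv m) x)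
      (integrable_smul_translate ha (hs n) hcont (hw.2.iteratedFDeriv m) x)]
  calc _ ≤ ∫ y, ‖a y‖ * (ε / (A + 1)) ∂μ := by
        refine norm_integral_le_of_norm_le (ha.norm.mul_const _) ?_
        filter_upwards [hn] with y hy
        rw [← smul_sub, norm_smul]
        refine mul_le_mul_of_nonneg_left ?_ (norm_nonneg _)
        rw [← dist_eq_norm]
        refine (h ?_).le
        rwa [dist_eq_norm, sub_sub_sub_cancel_left]
    _ = A * (ε / (A + 1)) := integral_mul_const _ _
    _ < ε := by
        rw [mul_div_assoc', div_lt_iff₀ (by positivity)]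
        nlinarith

end Average

section Riemann

variable {d : ℕ}

lemma exists_simpleFunc_near {K : Set (Euc d)} (hK : IsCompact K) (hne : K.Nonempty) {ε : ℝ}
    (hε : 0 < ε) : ∃ s : SimpleFunc (Euc d) (Euc d), (∀ y, s y ∈ K) ∧ ∀ y ∈ K, ‖s y - y‖ < ε := by
  have := hne.to_subtype
  let e : ℕ → Euc d := fun n => (TopologicalSpace.denseSeq K n : K)
  obtain ⟨N, hN⟩ := hK.elim_directed_cover (fun N => ⋃ k ∈ Finset.range (N + 1), ball (e k) ε)
    (fun N => isOpen_biUnion fun _ _ => isOpen_ball) (by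
      intro y hy
      obtain ⟨n, hn⟩ := (TopologicalSpace.denseRange_denseSeq K).exists_dist_lt ⟨y, hy⟩ hε
      simp only [mem_iUnion]
      exact ⟨n, n, by simp, hn⟩)
    (monotone_nat_of_le_succ (fun N => biUnion_subset_biUnion_left
      (Finset.range_mono (by omega)))).directed_le
  refine ⟨SimpleFunc.nearestPt e N, fun y => ?_, fun y hy => ?_⟩
  · simp only [SimpleFunc.nearestPt, SimpleFunc.map_apply]
    exact Subtype.coe_prop _
  · have := hN hy
    simp only [mem_iUnion, Finset.mem_range] at this
    obtain ⟨k, hk, hy⟩ := this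
    rw [← dist_eq_norm]
    have h1 := SimpleFunc.edist_nearestPt_le e y (show k ≤ N by omega)
    rw [edist_dist, edist_dist, ENNReal.ofReal_le_ofReal_iff dist_nonneg] at h1
    exact h1.trans_lt (by rwa [dist_comm])

lemma integral_mul_simpleFunc {Y Z : Type*} [MeasurableSpace Y] {μ : Measure Y} {a : Y → ℝ}
    (ha : Integrable a μ) (s : SimpleFunc Y Z) (φ : Z → ℝ) :
    ∫ y, a y * φ (s y) ∂μ = ∑ z ∈ s.range, (∫ y in s ⁻¹' {z}, a y ∂μ) * φ z := by
  have h : ∀ y, a y * φ (s y) = ∑ z ∈ s.range, (s ⁻¹' {z}).indicator (fun y => a y * φ z) y := by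
    intro y
    rw [Finset.sum_eq_single (s y)]
    · simp
    · intro z _ hz
      exact indicator_of_notMem (by simpa using hz.symm) _
    · simp
  simp_rw [h]
  rw [integral_finsetSum]
  · refine Finset.sum_congr rfl fun z _ => ?_
    rw [integral_indicator (s.measurableSet_fiber z), integral_mul_const]
  · exact fun z _ => (ha.mul_const _).indicator (s.measurableSet_fiber z)

lemma tendstoUniformly_mul_zero {χ : Euc d → ℝ} (hχ : IsTestFun χ) {h : ℕ → Euc d → ℝ}
    (hh : ∀ n, ContDiff ℝ (⊤ : ℕ∞) (h n)) {δ : ℕ → ℝ} (hδ : Tendsto δ atTop (𝓝 0))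
    (hb : ∀ j : ℕ, ∃ C, ∀ n, ∀ x ∈ tsupport χ, ‖iteratedFDeriv ℝ j (h n) x‖ ≤ C * δ n) (m : ℕ) :
    TendstoUniformly (fun n => iteratedFDeriv ℝ m (χ * h n)) (iteratedFDeriv ℝ m (0 : Euc d → ℝ))
      atTop := by
  choose C hC using hb
  have hA : ∀ j : ℕ, ∃ A, ∀ x, ‖iteratedFDeriv ℝ j χ x‖ ≤ A := fun j =>
    (hχ.2.iteratedFDeriv j).exists_bound_of_continuous
      (hχ.1.continuous_iteratedFDeriv (by exact_mod_cast le_top))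
  choose A hA using hA
  have hlim : Tendsto (fun n => ∑ i ∈ Finset.range (m + 1), (m.choose i) * A i * (C (m - i) * δ n))
      atTop (𝓝 0) := by
    have : Tendsto (fun n => (∑ i ∈ Finset.range (m + 1), (m.choose i) * A i * C (m - i)) * δ n)
      atTop (𝓝 ((∑ i ∈ Finset.range (m + 1), (m.choose i) * A i * C (m - i)) * 0)) :=
      tendsto_const_nhds.mul hδ
    rw [mul_zero] at this
    refine this.congr fun n => ?_
    rw [Finset.sum_mul]
    exact Finset.sum_congr rfl fun i _ => by ring
  have h0 : iteratedFDeriv ℝ m (0 : Euc d → ℝ) = 0 := iteratedFDeriv_fun_zero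
  rw [Metric.tendstoUniformly_iff]
  intro ε hε
  filter_upwards [hlim.eventually (gt_mem_nhds hε)] with n hn x
  rw [h0, dist_eq_norm, Pi.zero_apply, zero_sub, norm_neg]
  by_cases hx : x ∈ tsupport χ
  · refine lt_of_le_of_lt ?_ hn
    refine (norm_iteratedFDeriv_mul_le hχ.1 (hh n) x (n := m) (by exact_mod_cast le_top)).trans ?_
    refine Finset.sum_le_sum fun i _ => ?_
    exact mul_le_mul (mul_le_mul_of_nonneg_left (hA _ _) (by positivity)) (hC _ _ _ hx)
      (norm_nonneg _) (mul_nonneg (by positivity) ((norm_nonneg _).trans (hA i x)))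
  · have hz : iteratedFDeriv ℝ m (χ * h n) x = 0 := by
      refine image_eq_zero_of_notMem_tsupport fun h' => hx ?_
      exact tsupport_mul_subset_left (tsupport_iteratedFDeriv_subset m h')
    rwa [hz, norm_zero]

lemma lap_sum_smul {ι : Type*} (s : Finset ι) (c : ι → ℝ) {F : ι → Euc d → ℝ}
    (hF : ∀ i, IsTestFun (F i)) : lap (∑ i ∈ s, c i • F i) = ∑ i ∈ s, c i • lap (F i) := by
  classical
  induction s using Finset.induction_on with
  | empty =>
    ext x
    have h := lap_const_mul (u := (0 : Euc d → ℝ)) (x := x) 0 contDiffAt_const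
    rw [zero_mul] at h
    simp only [zero_mul] at h
    exact h
  | insert a s ha ih =>
    rw [Finset.sum_insert ha, Finset.sum_insert ha, ← ih]
    ext x
    have h1 := lap_add (u := c a • F a) (v := ∑ i ∈ s, c i • F i) (x := x)
      ((hF a).smul _).c2.contDiffAt (IsTestFun.sum s fun i _ => (hF i).smul (c i)).c2.contDiffAt
    have h2 := lap_const_mul (c a) (hF a).c2.contDiffAt (x := x)
    exact h1.trans (congrArg (· + _) h2)

end Riemann

namespace GFF

variable {d : ℕ} {Ω : Type} [MeasurableSpace Ω] {X : GFF d Ω} {g : Euc d → ℝ}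

lemma tendsto_cov_lap {u : ℕ → Euc d → ℝ} {u₀ : Euc d → ℝ} {K : Set (Euc d)} (hK : IsCompact K)
    (hKB : K ⊆ ball 0 1) (hu : ∀ n, IsTestFun (u n)) (hu₀ : IsTestFun u₀) (hg : IsTestFun g)
    (hgs : tsupport g ⊆ ball 0 1) (hs : ∀ n, tsupport (u n) ⊆ K) (hs₀ : tsupport u₀ ⊆ K)
    (hlim : ∀ m : ℕ, TendstoUniformly (fun n => iteratedFDeriv ℝ m (u n)) (iteratedFDeriv ℝ m u₀)
      atTop) :
    Tendsto (fun n => X.cov (lap (u n)) g) atTop (𝓝 (X.cov (lap u₀) g)) := by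
  refine X.K2_cont (fun n => lap (u n)) (lap u₀) g K hK hKB (fun n => (hu n).lap) hu₀.lap hg hgs
    (fun n => (tsupport_lap_subset _).trans (hs n)) ((tsupport_lap_subset _).trans hs₀) fun m => ?_
  obtain ⟨C, hC, h⟩ := norm_iteratedFDeriv_lap_le d
  rw [Metric.tendstoUniformly_iff]
  intro ε hε
  filter_upwards [Metric.tendstoUniformly_iff.1 (hlim (m + 2)) (ε / (C + 1)) (by positivity)]
    with n hn x
  have hl : lap u₀ - lap (u n) = lap (u₀ - u n) := by
    ext x
    exact (lap_sub hu₀.c2.contDiffAt (hu n).c2.contDiffAt).symm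
  have h1 := h (u₀ - u n) (hu₀.sub (hu n)).1 m x
  have hle : ∀ k : ℕ, (k : WithTop ℕ∞) ≤ ((⊤ : ℕ∞) : WithTop ℕ∞) := fun k => by
    exact_mod_cast le_top
  rw [← hl, iteratedFDeriv_sub (hu₀.lap.1.of_le (hle _)) ((hu n).lap.1.of_le (hle _)),
    iteratedFDeriv_sub (hu₀.1.of_le (hle _)) ((hu n).1.of_le (hle _)), Pi.sub_apply, Pi.sub_apply,
    ← dist_eq_norm, ← dist_eq_norm] at h1
  refine h1.trans_lt ?_
  have h2 := hn x
  rw [lt_div_iff₀ (by positivity)] at h2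
  have := dist_nonneg (x := iteratedFDeriv ℝ (m + 2) u₀ x) (y := iteratedFDeriv ℝ (m + 2) (u n) x)
  linarith

lemma average_tsupport_subset {Y : Type*} [MeasurableSpace Y] {μ : Measure Y} {a : Y → ℝ}
    {b : Y → Euc d} {w : Euc d → ℝ} {K : Set (Euc d)} (hK : IsClosed K)
    (h : ∀ᵐ y ∂μ, ∀ x, x - b y ∈ tsupport w → x ∈ K) :
    tsupport (fun x => ∫ y, a y * w (x - b y) ∂μ) ⊆ K := by
  refine closure_minimal (fun x hx => ?_) hK
  by_contra hxK
  refine hx (integral_eq_zero_of_ae ?_)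
  filter_upwards [h] with y hy
  rw [image_eq_zero_of_notMem_tsupport fun h => hxK (hy x h), mul_zero, Pi.zero_apply]

lemma isTestFun_average {Y : Type*} [MeasurableSpace Y] {μ : Measure Y} {a : Y → ℝ}
    {b : Y → Euc d} {w : Euc d → ℝ} {K : Set (Euc d)} (hK : IsCompact K) (ha : Integrable a μ)
    (hb : Measurable b) (hw : IsTestFun w) (h : ∀ᵐ y ∂μ, ∀ x, x - b y ∈ tsupport w → x ∈ K) :
    IsTestFun (fun x => ∫ y, a y * w (x - b y) ∂μ) :=
  ⟨contDiff_average ha hb hw, hK.of_isClosed_subset (isClosed_tsupport _)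
    (average_tsupport_subset hK.isClosed h)⟩

lemma _root_.IsTestFun.comp_sub {w : Euc d → ℝ} (hw : IsTestFun w) (z : Euc d) :
    IsTestFun fun x => w (x - z) := by
  have := hw.comp_affine (-z) one_ne_zero
  simpa [neg_add_eq_sub] using this

/-- If the covariance of `g` with the Laplacians of all translates of `w` is close to `c * g`, the
same holds for averages of translates. -/
lemma abs_cov_lap_average_sub_le {K K' : Set (Euc d)} (hK : IsCompact K) (hne : K.Nonempty)
    (hK' : IsCompact K') (hKB : K' ⊆ ball 0 1) {w : Euc d → ℝ} (hw : IsTestFun w)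
    (hwK : ∀ y ∈ K, ∀ x, x - y ∈ tsupport w → x ∈ K') (hg : IsTestFun g)
    (hgs : tsupport g ⊆ ball 0 1) {a : Euc d → ℝ} (ha : IntegrableOn a K) {c ε : ℝ}
    (h : ∀ y ∈ K, |X.cov (lap fun x => w (x - y)) g - c * g y| ≤ ε) :
    |X.cov (lap fun x => ∫ y in K, a y * w (x - y)) g - c * ∫ y in K, a y * g y|
      ≤ ε * ∫ y in K, |a y| := by
  have hs : ∀ n : ℕ, ∃ s : SimpleFunc (Euc d) (Euc d), (∀ y, s y ∈ K) ∧
      ∀ y ∈ K, ‖s y - y‖ < 1 / ((n : ℝ) + 1) := fun n => exists_simpleFunc_near hK hne (by positivity)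
  choose s hsK hs using hs
  have hlim : ∀ ε > 0, ∀ᶠ n in atTop, ∀ᵐ y ∂(volume.restrict K), ‖s n y - y‖ < ε := by
    intro ε hε
    filter_upwards [(tendsto_one_div_add_atTop_nhds_zero_nat (𝕜 := ℝ)).eventually
      (gt_mem_nhds hε)] with n hn
    filter_upwards [ae_restrict_mem hK.measurableSet] with y hy using (hs n y hy).trans hn
  have hsupp : ∀ n, ∀ᵐ y ∂(volume.restrict K), ∀ x, x - s n y ∈ tsupport w → x ∈ K' :=
    fun n => ae_of_all _ fun y => hwK _ (hsK n y)
  have hsupp₀ : ∀ᵐ y ∂(volume.restrict K), ∀ x, x - y ∈ tsupport w → x ∈ K' := by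
    filter_upwards [ae_restrict_mem hK.measurableSet] with y hy using hwK y hy
  have hT := tendsto_cov_lap (X := X) hK' hKB
    (fun n => isTestFun_average hK' ha (s n).measurable hw (hsupp n))
    (isTestFun_average hK' ha measurable_id hw hsupp₀) hg hgs
    (fun n => average_tsupport_subset hK'.isClosed (hsupp n))
    (average_tsupport_subset hK'.isClosed hsupp₀)
    (tendstoUniformly_average ha measurable_id (fun n => (s n).measurable) hlim hw)
  have hG : Tendsto (fun n => ∫ y in K, a y * g (s n y)) atTop (𝓝 (∫ y in K, a y * g y)) := by
    obtain ⟨C, hC⟩ := hg.2.exists_bound_of_continuous hg.continuous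
    refine tendsto_integral_of_dominated_convergence (fun y => ‖a y‖ * C) (fun n => ?_)
      (ha.norm.mul_const C) (fun n => ae_of_all _ fun y => ?_) ?_
    · exact ha.aestronglyMeasurable.mul (hg.continuous.comp_stronglyMeasurable
        (s n).measurable.stronglyMeasurable).aestronglyMeasurable
    · rw [norm_mul]
      exact mul_le_mul_of_nonneg_left (hC _) (norm_nonneg _)
    · filter_upwards [ae_restrict_mem hK.measurableSet] with y hy
      refine tendsto_const_nhds.mul ((hg.continuous.tendsto y).comp ?_)
      rw [tendsto_iff_norm_sub_tendsto_zero]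
      exact squeeze_zero (fun _ => norm_nonneg _) (fun n => (hs n y hy).le)
        tendsto_one_div_add_atTop_nhds_zero_nat
  refine le_of_tendsto ((hT.sub (hG.const_mul c)).abs) (Eventually.of_forall fun n => ?_)
  have h1 : (lap fun x => ∫ y in K, a y * w (x - s n y)) = ∑ z ∈ (s n).range,
      (∫ y in s n ⁻¹' {z}, a y ∂(volume.restrict K)) • lap fun x => w (x - z) := by
    have : (fun x => ∫ y in K, a y * w (x - s n y)) = ∑ z ∈ (s n).range,
        (∫ y in s n ⁻¹' {z}, a y ∂(volume.restrict K)) • fun x => w (x - z) := by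
      ext x
      rw [integral_mul_simpleFunc ha (s n) (fun z => w (x - z))]
      simp
    rw [this, lap_sum_smul _ _ fun z => hw.comp_sub z]
  rw [h1, cov_sum_left _ (fun z _ => ((hw.comp_sub z).lap).smul _) hg,
    integral_mul_simpleFunc ha (s n) g, Finset.mul_sum, ← Finset.sum_sub_distrib]
  calc _ ≤ ∑ z ∈ (s n).range, |∫ y in s n ⁻¹' {z}, a y ∂(volume.restrict K)| * ε := by
        refine (Finset.abs_sum_le_sum_abs _ _).trans (Finset.sum_le_sum fun z hz => ?_)
        rw [cov_smul_left _ ((hw.comp_sub z).lap)]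
        obtain ⟨y, rfl⟩ := SimpleFunc.mem_range.1 hz
        rw [show ∀ p q r : ℝ, p * q - c * (p * r) = p * (q - c * r) by intros; ring, abs_mul]
        exact mul_le_mul_of_nonneg_left (h _ (hsK n y)) (abs_nonneg _)
    _ ≤ ∑ z ∈ (s n).range, (∫ y in s n ⁻¹' {z}, |a y| ∂(volume.restrict K)) * ε := by
        obtain ⟨y, hy⟩ := hne
        have hε : 0 ≤ ε := (abs_nonneg _).trans (h y hy)
        exact Finset.sum_le_sum fun z _ => mul_le_mul_of_nonneg_right
          (abs_integral_le_integral_abs) hε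
    _ = ε * ∫ y in K, |a y| := by
        rw [← integral_mul_simpleFunc ha.abs (s n) (fun _ => ε), integral_mul_const, mul_comm]

end GFF

namespace GFF

variable {d : ℕ} {Ω : Type} [MeasurableSpace Ω] {X : GFF d Ω} {g : Euc d → ℝ}

lemma exists_forall_abs_cov_sub_le {p χ : Euc d → ℝ} (hp : IsTestFun p) (hps : tsupport p ⊆ ball 0 1)
    (hχ : IsTestFun χ) (hχs : tsupport χ ⊆ ball 0 1) (hg : IsTestFun g) {ε : ℝ} (hε : 0 < ε) :
    ∃ r₀ > (0 : ℝ), ∀ r : ℝ, 0 < r → r < r₀ → ∀ z : Euc d,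
      |X.cov p (χ * fun y => g (z + r • y)) - X.cov p χ * g z| ≤ ε := by
  by_contra! hcon
  have : ∀ n : ℕ, ∃ r : ℝ, 0 < r ∧ r < 1 / ((n : ℝ) + 1) ∧ ∃ z : Euc d,
      ε < |X.cov p (χ * fun y => g (z + r • y)) - X.cov p χ * g z| := fun n => by
    obtain ⟨r, h1, h2, h3⟩ := hcon (1 / ((n : ℝ) + 1)) (by positivity)
    exact ⟨r, h1, h2, h3⟩
  choose r hr hr' z hz using this
  set h : ℕ → Euc d → ℝ := fun n y => g (z n + r n • y) - g (z n) with hh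
  have hsm : ∀ n, ContDiff ℝ (⊤ : ℕ∞) (h n) := fun n =>
    (hg.1.comp (contDiff_const.add (contDiff_id.const_smul (r n)))).sub contDiff_const
  have hlim : ∀ m : ℕ, TendstoUniformly (fun n => iteratedFDeriv ℝ m (χ * h n))
      (iteratedFDeriv ℝ m (0 : Euc d → ℝ)) atTop := by
    refine tendstoUniformly_mul_zero hχ hsm (tendsto_one_div_add_atTop_nhds_zero_nat (𝕜 := ℝ)) ?_
    intro j
    rcases Nat.eq_zero_or_pos j with rfl | hj
    · obtain ⟨C, hC⟩ := (hg.2.fderiv ℝ).exists_bound_of_continuous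
        (hg.c2.continuous_fderiv (by norm_num))
      refine ⟨C, fun n x hx => ?_⟩
      have hC0 : 0 ≤ C := (norm_nonneg _).trans (hC 0)
      have h1 := Convex.norm_image_sub_le_of_norm_fderiv_le (𝕜 := ℝ) (s := univ) (f := g) (C := C)
        (x := z n) (y := z n + r n • x) (fun x _ => hg.c2.differentiable (by norm_num) x)
        (fun x _ => hC x) convex_univ (mem_univ _) (mem_univ _)
      rw [norm_iteratedFDeriv_zero]
      refine h1.trans (mul_le_mul_of_nonneg_left ?_ hC0)
      rw [add_sub_cancel_left, norm_smul, Real.norm_of_nonneg (hr n).le]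
      have h2 : ‖x‖ < 1 := by simpa using hχs hx
      nlinarith [hr n, hr' n, norm_nonneg x]
    · obtain ⟨C, hC⟩ := (hg.2.iteratedFDeriv (𝕜 := ℝ) j).exists_bound_of_continuous
        (hg.1.continuous_iteratedFDeriv (by exact_mod_cast le_top))
      refine ⟨C, fun n x hx => ?_⟩
      have hC0 : 0 ≤ C := (norm_nonneg _).trans (hC 0)
      have h1 : iteratedFDeriv ℝ j (h n) x = r n ^ j • iteratedFDeriv ℝ j g (z n + r n • x) := by
        have e1 : h n = (fun y => g (z n + r n • y)) - fun _ => g (z n) := rfl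
        have hcg : ContDiff ℝ j fun y => g (z n + y) :=
          (hg.1.of_le (by exact_mod_cast le_top)).comp (contDiff_const.add contDiff_id)
        rw [e1, iteratedFDeriv_sub_apply, iteratedFDeriv_const_of_ne hj.ne', Pi.zero_apply, sub_zero,
          iteratedFDeriv_comp_const_smul (f := fun y => g (z n + y)) (r n) hcg,
          iteratedFDeriv_comp_add_left']
        · exact (hcg.comp (contDiff_id.const_smul (r n))).contDiffAt
        · exact contDiffAt_const
      rw [h1, norm_smul, norm_pow, Real.norm_of_nonneg (hr n).le, mul_comm]
      refine mul_le_mul (hC _) ?_ (pow_nonneg (hr n).le _) hC0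
      have h3 : r n ≤ 1 := (hr' n).le.trans (by
        rw [div_le_one (by positivity)]; linarith [(n.cast_nonneg : (0 : ℝ) ≤ n)])
      calc r n ^ j ≤ r n ^ 1 := pow_le_pow_of_le_one (hr n).le h3 hj
        _ ≤ _ := by rw [pow_one]; exact (hr' n).le
  have key := X.K2_cont (fun n => χ * h n) 0 p (tsupport χ) hχ.2 hχs
    (fun n => hχ.mul_right (hsm n)) IsTestFun.zero hp hps (fun n => tsupport_mul_subset_left)
    (by simp [tsupport]) hlim
  have h0 : Tendsto (fun n => X.cov (χ * h n) p) atTop (𝓝 0) := by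
    have := cov_zero_left (X := X) (u := p)
    rw [← this]
    exact key
  have hev := h0.eventually (Metric.ball_mem_nhds 0 hε)
  obtain ⟨n, hn⟩ := hev.exists
  have e2 : χ * h n = (χ * fun y => g (z n + r n • y)) - g (z n) • χ := by
    ext y
    simp [hh]
    ring
  rw [e2, cov_sub_left (hχ.mul_right (hg.comp_affine _ (hr n).ne').1) (hχ.smul _) hp,
    cov_smul_left _ hχ, cov_comm, cov_comm χ, Real.dist_0_eq_abs,
    mul_comm (g (z n))] at hn
  exact (hz n).not_gt hn

/-- The covariance form inverts the Laplacian up to a constant. -/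
theorem exists_cov_lap_eq (X : GFF d Ω) : ∃ c : ℝ, ∀ u g : Euc d → ℝ, IsTestFun u → IsTestFun g →
    tsupport u ⊆ ball 0 1 → tsupport g ⊆ ball 0 1 → X.cov (lap u) g = c * ∫ x, u x * g x := by
  let β : ContDiffBump (0 : Euc d) := ⟨1 / 4, 1 / 3, by norm_num, by norm_num⟩
  set ψ : Euc d → ℝ := β.normed volume with hψdef
  have hψs : tsupport ψ = closedBall 0 (1 / 3) := β.tsupport_normed_eq
  have hψ : IsTestFun ψ := ⟨β.contDiff_normed, by
    rw [HasCompactSupport, hψs]; exact isCompact_closedBall _ _⟩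
  obtain ⟨χ, hχ, hχs, hχ1, -⟩ := exists_cutoff (isCompact_closedBall (0 : Euc d) (1 / 2))
    (isOpen_ball (x := (0 : Euc d)) (ε := 1)) (closedBall_subset_ball (by norm_num))
  refine ⟨X.cov (lap ψ) χ, fun u g hu hg hus hgs => ?_⟩
  set c := X.cov (lap ψ) χ
  obtain ⟨ρ, ⟨hρ0, hρ1⟩, hρ⟩ := exists_pos_lt_subset_ball one_pos (isClosed_tsupport u) hus
  set K := closedBall (0 : Euc d) ρ
  set K' := closedBall (0 : Euc d) ((1 + ρ) / 2)
  have hK'B : K' ⊆ ball (0 : Euc d) 1 := closedBall_subset_ball (by linarith)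
  have hKK' : K ⊆ K' := closedBall_subset_closedBall (by linarith)
  set w : ℝ → Euc d → ℝ := fun r => (r ^ d)⁻¹ • fun x => ψ (0 + r⁻¹ • x) with hw
  have hwt : ∀ r, 0 < r → IsTestFun (w r) := fun r hr =>
    (hψ.comp_affine 0 (inv_ne_zero hr.ne')).smul _
  have hws : ∀ r, 0 < r → ∀ x ∈ tsupport (w r), ‖x‖ ≤ r / 3 := by
    intro r hr x hx
    have h1 : tsupport (w r) ⊆ (fun x : Euc d => 0 + r⁻¹ • x) ⁻¹' tsupport ψ :=
      (tsupport_smul_subset_right (fun _ => (r ^ d)⁻¹) _).trans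
        (tsupport_comp_subset_preimage ψ (by fun_prop))
    have h2 := h1 hx
    rw [mem_preimage, hψs, mem_closedBall_zero_iff, zero_add, norm_smul, norm_inv,
      Real.norm_of_nonneg hr.le, inv_mul_le_iff₀ hr] at h2
    linarith
  have hτ : ∀ r, 0 < r → r < (1 - ρ) / 2 → ∀ y ∈ K, X.cov (lap fun x => w r (x - y)) g
      = X.cov (lap ψ) (χ * fun x => g (y + r • x)) := by
    intro r hr hr1 y hy
    have hyρ : ‖y‖ ≤ ρ := by simpa [K] using hy
    have hts : ∀ x ∈ tsupport (fun x => w r (x - y)), ‖x - y‖ ≤ r / 3 := by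
      intro x hx
      have : tsupport (fun x => w r (x - y)) ⊆ (fun x : Euc d => x - y) ⁻¹' tsupport (w r) :=
        tsupport_comp_subset_preimage (w r) (by fun_prop)
      exact hws r hr _ (this hx)
    have hgy := hg.comp_affine y hr.ne'
    rw [cov_lap_eq hr (a := y) ?_ ((hwt r hr).comp_sub y) ?_ hg]
    · have e1 : (fun x => w r (y + r • x - y)) = (r ^ d)⁻¹ • ψ := by
        ext x
        simp [hw, smul_smul, hr.ne']
      have e2 : (lap ((r ^ d)⁻¹ • ψ)) = (r ^ d)⁻¹ • lap ψ := by
        ext x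
        exact lap_const_mul _ hψ.c2.contDiffAt
      have e3 : (fun x => g (y + r • x)) = (χ * fun x => g (y + r • x))
          + ((fun x => g (y + r • x)) - χ * fun x => g (y + r • x)) := by ring
      have h0 : X.cov (lap ψ) ((fun x => g (y + r • x)) - χ * fun x => g (y + r • x)) = 0 := by
        refine cov_lap_eq_zero (a := 0) (r := 1 / 2) (by norm_num) (ball_subset_ball (by norm_num))
          hψ ?_ (hgy.sub (hχ.mul_right hgy.1)) ?_
        · rw [hψs]; exact closedBall_subset_ball (by norm_num)
        · intro x hx hxb
          refine notMem_tsupport_iff_eventuallyEq.2 ?_ hx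
          filter_upwards [mem_nhdsSet_iff_forall.1 hχ1 x (ball_subset_closedBall hxb)] with z hz
          simp [hz]
      rw [e1, e2, cov_smul_left _ hψ.lap, ← mul_assoc, mul_inv_cancel₀ (pow_pos hr d).ne', one_mul,
        e3, cov_add_right (hχ.mul_right hgy.1) (hgy.sub (hχ.mul_right hgy.1)) hψ.lap, h0, add_zero,
        ← e3]
    · intro x hx
      rw [mem_ball_iff_norm] at hx
      rw [mem_ball_zero_iff]
      have := norm_le_norm_add_norm_sub' x y
      linarith
    · intro x hx
      rw [mem_ball_iff_norm]
      linarith [hts x hx]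
  set A : ℝ → Euc d → ℝ := fun r x => ∫ y in K, u y * w r (x - y) with hA
  have hA2 : ∀ r, 0 < r → A r = fun x => ∫ z in ball (0 : Euc d) 1, ψ z * u (x - r • z) := by
    intro r hr
    ext x
    have e1 : A r x = ∫ y, u y * w r (x - y) := by
      refine setIntegral_eq_integral_of_forall_compl_eq_zero fun y hy => ?_
      rw [image_eq_zero_of_notMem_tsupport fun h => hy (ball_subset_closedBall (hρ h)), zero_mul]
    have e2 : ∫ z in ball (0 : Euc d) 1, ψ z * u (x - r • z) = ∫ z, ψ z * u (x - r • z) := by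
      refine setIntegral_eq_integral_of_forall_compl_eq_zero fun y hy => ?_
      rw [image_eq_zero_of_notMem_tsupport (f := ψ), zero_mul]
      rw [hψs]
      exact fun h => hy (closedBall_subset_ball (by norm_num) h)
    rw [e1, e2, ← integral_sub_left_eq_self _ volume x]
    have e3 := Measure.integral_comp_inv_smul (volume : Measure (Euc d))
      (fun z => ψ z * u (x - r • z)) r
    simp only [smul_smul, mul_inv_cancel₀ hr.ne', one_smul, finrank_euclideanSpace_fin,
      abs_of_pos (pow_pos hr d), smul_eq_mul] at e3
    rw [← inv_mul_eq_iff_eq_mul₀ (pow_pos hr d).ne', ← integral_const_mul] at e3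
    rw [← e3]
    congr 1
    ext y
    simp [hw]
    ring
  set r : ℕ → ℝ := fun n => (1 - ρ) / 2 * (1 / ((n : ℝ) + 2)) with hr
  have hrpos : ∀ n, 0 < r n := fun n => mul_pos (by linarith) (by positivity)
  have hrlt : ∀ n, r n < (1 - ρ) / 2 := fun n => by
    have h2 : 1 / ((n : ℝ) + 2) < 1 := by
      rw [div_lt_one (by positivity)]; linarith [(n.cast_nonneg : (0 : ℝ) ≤ n)]
    have : 0 < (1 - ρ) / 2 := by linarith
    simp only [hr]
    nlinarith
  have hrlim : Tendsto r atTop (𝓝 0) := by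
    have h1 : Tendsto (fun n : ℕ => (n : ℝ) + 2) atTop atTop :=
      tendsto_atTop_add_const_right _ _ tendsto_natCast_atTop_atTop
    have := (h1.inv_tendsto_atTop).const_mul ((1 - ρ) / 2)
    rw [mul_zero] at this
    simpa [hr] using this
  have hTu : Tendsto (fun n => X.cov (lap (A (r n))) g) atTop (𝓝 (X.cov (lap u) g)) := by
    have hψi : IntegrableOn ψ (ball (0 : Euc d) 1) :=
      (hψ.continuous.integrable_of_hasCompactSupport hψ.2).integrableOn
    have hu0 : u = fun x => ∫ z in ball (0 : Euc d) 1, ψ z * u (x - 0) := by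
      ext x
      rw [integral_mul_const, setIntegral_eq_integral_of_forall_compl_eq_zero, sub_zero,
        β.integral_normed, one_mul]
      intro y hy
      refine image_eq_zero_of_notMem_tsupport ?_
      rw [hψs]
      exact fun h => hy (closedBall_subset_ball (by norm_num) h)
    have hmem : ∀ n, ∀ᵐ y ∂(volume.restrict (ball (0 : Euc d) 1)), ∀ x, x - r n • y ∈ tsupport u →
        x ∈ K' := by
      intro n
      filter_upwards [ae_restrict_mem measurableSet_ball] with y hy x hx
      rw [mem_ball_zero_iff] at hy
      have h1 := hρ hx
      rw [mem_ball_zero_iff] at h1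
      have h2 : ‖r n • y‖ ≤ r n := by
        rw [norm_smul, Real.norm_of_nonneg (hrpos n).le]
        nlinarith [hrpos n]
      have h3 := norm_le_norm_add_norm_sub' x (r n • y)
      simp only [K', mem_closedBall_zero_iff]
      linarith [hrlt n]
    have hm : ∀ n, Measurable fun y : Euc d => r n • y := fun n => measurable_const_smul _
    refine tendsto_cov_lap (isCompact_closedBall _ _) hK'B (K := K') (fun n => ?_) hu hg hgs
      (fun n => ?_) ((hρ.trans ball_subset_closedBall).trans hKK') fun m => ?_
    · rw [hA2 _ (hrpos n)]
      exact isTestFun_average (isCompact_closedBall _ _) hψi (hm n) hu (hmem n)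
    · rw [hA2 _ (hrpos n)]
      exact average_tsupport_subset isClosed_closedBall (hmem n)
    · conv => 
        arg 2
        rw [hu0]
      simp_rw [hA2 _ (hrpos _)]
      refine tendstoUniformly_average hψi measurable_const hm (fun ε hε => ?_) hu m
      filter_upwards [hrlim.eventually (gt_mem_nhds hε)] with n hn
      filter_upwards [ae_restrict_mem measurableSet_ball] with y hy
      rw [mem_ball_zero_iff] at hy
      rw [sub_zero, norm_smul, Real.norm_of_nonneg (hrpos n).le]
      nlinarith [hrpos n, norm_nonneg y]
  have hui : IntegrableOn u K := (hu.continuous.integrable_of_hasCompactSupport hu.2).integrableOn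
  have hug : ∫ y in K, u y * g y = ∫ y, u y * g y := by
    refine setIntegral_eq_integral_of_forall_compl_eq_zero fun y hy => ?_
    rw [image_eq_zero_of_notMem_tsupport fun h => hy (ball_subset_closedBall (hρ h)), zero_mul]
  have hest : ∀ ε > 0, |X.cov (lap u) g - c * ∫ y, u y * g y| ≤ ε * ∫ y in K, |u y| := by
    intro ε hε
    obtain ⟨r₀, hr₀, h⟩ := exists_forall_abs_cov_sub_le (X := X) hψ.lap
      ((tsupport_lap_subset ψ).trans (hψs.trans_subset (closedBall_subset_ball (by norm_num))))
      hχ hχs hg hε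
    refine le_of_tendsto (hTu.sub_const _).abs ?_
    filter_upwards [hrlim.eventually (gt_mem_nhds hr₀)] with n hn
    rw [← hug]
    refine abs_cov_lap_average_sub_le (K' := K') (isCompact_closedBall _ _) ⟨0, by simp [K, hρ0.le]⟩
      (isCompact_closedBall _ _) hK'B (hwt _ (hrpos n)) (fun y hy x hx => ?_) hg hgs hui
      fun y hy => ?_
    · have h1 := hws _ (hrpos n) _ hx
      have h3 := norm_le_norm_add_norm_sub' x y
      simp only [K, K', mem_closedBall_zero_iff] at hy ⊢
      linarith [hrlt n, hrpos n]
    · rw [hτ _ (hrpos n) (hrlt n) y hy]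
      exact h _ (hrpos n) hn y
  have hI : 0 ≤ ∫ y in K, |u y| := integral_nonneg fun _ => abs_nonneg _
  have : |X.cov (lap u) g - c * ∫ y, u y * g y| ≤ 0 := by
    refine le_of_forall_pos_le_add fun δ hδ => ?_
    refine (hest (δ / ((∫ y in K, |u y|) + 1)) (by positivity)).trans ?_
    rw [zero_add, div_mul_eq_mul_div, div_le_iff₀ (by positivity)]
    nlinarith
  exact sub_eq_zero.1 (abs_nonpos_iff.1 this)

end GFF

section Profile

variable {d : ℕ}

/-- The profile of the fundamental solution as a function of the squared distance. -/
def sqProfile (d : ℕ) (t : ℝ) : ℝ :=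
  if d = 2 then -(1 / 2) * Real.log t else t ^ (((2 : ℝ) - d) / 2)

/-- Minus the derivative of `sqProfile d` at `1`. -/
def profileSlope (d : ℕ) : ℝ := if d = 2 then 1 / 2 else ((d : ℝ) - 2) / 2

lemma profileSlope_pos (hd : 2 ≤ d) : 0 < profileSlope d := by
  unfold profileSlope
  split_ifs with h
  · norm_num
  · have : (2 : ℝ) < d := by exact_mod_cast lt_of_le_of_ne hd (Ne.symm h)
    linarith

lemma sFun_eq_sqProfile {r : ℝ} (hr : 0 ≤ r) : sFun d r = sqProfile d (r ^ 2) := by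
  unfold sFun sqProfile
  split_ifs with h
  · rw [Real.log_pow]; push_cast; ring
  · rw [← Real.rpow_natCast r 2, ← Real.rpow_mul hr]
    congr 1; push_cast; ring

lemma contDiffAt_sqProfile {n : WithTop ℕ∞} {t : ℝ} (ht : 0 < t) :
    ContDiffAt ℝ n (sqProfile d) t := by
  unfold sqProfile
  split_ifs with h
  · exact contDiffAt_const.mul (Real.contDiffAt_log.2 ht.ne')
  · exact Real.contDiffAt_rpow_const_of_ne ht.ne'

lemma hasDerivAt_sqProfile {t : ℝ} (ht : 0 < t) :
    HasDerivAt (sqProfile d) (-profileSlope d * t ^ (-(d : ℝ) / 2)) t := by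
  unfold sqProfile profileSlope
  split_ifs with h
  · refine ((Real.hasDerivAt_log ht.ne').const_mul (-(1 / 2) : ℝ)).congr_deriv ?_
    rw [h, ← Real.rpow_neg_one]; norm_num
  · convert Real.hasDerivAt_rpow_const (p := ((2 : ℝ) - d) / 2) (Or.inl ht.ne') using 1
    rw [show ((2 : ℝ) - d) / 2 - 1 = -(d : ℝ) / 2 by ring]; ring

lemma deriv_sqProfile {t : ℝ} (ht : 0 < t) :
    deriv (sqProfile d) t = -profileSlope d * t ^ (-(d : ℝ) / 2) := (hasDerivAt_sqProfile ht).deriv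

lemma deriv_deriv_sqProfile {t : ℝ} (ht : 0 < t) :
    deriv (deriv (sqProfile d)) t = profileSlope d * (d / 2) * t ^ (-((d : ℝ) + 2) / 2) := by
  have : deriv (sqProfile d) =ᶠ[𝓝 t] fun t => -profileSlope d * t ^ (-(d : ℝ) / 2) := by
    filter_upwards [lt_mem_nhds ht] with s hs using deriv_sqProfile hs
  rw [this.deriv_eq, ((Real.hasDerivAt_rpow_const (p := -(d : ℝ) / 2) (Or.inl ht.ne')).const_mul
    (-profileSlope d)).deriv, show -(d : ℝ) / 2 - 1 = -((d : ℝ) + 2) / 2 by ring]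
  ring

lemma sqProfile_ode {t : ℝ} (ht : 0 < t) :
    4 * t * deriv (deriv (sqProfile d)) t + 2 * d * deriv (sqProfile d) t = 0 := by
  rw [deriv_deriv_sqProfile ht, deriv_sqProfile ht]
  have : t ^ (-(d : ℝ) / 2) = t * t ^ (-((d : ℝ) + 2) / 2) := by
    rw [show -(d : ℝ) / 2 = 1 + -((d : ℝ) + 2) / 2 by ring, Real.rpow_add ht, Real.rpow_one]
  rw [this]; ring

lemma measurable_sqProfile : Measurable (sqProfile d) := by
  unfold sqProfile
  split_ifs
  · exact Real.measurable_log.const_mul _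
  · exact measurable_id.pow_const _

/-- Mean value bounds for the profile. -/
lemma sqProfile_sub_bounds (hd : 2 ≤ d) {s t : ℝ} (hs : 0 < s) (hst : s ≤ t) :
    profileSlope d * t ^ (-(d : ℝ) / 2) * (t - s) ≤ sqProfile d s - sqProfile d t ∧
      sqProfile d s - sqProfile d t ≤ profileSlope d * s ^ (-(d : ℝ) / 2) * (t - s) := by
  rcases hst.eq_or_lt with rfl | hlt
  · simp
  obtain ⟨ξ, hξ, he⟩ := exists_hasDerivAt_eq_slope (sqProfile d)
    (fun t => -profileSlope d * t ^ (-(d : ℝ) / 2)) hlt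
    (fun x hx => (hasDerivAt_sqProfile (hs.trans_le hx.1)).continuousAt.continuousWithinAt)
    (fun x hx => hasDerivAt_sqProfile (hs.trans hx.1))
  rw [eq_div_iff (by linarith)] at he
  have hm := profileSlope_pos hd
  have hξ0 := hs.trans hξ.1
  have e : sqProfile d s - sqProfile d t = profileSlope d * ξ ^ (-(d : ℝ) / 2) * (t - s) := by linarith
  have hneg : -(d : ℝ) / 2 ≤ 0 := by
    have : (0 : ℝ) ≤ d := by positivity
    linarith
  rw [e]
  constructor
  · refine mul_le_mul_of_nonneg_right (mul_le_mul_of_nonneg_left ?_ hm.le) (by linarith)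
    exact Real.rpow_le_rpow_of_nonpos hξ0 hξ.2.le hneg
  · refine mul_le_mul_of_nonneg_right (mul_le_mul_of_nonneg_left ?_ hm.le) (by linarith)
    exact Real.rpow_le_rpow_of_nonpos hs hξ.1.le hneg

lemma sqProfile_anti (hd : 2 ≤ d) {s t : ℝ} (hs : 0 < s) (hst : s ≤ t) :
    sqProfile d t ≤ sqProfile d s := by
  have h := (sqProfile_sub_bounds hd hs hst).1
  have h2 : 0 ≤ profileSlope d * t ^ (-(d : ℝ) / 2) * (t - s) :=
    mul_nonneg (mul_nonneg (profileSlope_pos hd).le (Real.rpow_nonneg (hs.le.trans hst) _)) (by linarith)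
  linarith

lemma abs_sqProfile_le (hd : 2 ≤ d) {r s t : ℝ} (hr : 0 < r) (hrs : r ≤ s) (hst : s ≤ t) :
    |sqProfile d s| ≤ |sqProfile d r| + |sqProfile d t| := by
  have h1 := sqProfile_anti hd hr hrs
  have h2 := sqProfile_anti hd (hr.trans_le hrs) hst
  rw [abs_le]
  have := abs_nonneg (sqProfile d r)
  have := abs_nonneg (sqProfile d t)
  have := le_abs_self (sqProfile d r)
  have := neg_abs_le (sqProfile d t)
  constructor <;> linarith

lemma exists_sqProfile_lipschitz (hd : 2 ≤ d) {δ : ℝ} (hδ : 0 < δ) :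
    ∃ L, 0 < L ∧ ∀ s t, δ ≤ s → δ ≤ t → |sqProfile d s - sqProfile d t| ≤ L * |s - t| := by
  have hL : 0 < profileSlope d * δ ^ (-(d : ℝ) / 2) := mul_pos (profileSlope_pos hd) (Real.rpow_pos_of_pos hδ _)
  refine ⟨_, hL, ?_⟩
  have key : ∀ s t, δ ≤ s → s ≤ t →
      |sqProfile d s - sqProfile d t| ≤ profileSlope d * δ ^ (-(d : ℝ) / 2) * |s - t| := by
    intro s t hs hst
    have hs0 := hδ.trans_le hs
    rw [abs_of_nonneg (by linarith [sqProfile_anti hd hs0 hst]), abs_sub_comm,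
      abs_of_nonneg (by linarith : (0 : ℝ) ≤ t - s)]
    refine (sqProfile_sub_bounds hd hs0 hst).2.trans ?_
    refine mul_le_mul_of_nonneg_right (mul_le_mul_of_nonneg_left ?_ (profileSlope_pos hd).le) (by linarith)
    have : (0 : ℝ) ≤ d := by positivity
    exact Real.rpow_le_rpow_of_nonpos hδ hs (by linarith)
  intro s t hs ht
  rcases le_total s t with h | h
  · exact key s t hs h
  · rw [abs_sub_comm, abs_sub_comm s]; exact key t s ht h

lemma continuous_normSq : Continuous fun z : Euc d => ‖z‖ ^ 2 := by fun_prop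

lemma measurable_sqProfile_norm : Measurable fun z : Euc d => sqProfile d (‖z‖ ^ 2) :=
  measurable_sqProfile.comp continuous_normSq.measurable

lemma locallyIntegrable_sqProfile (hd : 2 ≤ d) :
    LocallyIntegrable fun z : Euc d => sqProfile d (‖z‖ ^ 2) := by
  have hfr : Module.finrank ℝ (Euc d) = d := by simp
  by_cases h : d = 2
  · have hle : ∀ r : ℝ, 0 ≤ r → |Real.log r| ≤ r ^ (1 : ℝ) + r ^ (-1 : ℝ) := by
      intro r hr
      rcases hr.eq_or_lt with rfl | hr
      · simp
      rw [Real.rpow_one, Real.rpow_neg_one, abs_le]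
      have h1 := Real.log_le_sub_one_of_pos hr
      have h2 := Real.log_le_sub_one_of_pos (inv_pos.2 hr)
      rw [Real.log_inv] at h2
      have := inv_pos.2 hr
      constructor <;> linarith
    have h1 : LocallyIntegrable fun z : Euc d => ‖z‖ ^ (1 : ℝ) := by
      simpa using (continuous_norm (E := Euc d)).locallyIntegrable (μ := volume)
    have h2 : LocallyIntegrable fun z : Euc d => ‖z‖ ^ (-1 : ℝ) := by
      refine locallyIntegrable_of_norm_le_rpow (C := 1) (α := 1) (by rw [hfr]; omega)
        (by rw [hfr, h]; norm_num) (ae_of_all _ fun z => ?_)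
        (measurable_norm.pow_const _).aestronglyMeasurable
      rw [one_mul, Real.norm_of_nonneg (Real.rpow_nonneg (norm_nonneg _) _)]
    refine (h1.add h2).mono measurable_sqProfile_norm.aestronglyMeasurable (ae_of_all _ fun z => ?_)
    have e : sqProfile d (‖z‖ ^ 2) = -Real.log ‖z‖ := by
      rw [← sFun_eq_sqProfile (norm_nonneg z)]; simp [sFun, h]
    rw [e, Real.norm_eq_abs, abs_neg]
    exact (hle _ (norm_nonneg z)).trans (le_abs_self _)
  · have hlt : (2 : ℝ) < d := by exact_mod_cast lt_of_le_of_ne hd (Ne.symm h)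
    refine locallyIntegrable_of_norm_le_rpow (C := 1) (α := d - 2) (by rw [hfr]; omega)
        (by rw [hfr]; linarith) (ae_of_all _ fun z => ?_)
        measurable_sqProfile_norm.aestronglyMeasurable
    rw [← sFun_eq_sqProfile (norm_nonneg z), sFun, if_neg h, one_mul, neg_sub,
      Real.norm_of_nonneg (Real.rpow_nonneg (norm_nonneg _) _)]

end Profile

section FundamentalSolution

variable {d : ℕ}

/-- The normalization of the fundamental solution: `-Δ s(|·|) = fundConst d • δ₀`. -/
def fundConst (d : ℕ) : ℝ :=
  2 * d * profileSlope d * ∫ w : Euc d, ((1 : ℝ) + ‖w‖ ^ 2) ^ (-((d : ℝ) + 2) / 2)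

lemma integrable_japanese (d : ℕ) :
    Integrable fun w : Euc d => ((1 : ℝ) + ‖w‖ ^ 2) ^ (-((d : ℝ) + 2) / 2) := by
  refine integrable_rpow_neg_one_add_norm_sq ?_
  simp

lemma fundConst_pos (hd : 2 ≤ d) : 0 < fundConst d := by
  have h : 0 < ∫ w : Euc d, ((1 : ℝ) + ‖w‖ ^ 2) ^ (-((d : ℝ) + 2) / 2) := by
    refine integral_pos_of_integrable_nonneg_nonzero (x := 0) ?_ (integrable_japanese d)
      (fun w => by positivity) ?_
    · exact Continuous.rpow_const (by fun_prop) fun w => Or.inl (by positivity)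
    · simp
  have : (0 : ℝ) < d := by exact_mod_cast (by omega : 0 < d)
  have := profileSlope_pos hd
  unfold fundConst; positivity

lemma lap_regularized {ε : ℝ} (hε : 0 < ε) (x : Euc d) :
    lap (fun y => sqProfile d (quadPoly ε 1 0 y)) x
      = -(2 * d * profileSlope d) * (ε * (ε + ‖x‖ ^ 2) ^ (-((d : ℝ) + 2) / 2)) := by
  have hq : quadPoly ε 1 (0 : Euc d) x = ε + ‖x‖ ^ 2 := by simp [quadPoly]
  have h0 : 0 < quadPoly ε 1 (0 : Euc d) x := by rw [hq]; positivity
  rw [lap_comp_quadPoly (contDiffAt_sqProfile h0), sqProfile_ode h0, deriv_deriv_sqProfile h0, hq]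
  simp
  ring

lemma integral_regularized_mul_lap {φ : Euc d → ℝ} (hφ : IsTestFun φ) {r : ℝ} (hr : 0 < r) :
    ∫ x, sqProfile d (r ^ 2 + ‖x‖ ^ 2) * lap φ x
      = -(2 * d * profileSlope d) *
        ∫ w : Euc d, ((1 : ℝ) + ‖w‖ ^ 2) ^ (-((d : ℝ) + 2) / 2) * φ (r • w) := by
  have hq : ∀ x, quadPoly (r ^ 2) 1 (0 : Euc d) x = r ^ 2 + ‖x‖ ^ 2 := fun x => by simp [quadPoly]
  have hv : ContDiff ℝ 2 fun y : Euc d => sqProfile d (quadPoly (r ^ 2) 1 0 y) := by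
    refine contDiff_iff_contDiffAt.2 fun x => ContDiffAt.comp x (contDiffAt_sqProfile ?_)
      (contDiff_quadPoly _ _ _).contDiffAt
    rw [hq]; positivity
  have h1 := integral_mul_lap hφ.c2 hv hφ.2
  simp_rw [lap_regularized (d := d) (show 0 < r ^ 2 by positivity), hq] at h1
  rw [show (∫ x, sqProfile d (r ^ 2 + ‖x‖ ^ 2) * lap φ x)
    = ∫ x, lap φ x * sqProfile d (r ^ 2 + ‖x‖ ^ 2) from integral_congr_ae
      (ae_of_all _ fun x => mul_comm _ _), ← h1]
  have h2 := Measure.integral_comp_smul (volume : Measure (Euc d))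
    (fun x => φ x * (-(2 * d * profileSlope d)
      * (r ^ 2 * (r ^ 2 + ‖x‖ ^ 2) ^ (-((d : ℝ) + 2) / 2)))) r
  rw [finrank_euclideanSpace, Fintype.card_fin, abs_of_pos (by positivity), smul_eq_mul,
    eq_inv_mul_iff_mul_eq₀ (by positivity)] at h2
  rw [← h2, ← integral_const_mul, ← integral_const_mul]
  refine integral_congr_ae (ae_of_all _ fun w => ?_)
  have e : (r ^ 2 + ‖r • w‖ ^ 2) ^ (-((d : ℝ) + 2) / 2)
      = (r ^ d * r ^ 2)⁻¹ * ((1 : ℝ) + ‖w‖ ^ 2) ^ (-((d : ℝ) + 2) / 2) := by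
    rw [norm_smul, Real.norm_of_nonneg hr.le,
      show r ^ 2 + (r * ‖w‖) ^ 2 = r ^ 2 * (1 + ‖w‖ ^ 2) by ring,
      Real.mul_rpow (by positivity) (by positivity), ← Real.rpow_natCast r 2, ← Real.rpow_mul hr.le,
      ← Real.rpow_natCast r d, ← Real.rpow_add hr, ← Real.rpow_neg hr.le]
    congr 2; push_cast; ring
  simp only [e]
  field_simp

lemma integral_profile_mul_lap_zero (hd : 2 ≤ d) {φ : Euc d → ℝ} (hφ : IsTestFun φ) :
    ∫ x, sqProfile d (‖x‖ ^ 2) * lap φ x = -(fundConst d * φ 0) := by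
  have : Nonempty (Fin d) := ⟨⟨0, by omega⟩⟩
  have : Nontrivial (Euc d) := inferInstance
  set r : ℕ → ℝ := fun n => 1 / ((n : ℝ) + 1)
  have hr0 : ∀ n, 0 < r n := fun n => Nat.one_div_pos_of_nat
  have hr1 : ∀ n, r n ≤ 1 := fun n => by
    simp only [r]; rw [div_le_one (by positivity)]; linarith [(Nat.cast_nonneg n : (0 : ℝ) ≤ n)]
  have hrt : Tendsto r atTop (𝓝 0) := tendsto_one_div_add_atTop_nhds_zero_nat
  have hlim1 : Tendsto (fun n => ∫ x, sqProfile d (r n ^ 2 + ‖x‖ ^ 2) * lap φ x) atTop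
      (𝓝 (∫ x, sqProfile d (‖x‖ ^ 2) * lap φ x)) := by
    have hlc : Continuous (lap φ) := hφ.lap.continuous
    refine tendsto_integral_of_dominated_convergence
      (fun x => |sqProfile d (‖x‖ ^ 2)| * |lap φ x| + |sqProfile d (1 + ‖x‖ ^ 2)| * |lap φ x|)
      (fun n => ?_) ?_ (fun n => ?_) ?_
    · exact (measurable_sqProfile.comp (by fun_prop)).aestronglyMeasurable.mul
        hlc.aestronglyMeasurable
    · refine Integrable.add ?_ ?_
      · have := (locallyIntegrable_sqProfile hd).integrable_smul_right_of_hasCompactSupport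
          hlc hφ.lap.2
        simpa [abs_mul, Pi.smul_apply'] using this.abs
      · have hc : Continuous fun x : Euc d => sqProfile d (1 + ‖x‖ ^ 2) :=
          continuous_iff_continuousAt.2 fun x => ContinuousAt.comp
            (g := sqProfile d) (f := fun x : Euc d => 1 + ‖x‖ ^ 2)
            (contDiffAt_sqProfile (n := 0) (by positivity)).continuousAt
            (Continuous.continuousAt (by fun_prop))
        exact (hc.abs.mul hlc.abs).integrable_of_hasCompactSupport hφ.lap.2.norm.mul_left
    · filter_upwards [compl_mem_ae_iff.2 (measure_singleton (0 : Euc d))] with x hx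
      have hx0 : 0 < ‖x‖ := norm_pos_iff.2 hx
      rw [norm_mul, ← add_mul]
      refine mul_le_mul_of_nonneg_right (abs_sqProfile_le hd (by positivity) ?_ ?_) (abs_nonneg _)
      · linarith [sq_nonneg (r n)]
      · have := pow_le_one₀ (n := 2) (hr0 n).le (hr1 n); linarith
    · filter_upwards [compl_mem_ae_iff.2 (measure_singleton (0 : Euc d))] with x hx
      have hx0 : 0 < ‖x‖ := norm_pos_iff.2 hx
      refine Tendsto.mul_const _ ?_
      have hc : ContinuousAt (sqProfile d) (‖x‖ ^ 2) :=
        (contDiffAt_sqProfile (n := 0) (by positivity)).continuousAt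
      refine hc.tendsto.comp ?_
      simpa using (hrt.pow 2).add_const (‖x‖ ^ 2)
  have hlim2 : Tendsto (fun n => -(2 * d * profileSlope d) *
        ∫ w : Euc d, ((1 : ℝ) + ‖w‖ ^ 2) ^ (-((d : ℝ) + 2) / 2) * φ (r n • w)) atTop
      (𝓝 (-(2 * d * profileSlope d) *
        ∫ w : Euc d, ((1 : ℝ) + ‖w‖ ^ 2) ^ (-((d : ℝ) + 2) / 2) * φ 0)) := by
    refine Tendsto.const_mul _ ?_
    obtain ⟨C, hC⟩ := hφ.continuous.bounded_above_of_compact_support hφ.2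
    refine tendsto_integral_of_dominated_convergence
      (fun w => ((1 : ℝ) + ‖w‖ ^ 2) ^ (-((d : ℝ) + 2) / 2) * C) (fun n => ?_)
      ((integrable_japanese d).mul_const C) (fun n => ae_of_all _ fun w => ?_)
      (ae_of_all _ fun w => ?_)
    · exact (integrable_japanese d).aestronglyMeasurable.mul
        (hφ.continuous.comp (continuous_const_smul _)).aestronglyMeasurable
    · rw [norm_mul, Real.norm_of_nonneg (by positivity)]
      exact mul_le_mul_of_nonneg_left (hC _) (by positivity)
    · refine Tendsto.const_mul _ ?_
      refine (hφ.continuous.tendsto' 0 _ rfl).comp ?_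
      simpa using hrt.smul_const w
  simp_rw [fun n => integral_regularized_mul_lap hφ (hr0 n)] at hlim1
  rw [tendsto_nhds_unique hlim1 hlim2, integral_mul_const, fundConst]
  ring

lemma integral_profile_mul_lap (hd : 2 ≤ d) {φ : Euc d → ℝ} (hφ : IsTestFun φ) (y : Euc d) :
    ∫ x, sqProfile d (‖x - y‖ ^ 2) * lap φ x = -(fundConst d * φ y) := by
  have h := integral_profile_mul_lap_zero hd (hφ.comp_affine y one_ne_zero)
  simp_rw [lap_comp_affine hφ.c2] at h
  rw [← integral_add_left_eq_self _ y]
  simpa using h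

end FundamentalSolution

section Green

variable {d : ℕ} {x y : Euc d}

/-- The squared quantity `|x|² |y - x/|x|²|²`, extended continuously to `x = 0`. -/
def mirrorSq (x y : Euc d) : ℝ := 1 - 2 * inner ℝ x y + ‖x‖ ^ 2 * ‖y‖ ^ 2

lemma mirrorSq_comm (x y : Euc d) : mirrorSq x y = mirrorSq y x := by
  unfold mirrorSq; rw [real_inner_comm]; ring

lemma mirrorSq_eq (x y : Euc d) :
    mirrorSq x y = ‖x - y‖ ^ 2 + (1 - ‖x‖ ^ 2) * (1 - ‖y‖ ^ 2) := by
  unfold mirrorSq; rw [norm_sub_sq_real]; ring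

lemma mirrorSq_eq_quadPoly (x y : Euc d) :
    mirrorSq x y = quadPoly 1 (‖y‖ ^ 2) ((-2 : ℝ) • y) x := by
  unfold mirrorSq quadPoly; rw [real_inner_smul_left, real_inner_comm]; ring

lemma greenBall_eq (x y : Euc d) :
    greenBall d x y = sqProfile d (‖x - y‖ ^ 2) - sqProfile d (mirrorSq x y) := by
  unfold greenBall
  split_ifs with h
  · rw [sFun_eq_sqProfile (norm_nonneg y), sFun_eq_sqProfile zero_le_one]
    simp [h, mirrorSq]
  · have h0 : ‖x‖ ≠ 0 := norm_ne_zero_iff.2 h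
    rw [sFun_eq_sqProfile (norm_nonneg _), sFun_eq_sqProfile (by positivity)]
    congr 2
    rw [mul_pow, norm_sub_sq_real, real_inner_smul_right, norm_smul, mirrorSq, real_inner_comm,
      Real.norm_of_nonneg (by positivity)]
    field_simp
    ring

lemma greenBall_comm (x y : Euc d) : greenBall d x y = greenBall d y x := by
  rw [greenBall_eq, greenBall_eq, mirrorSq_comm, norm_sub_rev]

lemma one_sub_normSq_pos (hx : x ∈ ball (0 : Euc d) 1) : 0 < 1 - ‖x‖ ^ 2 := by
  rw [mem_ball_zero_iff] at hx
  nlinarith [norm_nonneg x]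

lemma mirrorSq_pos_of_norm_mul_lt (h : ‖x‖ * ‖y‖ < 1) : 0 < mirrorSq x y := by
  have := real_inner_le_norm x y
  unfold mirrorSq
  nlinarith [mul_pos (sub_pos.2 h) (sub_pos.2 h)]

lemma norm_mul_lt_one (hx : x ∈ ball (0 : Euc d) 1) (hy : y ∈ ball (0 : Euc d) 1) :
    ‖x‖ * ‖y‖ < 1 := by
  rw [mem_ball_zero_iff] at hx hy
  nlinarith [norm_nonneg x, norm_nonneg y]

lemma mirrorSq_pos (hx : x ∈ ball (0 : Euc d) 1) (hy : y ∈ ball (0 : Euc d) 1) :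
    0 < mirrorSq x y := mirrorSq_pos_of_norm_mul_lt (norm_mul_lt_one hx hy)

lemma mirrorSq_le (hx : x ∈ ball (0 : Euc d) 1) (hy : y ∈ ball (0 : Euc d) 1) :
    mirrorSq x y ≤ 4 := by
  have h := norm_mul_lt_one hx hy
  have := neg_le_of_abs_le (abs_real_inner_le_norm x y)
  have h0 : 0 ≤ ‖x‖ * ‖y‖ := by positivity
  unfold mirrorSq
  nlinarith

lemma normSq_sub_le_mirrorSq (hx : x ∈ ball (0 : Euc d) 1) (hy : y ∈ ball (0 : Euc d) 1) :
    ‖x - y‖ ^ 2 ≤ mirrorSq x y := by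
  rw [mirrorSq_eq]
  have := mul_pos (one_sub_normSq_pos hx) (one_sub_normSq_pos hy)
  linarith

lemma normSq_sub_pos (hxy : x ≠ y) : 0 < ‖x - y‖ ^ 2 := by
  have := norm_pos_iff.2 (sub_ne_zero.2 hxy); positivity

/-- The constant in the lower bound of the Green function by the product of the squared-distance
weights. -/
def greenLower (d : ℕ) : ℝ := profileSlope d * 4 ^ (-(d : ℝ) / 2)

lemma greenLower_pos (hd : 2 ≤ d) : 0 < greenLower d :=
  mul_pos (profileSlope_pos hd) (Real.rpow_pos_of_pos (by norm_num) _)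

lemma greenLower_le (hd : 2 ≤ d) (hx : x ∈ ball (0 : Euc d) 1) (hy : y ∈ ball (0 : Euc d) 1)
    (hxy : x ≠ y) :
    greenLower d * ((1 - ‖x‖ ^ 2) * (1 - ‖y‖ ^ 2)) ≤ greenBall d x y := by
  rw [greenBall_eq]
  refine le_trans ?_ (sqProfile_sub_bounds hd (normSq_sub_pos hxy)
    (normSq_sub_le_mirrorSq hx hy)).1
  rw [show mirrorSq x y - ‖x - y‖ ^ 2 = (1 - ‖x‖ ^ 2) * (1 - ‖y‖ ^ 2) by rw [mirrorSq_eq]; ring]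
  refine mul_le_mul_of_nonneg_right (mul_le_mul_of_nonneg_left ?_ (profileSlope_pos hd).le)
    (mul_pos (one_sub_normSq_pos hx) (one_sub_normSq_pos hy)).le
  have : (0 : ℝ) ≤ d := by positivity
  exact Real.rpow_le_rpow_of_nonpos (mirrorSq_pos hx hy) (mirrorSq_le hx hy) (by linarith)

lemma greenBall_nonneg (hd : 2 ≤ d) (hx : x ∈ ball (0 : Euc d) 1) (hy : y ∈ ball (0 : Euc d) 1)
    (hxy : x ≠ y) : 0 ≤ greenBall d x y :=
  (mul_pos (greenLower_pos hd) (mul_pos (one_sub_normSq_pos hx) (one_sub_normSq_pos hy))).le.trans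
    (greenLower_le hd hx hy hxy)

lemma abs_sqProfile_mirrorSq_le (hd : 2 ≤ d) (hx : x ∈ ball (0 : Euc d) 1)
    (hy : y ∈ ball (0 : Euc d) 1) (hxy : x ≠ y) :
    |sqProfile d (mirrorSq x y)| ≤ |sqProfile d (‖x - y‖ ^ 2)| + |sqProfile d 4| :=
  abs_sqProfile_le hd (normSq_sub_pos hxy) (normSq_sub_le_mirrorSq hx hy) (mirrorSq_le hx hy)

lemma abs_greenBall_le (hd : 2 ≤ d) (hx : x ∈ ball (0 : Euc d) 1) (hy : y ∈ ball (0 : Euc d) 1)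
    (hxy : x ≠ y) :
    |greenBall d x y| ≤ 2 * |sqProfile d (‖x - y‖ ^ 2)| + |sqProfile d 4| := by
  rw [greenBall_eq]
  have := abs_sub (sqProfile d (‖x - y‖ ^ 2)) (sqProfile d (mirrorSq x y))
  linarith [abs_sqProfile_mirrorSq_le hd hx hy hxy]

lemma continuous_mirrorSq : Continuous fun p : Euc d × Euc d => mirrorSq p.1 p.2 := by
  unfold mirrorSq; fun_prop

lemma measurable_greenBall : Measurable fun p : Euc d × Euc d => greenBall d p.1 p.2 := by
  simp_rw [greenBall_eq]
  exact (measurable_sqProfile.comp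
    (by fun_prop : Continuous fun p : Euc d × Euc d => ‖p.1 - p.2‖ ^ 2).measurable).sub
    (measurable_sqProfile.comp continuous_mirrorSq.measurable)

lemma measurable_greenBall_left (x : Euc d) : Measurable (greenBall d x) :=
  measurable_greenBall.comp measurable_prodMk_left

lemma ae_ne (hd : 2 ≤ d) (x : Euc d) : ∀ᵐ y : Euc d, x ≠ y := by
  have : Nonempty (Fin d) := ⟨⟨0, by omega⟩⟩
  have : Nontrivial (Euc d) := inferInstance
  filter_upwards [compl_mem_ae_iff.2 (measure_singleton x)] with y hy
  exact fun h => hy (by simp [h])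

lemma measurableSet_unitBall : MeasurableSet (ball (0 : Euc d) 1) := isOpen_ball.measurableSet

lemma ae_unitBall_prod (hd : 2 ≤ d) :
    ∀ᵐ p : Euc d × Euc d ∂(volume.restrict (ball (0 : Euc d) 1)).prod
      (volume.restrict (ball (0 : Euc d) 1)),
      p.1 ∈ ball (0 : Euc d) 1 ∧ p.2 ∈ ball (0 : Euc d) 1 ∧ p.1 ≠ p.2 := by
  have hm : MeasurableSet {p : Euc d × Euc d | p.1 ∈ ball (0 : Euc d) 1 ∧
      p.2 ∈ ball (0 : Euc d) 1 ∧ p.1 ≠ p.2} :=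
    (measurable_fst measurableSet_unitBall).inter
      ((measurable_snd measurableSet_unitBall).inter
        (measurableSet_eq_fun measurable_fst measurable_snd).compl)
  refine (Measure.ae_prod_mem_iff_ae_ae_mem hm).2 ?_
  filter_upwards [ae_restrict_mem measurableSet_unitBall] with x hx
  filter_upwards [ae_restrict_mem measurableSet_unitBall, ae_restrict_of_ae (ae_ne hd x)]
    with y hy hxy
  exact ⟨hx, hy, hxy⟩

lemma exists_integral_profile_le (hd : 2 ≤ d) : ∃ C : ℝ, ∀ x ∈ ball (0 : Euc d) 1,
    IntegrableOn (fun y => |sqProfile d (‖x - y‖ ^ 2)|) (ball (0 : Euc d) 1) ∧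
    ∫ y in ball (0 : Euc d) 1, |sqProfile d (‖x - y‖ ^ 2)| ≤ C := by
  have hS : IntegrableOn (fun z : Euc d => |sqProfile d (‖z‖ ^ 2)|) (closedBall 0 2) :=
    ((locallyIntegrable_sqProfile hd).integrableOn_isCompact (isCompact_closedBall 0 2)).abs
  rw [← integrable_indicator_iff isClosed_closedBall.measurableSet] at hS
  refine ⟨∫ z, (closedBall (0 : Euc d) 2).indicator
    (fun z : Euc d => |sqProfile d (‖z‖ ^ 2)|) z, fun x hx => ?_⟩
  have hi := hS.comp_sub_left x
  have hle : ∀ y ∈ ball (0 : Euc d) 1, |sqProfile d (‖x - y‖ ^ 2)|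
      = (closedBall (0 : Euc d) 2).indicator (fun z : Euc d => |sqProfile d (‖z‖ ^ 2)|) (x - y) := by
    intro y hy
    rw [indicator_of_mem]
    rw [mem_ball_zero_iff] at hx hy
    rw [mem_closedBall_zero_iff]
    linarith [norm_sub_le x y]
  refine ⟨hi.integrableOn.congr_fun (fun y hy => (hle y hy).symm) measurableSet_unitBall, ?_⟩
  rw [setIntegral_congr_fun measurableSet_unitBall hle]
  refine (setIntegral_le_integral hi (ae_of_all _ fun y => indicator_nonneg
    (fun z _ => abs_nonneg _) _)).trans ?_
  rw [integral_sub_left_eq_self (fun z => (closedBall (0 : Euc d) 2).indicator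
    (fun z : Euc d => |sqProfile d (‖z‖ ^ 2)|) z) volume x]

lemma exists_integral_greenBall_le (hd : 2 ≤ d) : ∃ C : ℝ, ∀ x ∈ ball (0 : Euc d) 1,
    IntegrableOn (greenBall d x) (ball (0 : Euc d) 1) ∧
    ∫ y in ball (0 : Euc d) 1, |greenBall d x y| ≤ C := by
  obtain ⟨C, hC⟩ := exists_integral_profile_le hd
  refine ⟨2 * C + ∫ y in ball (0 : Euc d) 1, |sqProfile d 4|, fun x hx => ?_⟩
  obtain ⟨h1, h2⟩ := hC x hx
  have hdom : IntegrableOn (fun y => 2 * |sqProfile d (‖x - y‖ ^ 2)| + |sqProfile d 4|)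
      (ball (0 : Euc d) 1) := (h1.const_mul 2).add (integrableOn_const measure_ball_lt_top.ne)
  have hle : ∀ᵐ y ∂volume.restrict (ball (0 : Euc d) 1),
      |greenBall d x y| ≤ 2 * |sqProfile d (‖x - y‖ ^ 2)| + |sqProfile d 4| := by
    filter_upwards [ae_restrict_mem measurableSet_unitBall, ae_restrict_of_ae (ae_ne hd x)]
      with y hy hxy using abs_greenBall_le hd hx hy hxy
  have hI : IntegrableOn (greenBall d x) (ball (0 : Euc d) 1) :=
    Integrable.mono' hdom (measurable_greenBall_left x).aestronglyMeasurable hle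
  refine ⟨hI, (integral_mono_ae hI.abs hdom hle).trans ?_⟩
  rw [integral_add (h1.const_mul 2) (integrableOn_const measure_ball_lt_top.ne),
    integral_const_mul]
  linarith

lemma integrable_greenBall (hd : 2 ≤ d) :
    Integrable (fun p : Euc d × Euc d => greenBall d p.1 p.2)
      ((volume.restrict (ball (0 : Euc d) 1)).prod (volume.restrict (ball (0 : Euc d) 1))) := by
  obtain ⟨C, hC⟩ := exists_integral_greenBall_le hd
  have : IsFiniteMeasure (volume.restrict (ball (0 : Euc d) 1)) :=
    isFiniteMeasure_restrict.2 measure_ball_lt_top.ne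
  refine (integrable_prod_iff measurable_greenBall.aestronglyMeasurable).2 ⟨?_, ?_⟩
  · filter_upwards [ae_restrict_mem measurableSet_unitBall] with x hx using (hC x hx).1
  · refine Integrable.mono' (integrable_const C)
      measurable_greenBall.aestronglyMeasurable.norm.integral_prod_right' ?_
    filter_upwards [ae_restrict_mem measurableSet_unitBall] with x hx
    rw [Real.norm_of_nonneg (integral_nonneg fun _ => norm_nonneg _)]
    exact (hC x hx).2

lemma integral_mirror_mul_lap {φ : Euc d → ℝ} (hφ : IsTestFun φ) (hs : tsupport φ ⊆ ball 0 1)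
    (hy : y ∈ ball (0 : Euc d) 1) : ∫ x, sqProfile d (mirrorSq x y) * lap φ x = 0 := by
  obtain ⟨χ, hχ, hχs, hχ1, -⟩ := GFF.exists_cutoff hφ.2.isCompact isOpen_ball hs
  have hq : ∀ x ∈ ball (0 : Euc d) 1, 0 < quadPoly 1 (‖y‖ ^ 2) ((-2 : ℝ) • y) x := fun x hx => by
    rw [← mirrorSq_eq_quadPoly]; exact mirrorSq_pos hx hy
  have hv : ContDiff ℝ 2 fun x => χ x * sqProfile d (mirrorSq x y) := by
    refine contDiff_iff_contDiffAt.2 fun x => ?_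
    by_cases hx : x ∈ ball (0 : Euc d) 1
    · refine hχ.c2.contDiffAt.mul ?_
      simp_rw [mirrorSq_eq_quadPoly]
      exact (contDiffAt_sqProfile (hq x hx)).comp x (contDiff_quadPoly _ _ _).contDiffAt
    · have h0 : χ =ᶠ[𝓝 x] 0 := notMem_tsupport_iff_eventuallyEq.1 fun h => hx (hχs h)
      refine (contDiffAt_const (c := (0 : ℝ))).congr_of_eventuallyEq ?_
      filter_upwards [h0] with z hz
      simp [hz]
  have hcut : ∀ x ∈ tsupport φ, ∀ᶠ z in 𝓝 x, χ z = 1 := fun x hx =>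
    (eventually_nhdsSet_iff_forall.1 hχ1) x hx
  have h := integral_mul_lap hφ.c2 hv hφ.2
  have h1 : ∀ x, φ x * lap (fun x => χ x * sqProfile d (mirrorSq x y)) x = 0 := by
    intro x
    by_cases hx : x ∈ tsupport φ
    · rw [lap_congr (v := fun z => sqProfile d (quadPoly 1 (‖y‖ ^ 2) ((-2 : ℝ) • y) z)),
        lap_comp_quadPoly (contDiffAt_sqProfile (hq x (hs hx))), sqProfile_ode (hq x (hs hx)),
        norm_smul]
      · simp; right; left; ring
      · filter_upwards [hcut x hx] with z hz
        rw [hz, one_mul, mirrorSq_eq_quadPoly]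
    · rw [image_eq_zero_of_notMem_tsupport hx, zero_mul]
  simp_rw [h1, integral_zero] at h
  rw [h]
  refine integral_congr_ae (ae_of_all _ fun x => ?_)
  by_cases hx : x ∈ tsupport φ
  · simp only [(hcut x hx).self_of_nhds]; ring
  · simp [image_eq_zero_of_notMem_tsupport fun h => hx (tsupport_lap_subset φ h)]

lemma integral_greenBall_mul_lap (hd : 2 ≤ d) {φ : Euc d → ℝ} (hφ : IsTestFun φ)
    (hs : tsupport φ ⊆ ball 0 1) (hy : y ∈ ball (0 : Euc d) 1) :
    ∫ x in ball (0 : Euc d) 1, greenBall d x y * lap φ x = -(fundConst d * φ y) := by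
  obtain ⟨C, hC⟩ := (hφ.lap.continuous).bounded_above_of_compact_support hφ.lap.2
  have hz : ∀ x, x ∉ ball (0 : Euc d) 1 → lap φ x = 0 := fun x hx =>
    image_eq_zero_of_notMem_tsupport fun h => hx (hs (tsupport_lap_subset φ h))
  obtain ⟨_, hP⟩ := exists_integral_profile_le hd
  have hp := (hP y hy).1
  have h1 : Integrable (fun x => sqProfile d (‖x - y‖ ^ 2) * lap φ x)
      (volume.restrict (ball (0 : Euc d) 1)) := by
    refine Integrable.mul_bdd (c := C) ?_ hφ.lap.continuous.aestronglyMeasurable (ae_of_all _ hC)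
    refine Integrable.mono hp (measurable_sqProfile.comp (by fun_prop)).aestronglyMeasurable
      (ae_of_all _ fun x => ?_)
    simp [norm_sub_rev x y]
  have h2 : Integrable (fun x => sqProfile d (mirrorSq x y) * lap φ x)
      (volume.restrict (ball (0 : Euc d) 1)) := by
    refine Integrable.mul_bdd (c := C) ?_ hφ.lap.continuous.aestronglyMeasurable (ae_of_all _ hC)
    refine Integrable.mono' (hp.add (integrableOn_const (C := |sqProfile d 4|)
        measure_ball_lt_top.ne))
      (measurable_sqProfile.comp (by unfold mirrorSq; fun_prop)).aestronglyMeasurable ?_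
    filter_upwards [ae_restrict_mem measurableSet_unitBall, ae_restrict_of_ae (ae_ne hd y)]
      with x hx hxy
    rw [Real.norm_eq_abs, mirrorSq_comm]
    exact abs_sqProfile_mirrorSq_le hd hy hx hxy
  simp_rw [greenBall_eq, sub_mul]
  rw [integral_sub h1 h2, setIntegral_eq_integral_of_forall_compl_eq_zero
    (fun x hx => by rw [hz x hx, mul_zero]), setIntegral_eq_integral_of_forall_compl_eq_zero
    (fun x hx => by rw [hz x hx, mul_zero]), integral_profile_mul_lap hd hφ,
    integral_mirror_mul_lap hφ hs hy, sub_zero]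

end Green

section Potential

variable {d : ℕ} {f : Euc d → ℝ}

/-- The Green potential of `f` in the unit ball. -/
def greenPotential (d : ℕ) (f : Euc d → ℝ) (x : Euc d) : ℝ :=
  ∫ y in ball (0 : Euc d) 1, greenBall d x y * f y

lemma integrableOn_greenBall_mul (hd : 2 ≤ d) (hf : Continuous f) (hc : HasCompactSupport f)
    {x : Euc d} (hx : x ∈ ball (0 : Euc d) 1) :
    IntegrableOn (fun y => greenBall d x y * f y) (ball (0 : Euc d) 1) := by
  obtain ⟨C, hC⟩ := hf.bounded_above_of_compact_support hc
  obtain ⟨_, h⟩ := exists_integral_greenBall_le hd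
  exact (h x hx).1.mul_bdd (c := C) hf.aestronglyMeasurable (ae_of_all _ hC)

lemma abs_normSq_sub_le {x x' y : Euc d} (hx : x ∈ ball (0 : Euc d) 1)
    (hx' : x' ∈ ball (0 : Euc d) 1) (hy : y ∈ ball (0 : Euc d) 1) :
    |‖x - y‖ ^ 2 - ‖x' - y‖ ^ 2| ≤ 4 * ‖x - x'‖ := by
  rw [mem_ball_zero_iff] at hx hx' hy
  have h1 := abs_norm_sub_norm_le (x - y) (x' - y)
  rw [sub_sub_sub_cancel_right] at h1
  have h2 : ‖x - y‖ ≤ 2 := by linarith [norm_sub_le x y]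
  have h3 : ‖x' - y‖ ≤ 2 := by linarith [norm_sub_le x' y]
  rw [sq_sub_sq, abs_mul, abs_of_nonneg (by positivity)]
  nlinarith [abs_nonneg (‖x - y‖ - ‖x' - y‖), norm_nonneg (x - y), norm_nonneg (x' - y)]

lemma abs_mirrorSq_sub_le {x x' y : Euc d} (hx : x ∈ ball (0 : Euc d) 1)
    (hx' : x' ∈ ball (0 : Euc d) 1) (hy : y ∈ ball (0 : Euc d) 1) :
    |mirrorSq x y - mirrorSq x' y| ≤ 4 * ‖x - x'‖ := by
  have h0 := abs_normSq_sub_le hx hx' (mem_ball_self one_pos)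
  have e : mirrorSq x y - mirrorSq x' y
      = -(2 * inner ℝ (x - x') y) + (‖x‖ ^ 2 - ‖x'‖ ^ 2) * ‖y‖ ^ 2 := by
    unfold mirrorSq; rw [inner_sub_left]; ring
  rw [mem_ball_zero_iff] at hx hx' hy
  have h1 := abs_norm_sub_norm_le x x'
  have h2 := abs_real_inner_le_norm (x - x') y
  have h3 : |‖x‖ ^ 2 - ‖x'‖ ^ 2| ≤ 2 * ‖x - x'‖ := by
    rw [sq_sub_sq, abs_mul, abs_of_nonneg (by positivity)]
    nlinarith [abs_nonneg (‖x‖ - ‖x'‖), norm_nonneg x, norm_nonneg x']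
  have h4 : ‖y‖ ^ 2 ≤ 1 := pow_le_one₀ (norm_nonneg y) hy.le
  rw [e]
  refine (abs_add_le _ _).trans ?_
  rw [abs_neg, abs_mul, abs_two, abs_mul, abs_of_nonneg (sq_nonneg ‖y‖)]
  nlinarith [norm_nonneg (x - x'), norm_nonneg y, abs_nonneg (‖x‖ ^ 2 - ‖x'‖ ^ 2)]

/-- Lipschitz bounds for the Green kernel when the pole stays away from the boundary. -/
lemma exists_greenBall_bounds (hd : 2 ≤ d) {r₀ r₁ : ℝ} (h : r₀ < r₁) : ∃ L, 0 < L ∧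
    (∀ x ∈ ball (0 : Euc d) 1, ∀ y ∈ ball (0 : Euc d) 1, r₁ ≤ ‖x‖ → ‖y‖ ≤ r₀ →
      |greenBall d x y| ≤ L * (1 - ‖x‖ ^ 2)) ∧
    (∀ x ∈ ball (0 : Euc d) 1, ∀ x' ∈ ball (0 : Euc d) 1, ∀ y ∈ ball (0 : Euc d) 1, r₁ ≤ ‖x‖ →
      r₁ ≤ ‖x'‖ → ‖y‖ ≤ r₀ → |greenBall d x y - greenBall d x' y| ≤ L * ‖x - x'‖) := by
  obtain ⟨L, hL, hlip⟩ := exists_sqProfile_lipschitz hd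
    (show 0 < (r₁ - r₀) ^ 2 from pow_pos (sub_pos.2 h) 2)
  have hp : ∀ x y : Euc d, r₁ ≤ ‖x‖ → ‖y‖ ≤ r₀ → (r₁ - r₀) ^ 2 ≤ ‖x - y‖ ^ 2 := fun x y hx hy =>
    pow_le_pow_left₀ (sub_pos.2 h).le (by linarith [norm_sub_norm_le x y]) 2
  refine ⟨8 * L, by positivity, fun x hx y hy hx1 hy0 => ?_,
    fun x hx x' hx' y hy hx1 hx1' hy0 => ?_⟩
  · have h1 := hlip _ _ (hp x y hx1 hy0) ((hp x y hx1 hy0).trans (normSq_sub_le_mirrorSq hx hy))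
    rw [greenBall_eq]
    refine h1.trans ?_
    have a := one_sub_normSq_pos hx
    have b := one_sub_normSq_pos hy
    rw [mirrorSq_eq, sub_add_cancel_left, abs_neg, abs_of_pos (mul_pos a b)]
    have : 1 - ‖y‖ ^ 2 ≤ 1 := by linarith [sq_nonneg ‖y‖]
    calc L * ((1 - ‖x‖ ^ 2) * (1 - ‖y‖ ^ 2)) ≤ L * ((1 - ‖x‖ ^ 2) * 1) := by gcongr
      _ ≤ 8 * L * (1 - ‖x‖ ^ 2) := by nlinarith [mul_pos hL a]
  · have h1 := hlip _ _ (hp x y hx1 hy0) (hp x' y hx1' hy0)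
    have h2 := hlip _ _ ((hp x y hx1 hy0).trans (normSq_sub_le_mirrorSq hx hy))
      ((hp x' y hx1' hy0).trans (normSq_sub_le_mirrorSq hx' hy))
    have h3 := mul_le_mul_of_nonneg_left (abs_normSq_sub_le hx hx' hy) hL.le
    have h4 := mul_le_mul_of_nonneg_left (abs_mirrorSq_sub_le hx hx' hy) hL.le
    rw [greenBall_eq, greenBall_eq, show ∀ a b c e : ℝ, a - b - (c - e) = (a - c) - (b - e) by
      intros; ring]
    refine (abs_sub _ _).trans ?_
    linarith

lemma exists_bound_greenPotential (hd : 2 ≤ d) (hf : Continuous f) (hc : HasCompactSupport f)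
    (hs : tsupport f ⊆ ball 0 1) :
    ∃ C, 0 < C ∧ (∀ x ∈ ball (0 : Euc d) 1, |greenPotential d f x| ≤ C * (1 - ‖x‖ ^ 2)) ∧
      ∃ r₁ < 1, 0 < r₁ ∧ ∀ x ∈ ball (0 : Euc d) 1, ∀ x' ∈ ball (0 : Euc d) 1, r₁ ≤ ‖x‖ →
        r₁ ≤ ‖x'‖ → |greenPotential d f x - greenPotential d f x'| ≤ C * ‖x - x'‖ := by
  obtain ⟨r₀, hr₀, hsr⟩ := exists_pos_lt_subset_ball one_pos (isClosed_tsupport f) hs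
  obtain ⟨M, hM⟩ := hf.bounded_above_of_compact_support hc
  have hM0 : 0 ≤ M := (norm_nonneg _).trans (hM 0)
  obtain ⟨D, hD⟩ := exists_integral_greenBall_le hd
  have hD0 : 0 ≤ D := (integral_nonneg fun _ => abs_nonneg _).trans (hD 0 (mem_ball_self one_pos)).2
  set r₁ := (1 + r₀) / 2 with hr₁
  have h1 : r₁ < 1 := by linarith [hr₀.2]
  have h2 : r₀ < r₁ := by linarith [hr₀.2]
  have h3 : 0 < r₁ := hr₀.1.trans h2
  obtain ⟨L, hL, hb, hl⟩ := exists_greenBall_bounds (d := d) hd h2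
  set V := volume.real (ball (0 : Euc d) 1)
  have hV : 0 ≤ V := measureReal_nonneg
  have hf0 : ∀ y, r₀ < ‖y‖ → f y = 0 := fun y hy => image_eq_zero_of_notMem_tsupport fun h => by
    have := hsr h; rw [mem_ball_zero_iff] at this; linarith
  have h4 : 0 < 1 - r₁ ^ 2 := by nlinarith
  have hint := fun x hx => integrableOn_greenBall_mul hd hf hc (x := x) hx
  set C := L * M * V + M * D / (1 - r₁ ^ 2) + 1
  have hC1 : L * M * V ≤ C := by
    have : 0 ≤ M * D / (1 - r₁ ^ 2) := by positivity
    linarith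
  have hC2 : M * D / (1 - r₁ ^ 2) ≤ C := by
    have : 0 ≤ L * M * V := by positivity
    linarith
  refine ⟨C, by positivity, fun x hx => ?_, r₁, h1, h3, fun x hx x' hx' hx1 hx1' => ?_⟩
  · have hpos := one_sub_normSq_pos hx
    rcases le_or_gt r₁ ‖x‖ with hxr | hxr
    · have : ‖greenPotential d f x‖ ≤ L * (1 - ‖x‖ ^ 2) * M * V := by
        refine norm_setIntegral_le_of_norm_le_const measure_ball_lt_top fun y hy => ?_
        rcases le_or_gt ‖y‖ r₀ with hyr | hyr
        · rw [norm_mul]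
          exact mul_le_mul (hb x hx y hy hxr hyr) (hM y) (norm_nonneg _) (by positivity)
        · rw [hf0 y hyr, mul_zero, norm_zero]; positivity
      refine (this.trans (le_of_eq ?_)).trans (mul_le_mul_of_nonneg_right hC1 hpos.le)
      ring
    · have : |greenPotential d f x| ≤ M * D := by
        refine (abs_integral_le_integral_abs).trans ?_
        calc _ ≤ ∫ y in ball (0 : Euc d) 1, M * |greenBall d x y| := by
              refine integral_mono (hint x hx).abs ((hD x hx).1.abs.const_mul M) fun y => ?_
              simp only [abs_mul]
              rw [mul_comm]
              exact mul_le_mul_of_nonneg_right (hM y) (abs_nonneg _)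
          _ ≤ M * D := by
              rw [integral_const_mul]
              exact mul_le_mul_of_nonneg_left (hD x hx).2 hM0
      refine this.trans ?_
      have h5 : 1 - r₁ ^ 2 ≤ 1 - ‖x‖ ^ 2 := by nlinarith [norm_nonneg x]
      calc M * D = M * D / (1 - r₁ ^ 2) * (1 - r₁ ^ 2) := by field_simp
        _ ≤ C * (1 - ‖x‖ ^ 2) := by gcongr
  · unfold greenPotential
    rw [← integral_sub (hint x hx) (hint x' hx')]
    have : ‖∫ y in ball (0 : Euc d) 1, (greenBall d x y * f y - greenBall d x' y * f y)‖
        ≤ L * ‖x - x'‖ * M * V := by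
      refine norm_setIntegral_le_of_norm_le_const measure_ball_lt_top fun y hy => ?_
      rcases le_or_gt ‖y‖ r₀ with hyr | hyr
      · rw [← sub_mul, norm_mul]
        exact mul_le_mul (hl x hx x' hx' y hy hx1 hx1' hyr) (hM y) (norm_nonneg _) (by positivity)
      · rw [hf0 y hyr, mul_zero, mul_zero, sub_zero, norm_zero]; positivity
    refine (this.trans (le_of_eq ?_)).trans (mul_le_mul_of_nonneg_right hC1 (norm_nonneg _))
    ring

lemma setIntegral_mul_eq_integral {s : Set (Euc d)} (hs : tsupport f ⊆ s) (g : Euc d → ℝ) :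
    ∫ y in s, g y * f y = ∫ y, g y * f y :=
  setIntegral_eq_integral_of_forall_compl_eq_zero fun y hy => by
    rw [image_eq_zero_of_notMem_tsupport fun h => hy (hs h), mul_zero]

lemma contDiffOn_greenPotential (hd : 2 ≤ d) (hf : IsTestFun f) (hs : tsupport f ⊆ ball 0 1) :
    ContDiffOn ℝ (⊤ : ℕ∞) (greenPotential d f) (ball 0 1) := by
  have hA : ContDiff ℝ (⊤ : ℕ∞) (convolution (fun z : Euc d => sqProfile d (‖z‖ ^ 2)) f
      (ContinuousLinearMap.lsmul ℝ ℝ) volume) :=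
    hf.2.contDiff_convolution_right _ (locallyIntegrable_sqProfile hd) hf.1
  have hV : ContDiffOn ℝ (⊤ : ℕ∞) (fun x : Euc d => convolution (fun _ : Euc d => (1 : ℝ))
      (fun z => sqProfile d (mirrorSq x (-z)) * f (-z))
      (ContinuousLinearMap.lsmul ℝ ℝ) volume 0) (ball 0 1) := by
    refine contDiffOn_convolution_right_with_param_comp
      (g := fun x z => sqProfile d (mirrorSq x (-z)) * f (-z)) (k := -tsupport f)
      (ContinuousLinearMap.lsmul ℝ ℝ) (v := fun _ => 0) contDiffOn_const isOpen_ball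
      hf.2.isCompact.neg (fun x z _ hz => ?_) continuous_const.locallyIntegrable ?_
    · rw [image_eq_zero_of_notMem_tsupport (f := f) (x := -z) (fun h => hz (by simpa using h)), mul_zero]
    · rintro ⟨x, z⟩ ⟨hx, -⟩
      refine ContDiffAt.contDiffWithinAt ?_
      have hfz : ContDiffAt ℝ (⊤ : ℕ∞) (fun p : Euc d × Euc d => f (-p.2)) (x, z) :=
        (hf.1.comp contDiff_snd.neg).contDiffAt
      by_cases hz : -z ∈ tsupport f
      · have hq : 0 < mirrorSq x (-z) := mirrorSq_pos hx (hs hz)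
        refine ContDiffAt.mul ?_ hfz
        refine ContDiffAt.comp (x, z) (g := sqProfile d)
          (f := fun p : Euc d × Euc d => mirrorSq p.1 (-p.2)) (contDiffAt_sqProfile hq) ?_
        unfold mirrorSq
        have hn := contDiff_snd (𝕜 := ℝ) (E := Euc d) (F := Euc d) (n := (⊤ : ℕ∞)).neg
        exact ((contDiff_const.sub (contDiff_const.mul (contDiff_fst.inner ℝ hn))).add
          ((contDiff_fst.norm_sq ℝ).mul (hn.norm_sq ℝ))).contDiffAt
      · refine (contDiffAt_const (c := (0 : ℝ))).congr_of_eventuallyEq ?_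
        have h0 : ∀ᶠ p : Euc d × Euc d in 𝓝 (x, z), f (-p.2) = 0 :=
          (continuous_snd.neg.tendsto (x, z)).eventually (notMem_tsupport_iff_eventuallyEq.1 hz)
        filter_upwards [h0] with p hp
        simp [Function.HasUncurry.uncurry, hp]
  refine (hA.contDiffOn.sub hV).congr fun x hx => ?_
  have hint := integrableOn_greenBall_mul hd hf.continuous hf.2 hx
  have e1 : convolution (fun z : Euc d => sqProfile d (‖z‖ ^ 2)) f
      (ContinuousLinearMap.lsmul ℝ ℝ) volume x = ∫ y, sqProfile d (‖x - y‖ ^ 2) * f y := by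
    rw [convolution_def, ← integral_sub_left_eq_self _ volume x]
    simp
  have e2 : convolution (fun _ : Euc d => (1 : ℝ))
      (fun z => sqProfile d (mirrorSq x (-z)) * f (-z))
      (ContinuousLinearMap.lsmul ℝ ℝ) volume 0 = ∫ y, sqProfile d (mirrorSq x y) * f y := by
    rw [convolution_def]
    simp
  have hP : IntegrableOn (fun y => sqProfile d (‖x - y‖ ^ 2) * f y) (ball (0 : Euc d) 1) := by
    obtain ⟨C, hC⟩ := hf.continuous.bounded_above_of_compact_support hf.2
    obtain ⟨_, h⟩ := exists_integral_profile_le hd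
    refine Integrable.mul_bdd (c := C) ?_ hf.continuous.aestronglyMeasurable (ae_of_all _ hC)
    exact Integrable.mono (h x hx).1 (measurable_sqProfile.comp (by fun_prop)).aestronglyMeasurable
      (ae_of_all _ fun y => by simp)
  have hM : IntegrableOn (fun y => sqProfile d (mirrorSq x y) * f y) (ball (0 : Euc d) 1) := by
    refine (hP.sub hint).congr (ae_of_all _ fun y => ?_)
    simp only [greenBall_eq, Pi.sub_apply]; ring
  simp only [e1, e2, greenPotential, greenBall_eq, sub_mul]
  rw [integral_sub hP hM, setIntegral_mul_eq_integral hs, setIntegral_mul_eq_integral hs]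

lemma ContDiffAt.lap {n m : WithTop ℕ∞} {u : Euc d → ℝ} {x : Euc d} (hu : ContDiffAt ℝ n u x)
    (h : m + 2 ≤ n) : ContDiffAt ℝ m (_root_.lap u) x := by
  have h1 : ContDiffAt ℝ (m + 1) (fderiv ℝ u) x := hu.fderiv_right (by
    rw [add_assoc, one_add_one_eq_two]; exact h)
  have h2 : ContDiffAt ℝ m (fderiv ℝ (fderiv ℝ u)) x := h1.fderiv_right le_rfl
  rw [lap_eq_clm]
  exact (ContinuousLinearMap.contDiff _).contDiffAt.comp x h2

lemma integral_greenPotential_mul_lap (hd : 2 ≤ d) (hf : IsTestFun f)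
    {φ : Euc d → ℝ} (hφ : IsTestFun φ) (hφs : tsupport φ ⊆ ball 0 1) :
    ∫ x in ball (0 : Euc d) 1, lap φ x * greenPotential d f x
      = -(fundConst d * ∫ x, φ x * f x) := by
  obtain ⟨A, hA⟩ := hf.continuous.bounded_above_of_compact_support hf.2
  obtain ⟨B, hB⟩ := hφ.lap.continuous.bounded_above_of_compact_support hφ.lap.2
  have hint : Integrable (fun p : Euc d × Euc d => greenBall d p.1 p.2 * lap φ p.1 * f p.2)
      ((volume.restrict (ball (0 : Euc d) 1)).prod (volume.restrict (ball (0 : Euc d) 1))) := by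
    refine ((integrable_greenBall hd).mul_bdd (c := B) ?_ (ae_of_all _ fun p => hB p.1)).mul_bdd
      (c := A) ?_ (ae_of_all _ fun p => hA p.2)
    · exact (hφ.lap.continuous.comp continuous_fst).aestronglyMeasurable
    · exact (hf.continuous.comp continuous_snd).aestronglyMeasurable
  have h1 : ∀ x, lap φ x * greenPotential d f x
      = ∫ y in ball (0 : Euc d) 1, greenBall d x y * lap φ x * f y := fun x => by
    rw [greenPotential, ← integral_const_mul]
    exact integral_congr_ae (ae_of_all _ fun y => by ring)
  simp_rw [h1]
  rw [integral_integral_swap hint]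
  have h2 : ∀ y ∈ ball (0 : Euc d) 1, ∫ x in ball (0 : Euc d) 1, greenBall d x y * lap φ x * f y
      = f y * -(fundConst d) * φ y := fun y hy => by
    rw [integral_mul_const, integral_greenBall_mul_lap hd hφ hφs hy]; ring
  rw [setIntegral_congr_fun measurableSet_unitBall h2, setIntegral_mul_eq_integral hφs,
    ← neg_mul, ← integral_const_mul]
  exact integral_congr_ae (ae_of_all _ fun y => by ring)

lemma lap_greenPotential (hd : 2 ≤ d) (hf : IsTestFun f) (hs : tsupport f ⊆ ball 0 1) :
    ∀ x ∈ ball (0 : Euc d) 1, lap (greenPotential d f) x = -(fundConst d * f x) := by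
  have hU := contDiffOn_greenPotential hd hf hs
  have hUat : ∀ x ∈ ball (0 : Euc d) 1, ContDiffAt ℝ (⊤ : ℕ∞) (greenPotential d f) x :=
    fun x hx => hU.contDiffAt (isOpen_ball.mem_nhds hx)
  have hcl : ContinuousOn (lap (greenPotential d f)) (ball 0 1) := fun x hx =>
    ((hUat x hx).lap (m := 0) (by
    rw [zero_add]; exact WithTop.coe_le_coe.2 (le_top : (2 : ℕ∞) ≤ ⊤))).continuousAt.continuousWithinAt
  have hcont : ContinuousOn (fun x => lap (greenPotential d f) x + fundConst d * f x) (ball 0 1) :=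
    hcl.add (continuous_const.mul hf.continuous).continuousOn
  have hae := isOpen_ball.ae_eq_zero_of_integral_contDiff_smul_eq_zero
    (hcont.locallyIntegrableOn (μ := volume) measurableSet_unitBall) fun φ hφ hφc hφs => by
      have hφt : IsTestFun φ := ⟨hφ, hφc⟩
      obtain ⟨χ, hχ, hχs, hχ1, -⟩ := GFF.exists_cutoff hφt.2.isCompact isOpen_ball hφs
      have hcut : ∀ x ∈ tsupport φ, ∀ᶠ z in 𝓝 x, χ z = 1 := fun x hx =>
        (eventually_nhdsSet_iff_forall.1 hχ1) x hx
      have hv : ContDiff ℝ (⊤ : ℕ∞) fun x => χ x * greenPotential d f x := by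
        refine contDiff_iff_contDiffAt.2 fun x => ?_
        by_cases hx : x ∈ ball (0 : Euc d) 1
        · exact hχ.1.contDiffAt.mul (hUat x hx)
        · have h0 : χ =ᶠ[𝓝 x] 0 := notMem_tsupport_iff_eventuallyEq.1 fun h => hx (hχs h)
          refine (contDiffAt_const (c := (0 : ℝ))).congr_of_eventuallyEq ?_
          filter_upwards [h0] with z hz
          simp [hz]
      have hv2 : ContDiff ℝ 2 fun x => χ x * greenPotential d f x :=
        hv.of_le (WithTop.coe_le_coe.2 (le_top : (2 : ℕ∞) ≤ ⊤))
      have h := integral_mul_lap hφt.c2 hv2 hφt.2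
      have e1 : ∀ x, φ x * lap (fun x => χ x * greenPotential d f x) x
          = φ x * lap (greenPotential d f) x := fun x => by
        by_cases hx : x ∈ tsupport φ
        · rw [lap_congr (v := greenPotential d f)]
          filter_upwards [hcut x hx] with z hz
          rw [hz, one_mul]
        · rw [image_eq_zero_of_notMem_tsupport hx, zero_mul, zero_mul]
      have e2 : ∀ x, lap φ x * (χ x * greenPotential d f x) = greenPotential d f x * lap φ x :=
        fun x => by
        by_cases hx : x ∈ tsupport φ
        · rw [(hcut x hx).self_of_nhds]; ring
        · simp [image_eq_zero_of_notMem_tsupport fun h => hx (tsupport_lap_subset φ h)]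
      have hi : Integrable fun x => φ x * lap (fun x => χ x * greenPotential d f x) x := by
        refine Continuous.integrable_of_hasCompactSupport ?_ hφt.2.mul_right
        exact hφt.continuous.mul (hv2.lap (m := 0) (by norm_num)).continuous
      simp_rw [e1, e2] at h
      simp_rw [e1] at hi
      rw [← setIntegral_mul_eq_integral ((tsupport_lap_subset φ).trans hφs)] at h
      simp_rw [smul_eq_mul, mul_add]
      have hi2 : Integrable fun x => φ x * (fundConst d * f x) :=
        (hφt.continuous.mul (continuous_const.mul
          hf.continuous)).integrable_of_hasCompactSupport hφt.2.mul_right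
      have e3 : ∫ x, φ x * (fundConst d * f x) = fundConst d * ∫ x, φ x * f x := by
        rw [← integral_const_mul]
        exact integral_congr_ae (ae_of_all _ fun x => by ring)
      rw [integral_add hi hi2, h, e3]
      simp_rw [mul_comm (greenPotential d f _)]
      rw [integral_greenPotential_mul_lap hd hf hφt hφs, neg_add_cancel]
  have heq := Measure.eqOn_open_of_ae_eq (μ := volume) (U := ball (0 : Euc d) 1)
    (g := fun _ => (0 : ℝ)) ((ae_restrict_iff' measurableSet_unitBall).2 hae) isOpen_ball hcont
    continuousOn_const
  intro x hx
  have := heq hx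
  simp only at this
  linarith

lemma exists_bound_fderiv_greenPotential (hd : 2 ≤ d) (hf : Continuous f)
    (hc : HasCompactSupport f) (hs : tsupport f ⊆ ball 0 1) :
    ∃ C, 0 < C ∧ (∀ x ∈ ball (0 : Euc d) 1, |greenPotential d f x| ≤ C * (1 - ‖x‖ ^ 2)) ∧
      ∃ r₁ < 1, 0 < r₁ ∧ ∀ x ∈ ball (0 : Euc d) 1, r₁ < ‖x‖ →
        ‖fderiv ℝ (greenPotential d f) x‖ ≤ C := by
  obtain ⟨C, hC, h1, r₁, hr1, hr0, h2⟩ := exists_bound_greenPotential hd hf hc hs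
  refine ⟨C, hC, h1, r₁, hr1, hr0, fun x hx hxr => norm_fderiv_le_of_lip' ℝ hC.le ?_⟩
  filter_upwards [isOpen_ball.mem_nhds hx, continuous_norm.continuousAt.eventually
    (lt_mem_nhds hxr)] with z hz hzr
  exact h2 z hz x hx hzr.le hxr.le

end Potential

section BoundaryLayer

variable {d : ℕ}

/-- A smooth bump on the line, equal to `1` on `[1, 2]` and supported in `[1/2, 5/2]`. -/
def layerBump : ContDiffBump (3 / 2 : ℝ) := ⟨1 / 2, 1, by norm_num, by norm_num⟩

/-- A radial bump of height `N` on a shell of width of order `1 / N` inside the unit sphere. -/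
def layer (N : ℝ) (x : Euc d) : ℝ := N * layerBump (N * (1 - ‖x‖ ^ 2))

/-- A radial cutoff that is `1` well inside the unit ball and vanishes near the unit sphere. -/
def radialCutoff (N : ℝ) (x : Euc d) : ℝ := Real.smoothTransition (quadPoly (N - 1) (-N) 0 x)

lemma quadPoly_radial (N : ℝ) (x : Euc d) :
    quadPoly (N - 1) (-N) 0 x = N * (1 - ‖x‖ ^ 2) - 1 := by
  simp only [quadPoly, inner_zero_left]; ring

section layer

variable {N : ℝ} {x : Euc d}

lemma layer_nonneg (hN : 0 ≤ N) (x : Euc d) : 0 ≤ layer N x :=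
  mul_nonneg hN layerBump.nonneg

lemma layer_eq_of_mem (h1 : 1 ≤ N * (1 - ‖x‖ ^ 2)) (h2 : N * (1 - ‖x‖ ^ 2) ≤ 2) :
    layer N x = N := by
  rw [layer, layerBump.one_of_mem_closedBall, mul_one]
  rw [Real.closedBall_eq_Icc]
  constructor <;> simp only [layerBump] <;> linarith

lemma bounds_of_layer_ne_zero (h : layer N x ≠ 0) :
    1 / 2 < N * (1 - ‖x‖ ^ 2) ∧ N * (1 - ‖x‖ ^ 2) < 5 / 2 := by
  have h1 : layerBump (N * (1 - ‖x‖ ^ 2)) ≠ 0 := right_ne_zero_of_mul h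
  have h2 : N * (1 - ‖x‖ ^ 2) ∈ Function.support layerBump := h1
  rw [layerBump.support_eq, Real.ball_eq_Ioo] at h2
  obtain ⟨h3, h4⟩ := h2
  simp only [layerBump] at h3 h4
  constructor <;> linarith

lemma norm_bounds_of_layer_ne_zero (hN : 0 < N) (h : layer N x ≠ 0) :
    1 - 5 / (2 * N) ≤ ‖x‖ ∧ ‖x‖ ≤ 1 := by
  obtain ⟨h1, h2⟩ := bounds_of_layer_ne_zero h
  have h3 : 0 < 1 - ‖x‖ ^ 2 := by
    by_contra! h4
    nlinarith
  have h4 : 1 - ‖x‖ ^ 2 < 5 / (2 * N) := by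
    rw [lt_div_iff₀ (by positivity)]; linarith
  have h5 : ‖x‖ ≤ 1 := by nlinarith [norm_nonneg x]
  exact ⟨by nlinarith [norm_nonneg x], h5⟩

lemma isTestFun_layer (hN : 0 < N) : IsTestFun (layer N : Euc d → ℝ) := by
  refine ⟨contDiff_const.mul (layerBump.contDiff.comp
    (contDiff_const.mul (contDiff_const.sub (contDiff_norm_sq ℝ)))), ?_⟩
  refine HasCompactSupport.intro (isCompact_closedBall (0 : Euc d) 1) fun x hx => ?_
  by_contra h
  exact hx (mem_closedBall_zero_iff.2 (norm_bounds_of_layer_ne_zero hN h).2)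

lemma integral_layer_le (hN : 3 ≤ N) :
    ∫ x : Euc d, layer N x ≤ 5 * d / 2 * volume.real (ball (0 : Euc d) 1) := by
  have hN0 : 0 < N := by linarith
  set s : ℝ := 1 - 5 / (2 * N) with hs
  have hs0 : 0 < s := by
    rw [hs, sub_pos, div_lt_one (by positivity)]; linarith
  have hs1 : s ≤ 1 := by rw [hs]; simp; positivity
  set A : Set (Euc d) := closedBall 0 1 \ ball 0 s with hA
  have hAm : MeasurableSet A := measurableSet_closedBall.diff measurableSet_ball
  have hAf : volume A ≠ ⊤ := (measure_mono sdiff_subset |>.trans_lt measure_closedBall_lt_top).ne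
  have hvol : volume.real A = (1 - s ^ d) * volume.real (ball (0 : Euc d) 1) := by
    rw [hA, measureReal_sdiff (ball_subset_closedBall.trans (closedBall_subset_closedBall hs1))
      measurableSet_ball measure_closedBall_lt_top.ne,
      Measure.addHaar_real_closedBall _ _ zero_le_one, measureReal_def (μ := volume) (s := ball 0 s),
      Measure.addHaar_ball_of_pos _ _ hs0, ENNReal.toReal_mul,
      ENNReal.toReal_ofReal (by positivity), ← measureReal_def, finrank_euclideanSpace_fin]
    ring
  have hb : 1 - s ^ d ≤ d * (5 / (2 * N)) := by
    have := one_add_mul_le_pow (a := s - 1) (by linarith) d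
    rw [add_sub_cancel] at this
    have e : s - 1 = -(5 / (2 * N)) := by rw [hs]; ring
    rw [e] at this
    linarith
  calc ∫ x : Euc d, layer N x ≤ ∫ x, A.indicator (fun _ => N) x := by
        refine integral_mono ((isTestFun_layer hN0).continuous.integrable_of_hasCompactSupport
          (isTestFun_layer hN0).2) ((integrable_indicator_iff hAm).2 (integrableOn_const hAf))
          fun x => ?_
        by_cases h : layer N x = 0
        · rw [h]; exact indicator_nonneg (fun _ _ => hN0.le) x
        · have hxb := norm_bounds_of_layer_ne_zero hN0 h
          rw [indicator_of_mem (show x ∈ A from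
            ⟨mem_closedBall_zero_iff.2 hxb.2, fun h' => (mem_ball_zero_iff.1 h').not_ge hxb.1⟩)]
          exact mul_le_of_le_one_right hN0.le layerBump.le_one
    _ = volume.real A * N := by
        rw [integral_indicator hAm, setIntegral_const, smul_eq_mul]
    _ ≤ d * (5 / (2 * N)) * volume.real (ball (0 : Euc d) 1) * N := by
        rw [hvol]; gcongr
    _ = _ := by field_simp

lemma isTestFun_radialCutoff_mul {U : Euc d → ℝ} (hN : 0 < N)
    (hU : ContDiffOn ℝ (⊤ : ℕ∞) U (ball 0 1)) :
    IsTestFun (fun x => radialCutoff N x * U x) ∧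
      tsupport (fun x => radialCutoff N x * U x) ⊆ ball 0 1 := by
  set K : Set (Euc d) := {x | 1 / N ≤ 1 - ‖x‖ ^ 2} with hK
  have hKb : K ⊆ ball 0 1 := fun x hx => by
    have : 0 < 1 / N := by positivity
    have hx' : 1 / N ≤ 1 - ‖x‖ ^ 2 := hx
    rw [mem_ball_zero_iff]; nlinarith [norm_nonneg x]
  have hKc : IsClosed K := isClosed_le continuous_const (by fun_prop)
  have hs : tsupport (fun x => radialCutoff N x * U x) ⊆ K := by
    refine closure_minimal (fun x hx => ?_) hKc
    by_contra h
    refine hx ?_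
    have h' : ¬ (1 / N ≤ 1 - ‖x‖ ^ 2) := h
    rw [div_le_iff₀' hN, not_le] at h'
    simp only
    rw [radialCutoff, quadPoly_radial, Real.smoothTransition.zero_of_nonpos (by linarith), zero_mul]
  refine ⟨⟨?_, ?_⟩, hs.trans hKb⟩
  · refine contDiff_iff_contDiffAt.2 fun x => ?_
    by_cases hx : x ∈ tsupport fun x => radialCutoff N x * U x
    swap
    · exact contDiffAt_const.congr_of_eventuallyEq (notMem_tsupport_iff_eventuallyEq.1 hx)
    refine ContDiffAt.mul ?_ (hU.contDiffAt (isOpen_ball.mem_nhds (hKb (hs hx))))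
    exact (Real.smoothTransition.contDiff.comp (contDiff_quadPoly _ _ _)).contDiffAt
  · refine (isCompact_closedBall (0 : Euc d) 1).of_isClosed_subset (isClosed_tsupport _) ?_
    exact (hs.trans hKb).trans ball_subset_closedBall

end layer

namespace GFF

variable {Ω : Type} [MeasurableSpace Ω] {X : GFF d Ω}

lemma tendsto_cov_self_of_layer (hd : 0 < d) {N : ℕ → ℝ} (hN4 : ∀ n, 4 ≤ N n)
    (hN : Tendsto N atTop atTop) {F : ℕ → Euc d → ℝ} {A : ℝ} (hF : ∀ n, IsTestFun (F n))
    (h1 : ∀ n x, layer (N n) x ≤ F n x) (h2 : ∀ n x, F n x ≤ A * layer (N n) x) :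
    Tendsto (fun n => X.cov (F n) (F n)) atTop (𝓝 0) := by
  have hN0 : ∀ n, 0 < N n := fun n => by linarith [hN4 n]
  have hsub : ∀ n, tsupport (F n) ⊆ {x | 1 - 5 / (2 * N n) ≤ ‖x‖ ∧ ‖x‖ ≤ 1} := by
    intro n
    refine closure_minimal (fun x hx => ?_) ((isClosed_le continuous_const continuous_norm).inter
      (isClosed_le continuous_norm continuous_const))
    refine norm_bounds_of_layer_ne_zero (hN0 n) fun h0 => hx ?_
    have := h1 n x
    have := h2 n x
    rw [h0] at *
    linarith
  obtain ⟨p, hp⟩ : ∃ p : ℕ → Euc d, ∀ n, ‖p n‖ ^ 2 = 1 - 3 / (2 * N n) := by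
    refine ⟨fun n => √(1 - 3 / (2 * N n)) • EuclideanSpace.single ⟨0, hd⟩ 1, fun n => ?_⟩
    rw [norm_smul, PiLp.norm_single, norm_one, mul_one, Real.norm_eq_abs, sq_abs, Real.sq_sqrt]
    rw [sub_nonneg, div_le_one (by have := hN0 n; positivity)]
    linarith [hN4 n]
  have hpm : ∀ n, p n ∈ tsupport (F n) := by
    intro n
    refine subset_tsupport _ fun h0 => ?_
    have h3 : N n * (1 - ‖p n‖ ^ 2) = 3 / 2 := by
      rw [hp]; field_simp [(hN0 n).ne']; ring
    have := h1 n (p n)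
    rw [layer_eq_of_mem (by rw [h3]; norm_num) (by rw [h3]; norm_num), h0] at this
    linarith [hN0 n]
  have key := X.zero_bdry F hF (fun n x => (layer_nonneg (hN0 n).le x).trans (h1 n x)) ?_ ?_ ?_
  · simpa only [GFF.cov, ← sq] using key
  · refine ⟨|A| * (5 * d / 2 * volume.real (ball (0 : Euc d) 1)), fun n => ?_⟩
    have hl := isTestFun_layer (d := d) (hN0 n)
    calc ∫ x, F n x ≤ ∫ x, |A| * layer (N n) x := by
          refine integral_mono ((hF n).continuous.integrable_of_hasCompactSupport (hF n).2)
            ((hl.continuous.integrable_of_hasCompactSupport hl.2).const_mul _) fun x => ?_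
          exact (h2 n x).trans (mul_le_mul_of_nonneg_right (le_abs_self A)
            (layer_nonneg (hN0 n).le x))
      _ = |A| * ∫ x, layer (N n) x := integral_const_mul _ _
      _ ≤ _ := mul_le_mul_of_nonneg_left (integral_layer_le (by linarith [hN4 n])) (abs_nonneg A)
  · refine tendsto_of_tendsto_of_tendsto_of_le_of_le (g := fun n => 1 - 5 / (2 * N n))
      (h := fun _ => (1 : ℝ)) ?_ tendsto_const_nhds (fun n => ?_) (fun n => ?_)
    · have : Tendsto (fun n => 5 / (2 * N n)) atTop (𝓝 0) :=
        tendsto_const_nhds.div_atTop (hN.const_mul_atTop two_pos)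
      simpa using this.const_sub 1
    · refine (le_infDist ⟨_, hpm n⟩).2 fun y hy => ?_
      rw [dist_zero_left]
      exact (hsub n hy).1
    · refine (infDist_le_dist_of_mem (hpm n)).trans ?_
      rw [dist_zero_left]
      exact (hsub n (hpm n)).2
  · refine ⟨|A|, fun n x y hxy _ => (h2 n x).trans ?_⟩
    have e : layer (N n) x = layer (N n) y := by rw [layer, layer, hxy]
    rw [e]
    exact (mul_le_mul_of_nonneg_right (le_abs_self A) (layer_nonneg (hN0 n).le y)).trans
      (mul_le_mul_of_nonneg_left (h1 n y) (abs_nonneg A))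

lemma tendsto_cov_self_of_abs_le_layer (hd : 0 < d) {N : ℕ → ℝ} (hN4 : ∀ n, 4 ≤ N n)
    (hN : Tendsto N atTop atTop) {e : ℕ → Euc d → ℝ} {M : ℝ} (hM : 0 ≤ M)
    (he : ∀ n, IsTestFun (e n)) (h : ∀ n x, |e n x| ≤ M * layer (N n) x) :
    Tendsto (fun n => X.cov (e n) (e n)) atTop (𝓝 0) := by
  have hN0 : ∀ n, 0 < N n := fun n => by linarith [hN4 n]
  have hl : ∀ n, IsTestFun ((M + 1) • layer (N n) : Euc d → ℝ) :=
    fun n => (isTestFun_layer (hN0 n)).smul _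
  have hF : ∀ n, IsTestFun (e n + (M + 1) • layer (N n)) := fun n => (he n).add (hl n)
  have hpos := fun n (x : Euc d) => layer_nonneg (hN0 n).le x
  have t1 := tendsto_cov_self_of_layer (X := X) hd hN4 hN (A := 2 * M + 1) hF
    (fun n x => by
      have := abs_le.1 (h n x)
      simp only [Pi.add_apply, Pi.smul_apply, smul_eq_mul]; linarith)
    (fun n x => by
      have := abs_le.1 (h n x)
      simp only [Pi.add_apply, Pi.smul_apply, smul_eq_mul]; linarith)
  have t2 := tendsto_cov_self_of_layer (X := X) hd hN4 hN (A := M + 1) hl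
    (fun n x => by
      simp only [Pi.smul_apply, smul_eq_mul]; nlinarith [hpos n x])
    (fun n x => le_rfl)
  refine squeeze_zero (fun n => cov_self_nonneg _) (fun n => ?_)
    (by simpa using (t1.const_mul 2).add (t2.const_mul 2))
  have hs := cov_self_nonneg (X := X) ((e n + (M + 1) • layer (N n)) + (M + 1) • layer (N n))
  set a := e n + (M + 1) • layer (N n) with ha
  set b : Euc d → ℝ := (M + 1) • layer (N n) with hb
  have hea : e n = a - b := by rw [ha]; abel
  have h1 : X.cov (e n) (e n) = X.cov a a - 2 * X.cov a b + X.cov b b := by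
    rw [hea, cov_sub_left (hF n) (hl n) ((hF n).sub (hl n)), cov_sub_right (hF n) (hl n) (hF n),
      cov_sub_right (hF n) (hl n) (hl n), cov_comm b a]
    ring
  rw [cov_add_left (hF n) (hl n) ((hF n).add (hl n)), cov_add_right (hF n) (hl n) (hF n),
    cov_add_right (hF n) (hl n) (hl n), cov_comm b a] at hs
  linarith

end GFF

end BoundaryLayer

section CovarianceFormula

variable {d : ℕ}

lemma exists_deriv_smoothTransition_bound : ∃ S : ℝ, 0 ≤ S ∧ ∀ q ∈ Icc (0 : ℝ) 1,
    |deriv Real.smoothTransition q| ≤ S ∧ |deriv (deriv Real.smoothTransition) q| ≤ S := by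
  have hσ : ContDiff ℝ 2 Real.smoothTransition := Real.smoothTransition.contDiff
  have h1 : ContDiff ℝ 1 (deriv Real.smoothTransition) :=
    (contDiff_succ_iff_deriv.1 (show ContDiff ℝ (1 + 1) Real.smoothTransition from hσ)).2.2
  have h2 : Continuous (deriv (deriv Real.smoothTransition)) := h1.continuous_deriv le_rfl
  obtain ⟨A, hA⟩ := (isCompact_Icc (a := (0 : ℝ)) (b := 1)).exists_bound_of_continuousOn
    h1.continuous.continuousOn
  obtain ⟨B, hB⟩ := (isCompact_Icc (a := (0 : ℝ)) (b := 1)).exists_bound_of_continuousOn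
    h2.continuousOn
  refine ⟨max (max A B) 0, le_max_right _ _, fun q hq => ⟨?_, ?_⟩⟩
  · exact (hA q hq).trans ((le_max_left _ _).trans (le_max_left _ _))
  · exact (hB q hq).trans ((le_max_right _ _).trans (le_max_left _ _))

lemma abs_lap_radialCutoff_mul_le {N S C : ℝ} {x : Euc d} {U : Euc d → ℝ} (hN : 1 ≤ N)
    (hS0 : 0 ≤ S) (hC0 : 0 ≤ C)
    (hS : ∀ q ∈ Icc (0 : ℝ) 1,
      |deriv Real.smoothTransition q| ≤ S ∧ |deriv (deriv Real.smoothTransition) q| ≤ S)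
    (hU : ContDiffAt ℝ 2 U x) (hx : ‖x‖ ≤ 1) (h1 : 1 ≤ N * (1 - ‖x‖ ^ 2))
    (h2 : N * (1 - ‖x‖ ^ 2) ≤ 2) (hlap : lap U x = 0) (hUx : |U x| ≤ C * (1 - ‖x‖ ^ 2))
    (hU' : ‖fderiv ℝ U x‖ ≤ C) :
    |lap (fun y => radialCutoff N y * U y) x| ≤ (8 * d + 16) * S * C * N := by
  have hσ : ContDiff ℝ 2 Real.smoothTransition := Real.smoothTransition.contDiff
  have hχ : ContDiff ℝ 2 (radialCutoff N : Euc d → ℝ) := hσ.comp (contDiff_quadPoly _ _ _)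
  set q := quadPoly (N - 1) (-N) 0 x with hq
  have hq' : q = N * (1 - ‖x‖ ^ 2) - 1 := quadPoly_radial N x
  have hq0 : 0 ≤ q := by linarith
  have hq1 : q ≤ 1 := by linarith
  obtain ⟨b1, b2⟩ := hS q ⟨hq0, hq1⟩
  rw [lap_mul hχ.contDiffAt hU, hlap, mul_zero, zero_add]
  have hlapχ : |lap (radialCutoff N) x| ≤ (2 * d + 8) * S * N ^ 2 := by
    have e : lap (radialCutoff N) x = -N * (4 * q * deriv (deriv Real.smoothTransition) q
        + 2 * d * deriv Real.smoothTransition q)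
        + (‖(0 : Euc d)‖ ^ 2 - 4 * (N - 1) * (-N)) * deriv (deriv Real.smoothTransition) q :=
      lap_comp_quadPoly (S := Real.smoothTransition) hσ.contDiffAt
    have e' : lap (radialCutoff N) x = (4 * N * ((N - 1) - q)) * deriv (deriv Real.smoothTransition) q
        + (-(2 * d * N)) * deriv Real.smoothTransition q := by
      rw [e, norm_zero]; ring
    rw [e']
    have a1 : |4 * N * ((N - 1) - q)| ≤ 8 * N ^ 2 := by
      rw [abs_le]; constructor <;> nlinarith
    have a2 : |-(2 * d * N)| ≤ 2 * d * N ^ 2 := by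
      rw [abs_neg, abs_of_nonneg (by positivity)]
      have : N ≤ N ^ 2 := by nlinarith
      gcongr
    calc _ ≤ |4 * N * ((N - 1) - q)| * |deriv (deriv Real.smoothTransition) q|
          + |-(2 * d * N)| * |deriv Real.smoothTransition q| := by
          rw [← abs_mul, ← abs_mul]; exact abs_add_le _ _
      _ ≤ 8 * N ^ 2 * S + 2 * d * N ^ 2 * S := by gcongr
      _ = _ := by ring
  have hUN : |U x| ≤ 2 * C / N := by
    refine hUx.trans ?_
    rw [le_div_iff₀ (by linarith)]
    nlinarith
  have hprod : |lap (radialCutoff N) x * U x| ≤ (4 * d + 16) * S * C * N := by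
    rw [abs_mul]
    calc _ ≤ (2 * d + 8) * S * N ^ 2 * (2 * C / N) := by gcongr
      _ = _ := by field_simp; ring
  have hpd : ∀ i, |pd i (radialCutoff N) x * pd i U x| ≤ 2 * N * S * C := by
    intro i
    have e : pd i (radialCutoff N) x = deriv Real.smoothTransition q * ((0 : Euc d) i + 2 * (-N) * x i) := by
      rw [← pd_quadPoly (N - 1)]
      exact pd_comp i (hσ.differentiable (by norm_num) _)
        ((contDiff_quadPoly (n := 1) _ _ _).differentiable (by norm_num) _)
    have hxi : |x i| ≤ 1 := (PiLp.norm_apply_le x i).trans hx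
    have c1 : |pd i (radialCutoff N) x| ≤ 2 * N * S := by
      rw [e, abs_mul]
      have : |(0 : Euc d) i + 2 * (-N) * x i| ≤ 2 * N := by
        simp only [PiLp.zero_apply, zero_add, abs_mul, abs_neg, abs_two, abs_of_nonneg (show 0 ≤ N by linarith)]
        nlinarith
      calc _ ≤ S * (2 * N) := by gcongr
        _ = _ := by ring
    have c2 : |pd i U x| ≤ C := by
      refine ((fderiv ℝ U x).le_opNorm _).trans ?_
      rw [PiLp.norm_single, norm_one, mul_one]
      exact hU'
    rw [abs_mul]
    gcongr
  have hsum : |2 * ∑ i, pd i (radialCutoff N) x * pd i U x| ≤ 4 * d * S * C * N := by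
    rw [abs_mul, abs_two]
    calc _ ≤ 2 * ∑ i : Fin d, 2 * N * S * C := by
          gcongr
          exact (Finset.abs_sum_le_sum_abs _ _).trans (Finset.sum_le_sum fun i _ => hpd i)
      _ = _ := by simp; ring
  calc _ ≤ _ := abs_add_le _ _
    _ ≤ 4 * d * S * C * N + (4 * d + 16) * S * C * N := add_le_add hsum hprod
    _ = _ := by ring

lemma exists_abs_lap_radialCutoff_mul_add_le (hd : 2 ≤ d) {f : Euc d → ℝ} (hf : IsTestFun f)
    (hs : tsupport f ⊆ ball 0 1) : ∃ M N₀ : ℝ, 0 ≤ M ∧ 4 ≤ N₀ ∧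
      (∀ N ≥ N₀, ∀ x ∈ tsupport f, radialCutoff N x = 1) ∧ ∀ N ≥ N₀, ∀ x,
      |lap (fun y => radialCutoff N y * greenPotential d f y) x + fundConst d * f x|
        ≤ M * layer N x := by
  obtain ⟨C, hC, hU, r₁, hr1, hr0, hU'⟩ :=
    exists_bound_fderiv_greenPotential hd hf.continuous hf.2 hs
  obtain ⟨r₂, ⟨hr2, hr2'⟩, hsr⟩ :=
    exists_pos_lt_subset_ball one_pos (isClosed_tsupport f) hs
  obtain ⟨S, hS0, hS⟩ := exists_deriv_smoothTransition_bound
  have hUc := contDiffOn_greenPotential hd hf hs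
  set r := max ((1 + r₁) / 2) r₂ with hr
  have hr1' : r < 1 := max_lt (by linarith) hr2'
  have hrpos : 0 < r := lt_max_of_lt_right hr2
  have hrr : 0 < 1 - r ^ 2 := by nlinarith
  obtain ⟨N₁, hN₁, key⟩ : ∃ N₁ ≥ (4 : ℝ), ∀ N ≥ N₁, ∀ x : Euc d,
      N * (1 - ‖x‖ ^ 2) ≤ 2 → r ≤ ‖x‖ := by
    refine ⟨max 4 (2 / (1 - r ^ 2)), le_max_left _ _, fun N hN x hx => ?_⟩
    have h2 : 2 / (1 - r ^ 2) ≤ N := (le_max_right _ _).trans hN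
    have h4 : 4 ≤ N := (le_max_left _ _).trans hN
    rw [div_le_iff₀ hrr] at h2
    have : N * (1 - ‖x‖ ^ 2) ≤ N * (1 - r ^ 2) := by linarith
    have := le_of_mul_le_mul_left this (by linarith)
    nlinarith [norm_nonneg x]
  have hf0 : ∀ x : Euc d, r ≤ ‖x‖ → f x = 0 := fun x hx =>
    image_eq_zero_of_notMem_tsupport (f := f) fun h =>
      (mem_ball_zero_iff.1 (hsr h)).not_ge ((le_max_right _ _).trans hx)
  refine ⟨(8 * d + 16) * S * C, N₁, by positivity, hN₁, ?_, ?_⟩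
  · intro N hN x hx
    rw [radialCutoff, quadPoly_radial, Real.smoothTransition.one_of_one_le]
    by_contra! h
    have := key N hN x (by linarith)
    exact (mem_ball_zero_iff.1 (hsr hx)).not_ge ((le_max_right _ _).trans this)
  · intro N hN x
    have hN4 : 4 ≤ N := hN₁.trans hN
    have hl := layer_nonneg (show 0 ≤ N by linarith) x
    have hM : 0 ≤ (8 * d + 16) * S * C * layer N x := by positivity
    have hcont : Continuous fun y : Euc d => N * (1 - ‖y‖ ^ 2) := by fun_prop
    rcases lt_or_ge (N * (1 - ‖x‖ ^ 2)) 1 with ht | ht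
    · have e : (fun y => radialCutoff N y * greenPotential d f y) =ᶠ[𝓝 x] fun _ => 0 := by
        filter_upwards [hcont.continuousAt.eventually_lt continuousAt_const ht] with y hy
        rw [radialCutoff, quadPoly_radial, Real.smoothTransition.zero_of_nonpos (by linarith),
          zero_mul]
      have h0 : lap (fun _ : Euc d => (0 : ℝ)) x = 0 := by
        have := lap_const_mul (u := fun _ : Euc d => (0 : ℝ)) (x := x) 0 contDiffAt_const
        simpa using this
      rw [lap_congr e, h0, hf0 x (key N hN x (by linarith)), mul_zero, add_zero, abs_zero]
      exact hM
    have hxb : x ∈ ball (0 : Euc d) 1 := by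
      rw [mem_ball_zero_iff]
      have : 0 < 1 - ‖x‖ ^ 2 := by by_contra! h; nlinarith
      nlinarith [norm_nonneg x]
    have hlap := lap_greenPotential hd hf hs x hxb
    rcases lt_or_ge 2 (N * (1 - ‖x‖ ^ 2)) with ht2 | ht2
    · have e : (fun y => radialCutoff N y * greenPotential d f y) =ᶠ[𝓝 x] greenPotential d f := by
        filter_upwards [continuousAt_const.eventually_lt hcont.continuousAt ht2] with y hy
        rw [radialCutoff, quadPoly_radial, Real.smoothTransition.one_of_one_le (by linarith),
          one_mul]
      rw [lap_congr e, hlap, neg_add_cancel, abs_zero]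
      exact hM
    · have hxr := key N hN x ht2
      have hxr1 : (1 + r₁) / 2 ≤ ‖x‖ := (le_max_left _ _).trans hxr
      rw [hf0 x hxr, mul_zero, neg_zero] at hlap
      rw [hf0 x hxr, mul_zero, add_zero, layer_eq_of_mem ht ht2]
      refine abs_lap_radialCutoff_mul_le (by linarith) hS0 hC.le hS ?_
        (mem_ball_zero_iff.1 hxb).le ht ht2 hlap (hU x hxb) (hU' x hxb (by linarith))
      exact (hUc.contDiffAt (isOpen_ball.mem_nhds hxb)).of_le
        (WithTop.coe_le_coe.2 (le_top : (2 : ℕ∞) ≤ ⊤))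

namespace GFF

variable {Ω : Type} [MeasurableSpace Ω]

lemma greenEnergy_eq_integral_greenPotential (f : Euc d → ℝ) :
    greenEnergy d f = ∫ x in ball (0 : Euc d) 1, greenPotential d f x * f x := by
  unfold greenEnergy greenPotential
  congr 1
  ext x
  simp_rw [mul_assoc, integral_const_mul]
  ring

lemma exists_cov_eq_greenEnergy (hd : 2 ≤ d) (X : GFF d Ω) : ∃ κ : ℝ, ∀ f : Euc d → ℝ,
    IsTestFun f → tsupport f ⊆ ball 0 1 → X.cov f f = κ * greenEnergy d f := by
  obtain ⟨c, hc⟩ := X.exists_cov_lap_eq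
  refine ⟨-c / fundConst d, fun f hf hs => ?_⟩
  obtain ⟨M, N₀, hM, hN₀, hcut, hle⟩ := exists_abs_lap_radialCutoff_mul_add_le hd hf hs
  set N : ℕ → ℝ := fun n => n + N₀ with hNdef
  have hN : Tendsto N atTop atTop := tendsto_atTop_add_const_right _ _ tendsto_natCast_atTop_atTop
  have hNge : ∀ n, N₀ ≤ N n := fun n => by simp [hNdef]
  have hU := contDiffOn_greenPotential hd hf hs
  have hw := fun n => isTestFun_radialCutoff_mul (N := N n) (by linarith [hNge n]) hU
  set w : ℕ → Euc d → ℝ := fun n x => radialCutoff (N n) x * greenPotential d f x with hwdef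
  have he : ∀ n, IsTestFun (lap (w n) + fundConst d • f) :=
    fun n => (hw n).1.lap.add (hf.smul _)
  have t := tendsto_cov_self_of_abs_le_layer (X := X) (by omega) (fun n => hN₀.trans (hNge n)) hN hM
    he (fun n x => hle (N n) (hNge n) x)
  have hval : ∀ n, X.cov (lap (w n) + fundConst d • f) f
      = c * greenEnergy d f + fundConst d * X.cov f f := by
    intro n
    rw [cov_add_left (hw n).1.lap (hf.smul _) hf, cov_smul_left _ hf, hc _ _ (hw n).1 hf (hw n).2 hs,
      greenEnergy_eq_integral_greenPotential, setIntegral_mul_eq_integral hs]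
    congr 3
    ext x
    by_cases hx : x ∈ tsupport f
    · rw [hcut _ (hNge n) x hx, one_mul]
    · rw [image_eq_zero_of_notMem_tsupport hx, mul_zero, mul_zero]
  have hle0 : (c * greenEnergy d f + fundConst d * X.cov f f) ^ 2 ≤ 0 := by
    refine ge_of_tendsto (by simpa using t.mul_const (X.cov f f)) (Eventually.of_forall fun n => ?_)
    rw [← hval n]
    exact cov_sq_le (he n) hf
  have h0 : c * greenEnergy d f + fundConst d * X.cov f f = 0 := by
    have := sq_nonneg (c * greenEnergy d f + fundConst d * X.cov f f)
    exact pow_eq_zero_iff (two_ne_zero) |>.1 (le_antisymm hle0 this)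
  have hK := fundConst_pos hd
  field_simp
  linarith

end GFF

end CovarianceFormula

section FiniteEnergy

variable {d : ℕ}

/-- Measurable functions `u` on the ball for which `|u| G |u|` is integrable. -/
structure FiniteGreenEnergy (d : ℕ) (u : Euc d → ℝ) : Prop where
  measurable : Measurable u
  integrable_abs : Integrable (fun p : Euc d × Euc d => |u p.1| * greenBall d p.1 p.2 * |u p.2|)
    ((volume.restrict (ball (0 : Euc d) 1)).prod (volume.restrict (ball (0 : Euc d) 1)))

namespace FiniteGreenEnergy

variable {u v w φ : Euc d → ℝ}

lemma measurable_kernel (hu : Measurable u) :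
    Measurable fun p : Euc d × Euc d => u p.1 * greenBall d p.1 p.2 * u p.2 :=
  ((hu.comp measurable_fst).mul measurable_greenBall).mul (hu.comp measurable_snd)

lemma integrable (hu : FiniteGreenEnergy d u) :
    Integrable (fun p : Euc d × Euc d => u p.1 * greenBall d p.1 p.2 * u p.2)
      ((volume.restrict (ball (0 : Euc d) 1)).prod (volume.restrict (ball (0 : Euc d) 1))) :=
  hu.integrable_abs.mono (measurable_kernel hu.measurable).aestronglyMeasurable
    (ae_of_all _ fun p => by simp)

lemma greenEnergy_eq (hu : FiniteGreenEnergy d u) :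
    greenEnergy d u = ∫ p : Euc d × Euc d, u p.1 * greenBall d p.1 p.2 * u p.2
      ∂((volume.restrict (ball (0 : Euc d) 1)).prod (volume.restrict (ball (0 : Euc d) 1))) :=
  (integral_prod _ hu.integrable).symm

lemma abs_kernel_le {p : Euc d × Euc d} (h1 : |u p.1| ≤ |w p.1|) (h2 : |u p.2| ≤ |w p.2|) :
    ‖u p.1 * greenBall d p.1 p.2 * u p.2‖ ≤ ‖|w p.1| * greenBall d p.1 p.2 * |w p.2|‖ := by
  simp only [norm_mul, Real.norm_eq_abs, abs_abs]
  gcongr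

lemma ae_prod {q : Euc d → Prop} (h : ∀ᵐ x ∂volume.restrict (ball (0 : Euc d) 1), q x) :
    ∀ᵐ p ∂(volume.restrict (ball (0 : Euc d) 1)).prod (volume.restrict (ball (0 : Euc d) 1)),
      q p.1 ∧ q p.2 :=
  (Measure.quasiMeasurePreserving_fst.ae h).and (Measure.quasiMeasurePreserving_snd.ae h)

lemma mono (hw : FiniteGreenEnergy d w) (hu : Measurable u)
    (h : ∀ᵐ x ∂volume.restrict (ball (0 : Euc d) 1), |u x| ≤ |w x|) : FiniteGreenEnergy d u := by
  refine ⟨hu, hw.integrable_abs.mono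
    (measurable_kernel (u := fun x => |u x|) hu.abs).aestronglyMeasurable ?_⟩
  filter_upwards [ae_prod h] with p hp
  exact abs_kernel_le (u := fun x => |u x|) (by simpa using hp.1) (by simpa using hp.2)

lemma const (hd : 2 ≤ d) (M : ℝ) : FiniteGreenEnergy d fun _ => M := by
  refine ⟨measurable_const, ?_⟩
  exact ((integrable_greenBall hd).const_mul |M|).mul_const |M|

lemma of_bound (hd : 2 ≤ d) (hu : Measurable u) {M : ℝ} (h : ∀ x, |u x| ≤ M) :
    FiniteGreenEnergy d u :=
  (const hd M).mono hu (ae_of_all _ fun x => (h x).trans (le_abs_self M))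

lemma of_isTestFun (hd : 2 ≤ d) (hφ : IsTestFun φ) : FiniteGreenEnergy d φ := by
  obtain ⟨M, hM⟩ := hφ.continuous.bounded_above_of_compact_support hφ.2
  exact of_bound hd hφ.continuous.measurable hM

lemma tendsto_greenEnergy (hw : FiniteGreenEnergy d w) {u : ℕ → Euc d → ℝ}
    (hu : ∀ n, Measurable (u n)) (hv : Measurable v) (hb : ∀ n x, |u n x| ≤ |w x|)
    (hlim : ∀ᵐ x ∂volume.restrict (ball (0 : Euc d) 1),
      Tendsto (fun n => u n x) atTop (𝓝 (v x))) :
    Tendsto (fun n => greenEnergy d (u n)) atTop (𝓝 (greenEnergy d v)) := by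
  have hvw : FiniteGreenEnergy d v := hw.mono hv <| by
    filter_upwards [hlim] with x hx
    exact le_of_tendsto hx.abs (Eventually.of_forall fun n => hb n x)
  have huw : ∀ n, FiniteGreenEnergy d (u n) := fun n => hw.mono (hu n) (ae_of_all _ (hb n))
  rw [hvw.greenEnergy_eq]
  simp_rw [fun n => (huw n).greenEnergy_eq]
  refine tendsto_integral_of_dominated_convergence _
    (fun n => (measurable_kernel (hu n)).aestronglyMeasurable) hw.integrable_abs.norm
    (fun n => ae_of_all _ fun p => abs_kernel_le (hb n _) (hb n _)) ?_
  filter_upwards [ae_prod hlim] with p hp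
  exact (hp.1.mul_const _).mul hp.2

lemma integrableOn_abs_mul (hd : 2 ≤ d) (hu : FiniteGreenEnergy d u) :
    IntegrableOn (fun x => |u x| * (1 - ‖x‖ ^ 2)) (ball (0 : Euc d) 1) := by
  set F : Euc d → ℝ := fun x => |u x| * (1 - ‖x‖ ^ 2) with hF
  have hFm : Measurable F := hu.measurable.abs.mul (by fun_prop)
  have hk := greenLower_pos hd
  have h1 : Integrable (fun p : Euc d × Euc d => F p.1 * F p.2)
      ((volume.restrict (ball (0 : Euc d) 1)).prod (volume.restrict (ball (0 : Euc d) 1))) := by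
    refine (hu.integrable_abs.const_mul (greenLower d)⁻¹).mono
      ((hFm.comp measurable_fst).mul (hFm.comp measurable_snd)).aestronglyMeasurable ?_
    filter_upwards [ae_unitBall_prod hd] with p ⟨hx, hy, hxy⟩
    have hg := greenLower_le hd hx hy hxy
    have a1 := one_sub_normSq_pos hx
    have a2 := one_sub_normSq_pos hy
    have hG : 0 ≤ greenBall d p.1 p.2 := (by positivity : (0 : ℝ) ≤ _).trans hg
    rw [Real.norm_of_nonneg (by positivity), Real.norm_of_nonneg (by positivity),
      ← div_eq_inv_mul, le_div_iff₀ hk]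
    calc F p.1 * F p.2 * greenLower d
        = |u p.1| * (greenLower d * ((1 - ‖p.1‖ ^ 2) * (1 - ‖p.2‖ ^ 2))) * |u p.2| := by
          rw [hF]; ring
      _ ≤ _ := by gcongr
  by_cases h0 : F =ᵐ[volume.restrict (ball (0 : Euc d) 1)] 0
  · exact (integrable_zero _ _ _).congr h0.symm
  · have h2 := ((integrable_prod_iff h1.aestronglyMeasurable).1 h1).1
    obtain ⟨x, hx0, hxi⟩ := ((not_eventually.1 h0).and_eventually h2).exists
    exact (integrable_const_mul_iff (IsUnit.mk0 _ hx0) F).1 hxi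

lemma integrable_cross (hd : 2 ≤ d) (hu : FiniteGreenEnergy d u) (hφ : IsTestFun φ)
    (hs : tsupport φ ⊆ ball 0 1) :
    Integrable (fun p : Euc d × Euc d => |u p.1| * greenBall d p.1 p.2 * |φ p.2|)
      ((volume.restrict (ball (0 : Euc d) 1)).prod (volume.restrict (ball (0 : Euc d) 1))) := by
  have habs : HasCompactSupport fun x => |φ x| := hφ.2.comp_left (g := fun t : ℝ => |t|) abs_zero
  have hsupp : tsupport (fun x => |φ x|) ⊆ ball 0 1 :=
    (tsupport_comp_subset (g := fun t : ℝ => |t|) abs_zero φ).trans hs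
  obtain ⟨C, hC, hb, -⟩ := exists_bound_fderiv_greenPotential hd hφ.continuous.abs habs hsupp
  have hm : Measurable fun p : Euc d × Euc d => |u p.1| * greenBall d p.1 p.2 * |φ p.2| :=
    ((hu.measurable.abs.comp measurable_fst).mul measurable_greenBall).mul
      (hφ.continuous.abs.measurable.comp measurable_snd)
  rw [integrable_prod_iff hm.aestronglyMeasurable]
  constructor
  · filter_upwards [ae_restrict_mem measurableSet_unitBall] with x hx
    simp_rw [mul_assoc]
    exact (integrableOn_greenBall_mul hd hφ.continuous.abs habs hx).const_mul _
  · refine ((hu.integrableOn_abs_mul hd).const_mul C).mono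
      hm.norm.stronglyMeasurable.integral_prod_right.aestronglyMeasurable ?_
    filter_upwards [ae_restrict_mem measurableSet_unitBall] with x hx
    have e : ∫ y in ball (0 : Euc d) 1, ‖|u x| * greenBall d x y * |φ y|‖
        = |u x| * greenPotential d (fun y => |φ y|) x := by
      rw [greenPotential, ← integral_const_mul]
      refine integral_congr_ae ?_
      filter_upwards [ae_restrict_mem measurableSet_unitBall, ae_restrict_of_ae (ae_ne hd x)]
        with y hy hxy
      rw [Real.norm_of_nonneg (mul_nonneg (mul_nonneg (abs_nonneg _)
        (greenBall_nonneg hd hx hy hxy)) (abs_nonneg _)), mul_assoc]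
    have a1 := one_sub_normSq_pos hx
    rw [e, norm_mul, Real.norm_of_nonneg (abs_nonneg (u x)),
      Real.norm_of_nonneg (mul_nonneg hC.le (mul_nonneg (abs_nonneg (u x)) a1.le))]
    calc _ ≤ |u x| * (C * (1 - ‖x‖ ^ 2)) := mul_le_mul_of_nonneg_left (hb x hx) (abs_nonneg _)
      _ = _ := by ring

lemma smul (hu : FiniteGreenEnergy d u) (c : ℝ) : FiniteGreenEnergy d (c • u) := by
  refine ⟨hu.measurable.const_smul c, (hu.integrable_abs.const_mul (|c| * |c|)).congr
    (ae_of_all _ fun p => ?_)⟩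
  simp only [Pi.smul_apply, smul_eq_mul, abs_mul]
  ring

lemma add_testFun (hd : 2 ≤ d) (hu : FiniteGreenEnergy d u) (hφ : IsTestFun φ)
    (hs : tsupport φ ⊆ ball 0 1) : FiniteGreenEnergy d (u + φ) := by
  have hc := hu.integrable_cross hd hφ hs
  have hc' := hc.swap
  have hφm := hφ.continuous.measurable
  have hsum : FiniteGreenEnergy d fun x => |u x| + |φ x| := by
    refine ⟨hu.measurable.abs.add hφm.abs, ((hu.integrable_abs.add
      (of_isTestFun hd hφ).integrable_abs).add (hc.add hc')).congr (ae_of_all _ fun p => ?_)⟩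
    simp only [Pi.add_apply, Function.comp_apply, Prod.fst_swap, Prod.snd_swap,
      fun x => abs_of_nonneg (add_nonneg (abs_nonneg (u x)) (abs_nonneg (φ x))),
      greenBall_comm p.2 p.1]
    ring
  refine hsum.mono (hu.measurable.add hφm) (ae_of_all _ fun x => ?_)
  rw [abs_of_nonneg (add_nonneg (abs_nonneg (u x)) (abs_nonneg (φ x)))]
  exact abs_add_le _ _

lemma greenEnergy_parallelogram (hu : FiniteGreenEnergy d u) (hv : FiniteGreenEnergy d v)
    (ha : FiniteGreenEnergy d (u + v)) (hs : FiniteGreenEnergy d (u - v)) :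
    greenEnergy d (u + v) + greenEnergy d (u - v) = 2 * greenEnergy d u + 2 * greenEnergy d v := by
  rw [hu.greenEnergy_eq, hv.greenEnergy_eq, ha.greenEnergy_eq, hs.greenEnergy_eq,
    ← integral_add ha.integrable hs.integrable, ← integral_const_mul, ← integral_const_mul,
    ← integral_add (hu.integrable.const_mul 2) (hv.integrable.const_mul 2)]
  congr 1
  ext p
  simp only [Pi.add_apply, Pi.sub_apply]
  ring

end FiniteGreenEnergy

end FiniteEnergy

section Extension

variable {d : ℕ}

/-- A bounded function supported in a smaller ball is an a.e. limit of uniformly bounded test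
functions supported in the unit ball. -/
lemma exists_testFun_tendsto_ae {u : Euc d → ℝ} (hu : Measurable u) {M r : ℝ}
    (hM : ∀ x, |u x| ≤ M) (hr : r < 1) (hur : ∀ x, r < ‖x‖ → u x = 0) :
    ∃ φ : ℕ → Euc d → ℝ, (∀ n, IsTestFun (φ n)) ∧ (∀ n, tsupport (φ n) ⊆ ball 0 1) ∧
      (∀ n x, |φ n x| ≤ M) ∧ ∀ᵐ x, Tendsto (fun n => φ n x) atTop (𝓝 (u x)) := by
  have hr1 : 0 < 1 - r := by linarith
  set B : ℕ → ContDiffBump (0 : Euc d) := fun n =>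
    ⟨(1 - r) / (n + 2) / 2, (1 - r) / (n + 2), by positivity, half_lt_self (by positivity)⟩ with hB
  have hloc : LocallyIntegrable u volume := by
    refine (locallyIntegrable_const M).mono hu.aestronglyMeasurable (ae_of_all _ fun x => ?_)
    exact (hM x).trans (le_abs_self M)
  set φ : ℕ → Euc d → ℝ := fun n =>
    convolution ((B n).normed volume) u (ContinuousLinearMap.lsmul ℝ ℝ) volume with hφ
  have hsupp : ∀ n, tsupport (φ n) ⊆ closedBall 0 (r + (1 - r) / (n + 2)) := by
    intro n
    refine closure_minimal ?_ isClosed_closedBall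
    refine (support_convolution_subset _).trans ?_
    rintro _ ⟨a, ha, b, hb, rfl⟩
    rw [(B n).support_normed_eq, mem_ball_zero_iff] at ha
    have hb' : ‖b‖ ≤ r := by
      by_contra! h
      exact hb (hur b h)
    rw [mem_closedBall_zero_iff]
    have := norm_add_le a b
    have ha' : ‖a‖ < (1 - r) / (n + 2) := ha
    linarith
  have hlt : ∀ n : ℕ, r + (1 - r) / (n + 2) < 1 := by
    intro n
    have : (1 - r) / (n + 2) < 1 - r := div_lt_self hr1 (by linarith [n.cast_nonneg (α := ℝ)])
    linarith
  refine ⟨φ, fun n => ⟨?_, ?_⟩, fun n => ?_, fun n x => ?_, ?_⟩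
  · exact (B n).hasCompactSupport_normed.contDiff_convolution_left
      (ContinuousLinearMap.lsmul ℝ ℝ) (B n).contDiff_normed hloc
  · exact (isCompact_closedBall _ _).of_isClosed_subset (isClosed_tsupport _) (hsupp n)
  · exact (hsupp n).trans (closedBall_subset_ball (hlt n))
  · have hi : Integrable ((B n).normed volume) volume := (B n).integrable_normed
    rw [← Real.norm_eq_abs]
    calc ‖φ n x‖ ≤ ∫ t, (B n).normed volume t * M := by
          rw [hφ]; unfold convolution
          refine norm_integral_le_of_norm_le (hi.mul_const M) (ae_of_all _ fun t => ?_)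
          rw [ContinuousLinearMap.lsmul_apply, norm_smul,
            Real.norm_of_nonneg ((B n).nonneg_normed t)]
          exact mul_le_mul_of_nonneg_left (hM _) ((B n).nonneg_normed t)
      _ = M := by rw [integral_mul_const, (B n).integral_normed, one_mul]
  · refine ContDiffBump.ae_convolution_tendsto_right_of_locallyIntegrable (K := 2) ?_
      (Eventually.of_forall fun n => ?_) hloc
    · have : Tendsto (fun n : ℕ => (n : ℝ) + 2) atTop atTop :=
        tendsto_atTop_add_const_right _ _ tendsto_natCast_atTop_atTop
      exact tendsto_const_nhds.div_atTop this
    · simp only [hB]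
      linarith

/-- A function of finite Green energy is a dominated pointwise limit of bounded functions supported
in smaller balls. -/
lemma exists_bounded_tendsto {u : Euc d → ℝ} (hu : Measurable u) :
    ∃ v : ℕ → Euc d → ℝ, (∀ n, Measurable (v n)) ∧ (∀ n, ∃ M, ∀ x, |v n x| ≤ M) ∧
      (∀ n, ∃ r < (1 : ℝ), ∀ x, r < ‖x‖ → v n x = 0) ∧ (∀ n x, |v n x| ≤ |u x|) ∧
      ∀ x ∈ ball (0 : Euc d) 1, Tendsto (fun n => v n x) atTop (𝓝 (u x)) := by
  set A : ℕ → Set (Euc d) := fun n => {x | |u x| ≤ n} ∩ {x | ‖x‖ ≤ 1 - 1 / ((n : ℝ) + 1)} with hA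
  have hAm : ∀ n, MeasurableSet (A n) := fun n =>
    (measurableSet_le hu.abs measurable_const).inter (measurableSet_le measurable_norm measurable_const)
  refine ⟨fun n => (A n).indicator u, fun n => hu.indicator (hAm n), fun n => ⟨n, fun x => ?_⟩,
    fun n => ⟨1 - 1 / ((n : ℝ) + 1), by simp; positivity, fun x hx => ?_⟩, fun n x => ?_,
    fun x hx => ?_⟩
  · change |(A n).indicator u x| ≤ n
    by_cases h : x ∈ A n
    · rw [indicator_of_mem h]; exact h.1
    · rw [indicator_of_notMem h, abs_zero]; positivity
  · exact indicator_of_notMem (fun h => hx.not_ge h.2) _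
  · exact norm_indicator_le_norm_self u x
  · refine tendsto_const_nhds.congr' ?_
    rw [mem_ball_zero_iff] at hx
    have h1 : ∀ᶠ n : ℕ in atTop, |u x| ≤ n := tendsto_natCast_atTop_atTop.eventually_ge_atTop _
    have h2 : ∀ᶠ n : ℕ in atTop, 1 / ((n : ℝ) + 1) < 1 - ‖x‖ :=
      tendsto_one_div_add_atTop_nhds_zero_nat.eventually_lt_const (by linarith)
    filter_upwards [h1, h2] with n h1 h2
    rw [indicator_of_mem]
    exact ⟨h1, show ‖x‖ ≤ _ by linarith⟩

namespace GFF

variable {Ω : Type} [MeasurableSpace Ω]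

lemma mul_greenEnergy_nonneg (hd : 2 ≤ d) (X : GFF d Ω) {κ : ℝ}
    (hκ : ∀ f : Euc d → ℝ, IsTestFun f → tsupport f ⊆ ball 0 1 → X.cov f f = κ * greenEnergy d f)
    {u : Euc d → ℝ} (hu : FiniteGreenEnergy d u) : 0 ≤ κ * greenEnergy d u := by
  obtain ⟨v, hvm, hvb, hvr, hvu, hvt⟩ := exists_bounded_tendsto hu.measurable
  have hv : ∀ n, 0 ≤ κ * greenEnergy d (v n) := by
    intro n
    obtain ⟨M, hM⟩ := hvb n
    obtain ⟨r, hr, hr0⟩ := hvr n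
    obtain ⟨φ, hφ, hφs, hφM, hφt⟩ := exists_testFun_tendsto_ae (hvm n) hM hr hr0
    have t := (FiniteGreenEnergy.const hd M).tendsto_greenEnergy
      (fun n => (hφ n).continuous.measurable) (hvm n)
      (fun n x => (hφM n x).trans (le_abs_self M)) (ae_restrict_of_ae hφt)
    refine ge_of_tendsto (t.const_mul κ) (Eventually.of_forall fun k => ?_)
    rw [← hκ _ (hφ k) (hφs k)]
    exact cov_self_nonneg _
  have t := hu.tendsto_greenEnergy hvm hu.measurable hvu
    (ae_restrict_of_forall_mem measurableSet_unitBall hvt)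
  exact ge_of_tendsto (t.const_mul κ) (Eventually.of_forall hv)

/-- Two approximations of the same function of finite Green energy have close pairings with the
field. -/
lemma cov_sub_self_le (hd : 2 ≤ d) (X : GFF d Ω) {κ : ℝ}
    (hκ : ∀ f : Euc d → ℝ, IsTestFun f → tsupport f ⊆ ball 0 1 → X.cov f f = κ * greenEnergy d f)
    {u φ ψ : Euc d → ℝ} (hu : FiniteGreenEnergy d u) (hφ : IsTestFun φ)
    (hφs : tsupport φ ⊆ ball 0 1) (hψ : IsTestFun ψ) (hψs : tsupport ψ ⊆ ball 0 1) :
    X.cov (φ - ψ) (φ - ψ)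
      ≤ 2 * (κ * greenEnergy d (u - φ)) + 2 * (κ * greenEnergy d (u - ψ)) := by
  have hneg : ∀ {χ : Euc d → ℝ}, tsupport χ ⊆ ball 0 1 → tsupport ((-1 : ℝ) • χ) ⊆ ball 0 1 :=
    fun h => (tsupport_smul_subset_right (fun _ => (-1 : ℝ)) _).trans h
  have hsub : ∀ {v χ : Euc d → ℝ}, FiniteGreenEnergy d v → IsTestFun χ → tsupport χ ⊆ ball 0 1 →
      FiniteGreenEnergy d (v - χ) := by
    intro v χ hv hχ hs
    have := hv.add_testFun hd (hχ.smul (-1)) (hneg hs)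
    rwa [neg_one_smul, ← sub_eq_add_neg] at this
  have e1 : (u - φ) + (u - ψ) = (2 : ℝ) • u - φ - ψ := by rw [two_smul]; abel
  have e2 : (u - ψ) - (u - φ) = φ - ψ := by abel
  have hsum : FiniteGreenEnergy d ((u - ψ) + (u - φ)) := by
    rw [add_comm, e1]
    exact hsub (hsub (hu.smul 2) hφ hφs) hψ hψs
  have hdiff : IsTestFun (φ - ψ) := hφ.sub hψ
  have hdiffs : tsupport (φ - ψ) ⊆ ball 0 1 :=
    (tsupport_sub φ ψ).trans (union_subset hφs hψs)
  have hp := FiniteGreenEnergy.greenEnergy_parallelogram (hsub hu hψ hψs) (hsub hu hφ hφs) hsum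
    (by rw [e2]; exact FiniteGreenEnergy.of_isTestFun hd hdiff)
  rw [e2] at hp
  have hn := X.mul_greenEnergy_nonneg hd hκ hsum
  rw [hκ _ hdiff hdiffs]
  have : κ * greenEnergy d (φ - ψ) = 2 * (κ * greenEnergy d (u - ψ))
      + 2 * (κ * greenEnergy d (u - φ)) - κ * greenEnergy d ((u - ψ) + (u - φ)) := by
    linear_combination κ * hp
  linarith

end GFF

lemma norm_toLp_sub_sq {Ω : Type} [MeasurableSpace Ω] {P : Measure Ω} {Y : Ω → ℝ}
    (hY : MemLp Y 2 P) (L : Lp ℝ 2 P) : ‖hY.toLp Y - L‖ ^ 2 = ∫ ω, (Y ω - L ω) ^ 2 ∂P := by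
  rw [← real_inner_self_eq_norm_sq, L2.inner_def]
  refine integral_congr_ae ?_
  filter_upwards [Lp.coeFn_sub (hY.toLp Y) L, hY.coeFn_toLp] with ω h1 h2
  rw [h1, Pi.sub_apply, h2, real_inner_self_eq_norm_sq, Real.norm_eq_abs, sq_abs]

end Extension

/-- the pairing `(h^𝔹, ·)` extends to functions of finite Green energy:
pairings along any Green-energy approximating sequence converge in L²(P), with a common limit. -/
theorem statement10 (d : ℕ) (hd : 2 ≤ d) (Ω : Type) [MeasurableSpace Ω] (X : GFF d Ω) (f : Euc d → ℝ) (hf : Measurable f)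
    (hfin : IntegrableOn (fun p : Euc d × Euc d => |f p.1| * greenBall d p.1 p.2 * |f p.2|)
      (ball (0 : Euc d) 1 ×ˢ ball (0 : Euc d) 1))
    (fs gs : ℕ → Euc d → ℝ)
    (hfs : ∀ n, IsTestFun (fs n) ∧ tsupport (fs n) ⊆ ball (0 : Euc d) 1)
    (hgs : ∀ n, IsTestFun (gs n) ∧ tsupport (gs n) ⊆ ball (0 : Euc d) 1)
    (hfconv : Tendsto (fun n => greenEnergy d (f - fs n)) atTop (𝓝 0))
    (hgconv : Tendsto (fun n => greenEnergy d (f - gs n)) atTop (𝓝 0)) :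
    ∃ L : Ω → ℝ, Measurable L ∧
      Tendsto (fun n => ∫ ω, (X.h 0 1 (fs n) ω - L ω) ^ 2 ∂X.P) atTop (𝓝 0) ∧
      Tendsto (fun n => ∫ ω, (X.h 0 1 (gs n) ω - L ω) ^ 2 ∂X.P) atTop (𝓝 0) := by
  have hF : FiniteGreenEnergy d f := ⟨hf, by rwa [Measure.prod_restrict]⟩
  obtain ⟨κ, hκ⟩ := X.exists_cov_eq_greenEnergy hd
  have hLp : ∀ {φ : Euc d → ℝ}, IsTestFun φ → MemLp (X.h 0 1 φ) 2 X.P := GFF.memLp_h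
  set E : (Euc d → ℝ) → ℝ := fun φ => κ * greenEnergy d (f - φ) with hE
  have key : ∀ {φ ψ : Euc d → ℝ} (hφ : IsTestFun φ) (hψ : IsTestFun ψ), tsupport φ ⊆ ball 0 1 →
      tsupport ψ ⊆ ball 0 1 → ‖(hLp hφ).toLp _ - (hLp hψ).toLp _‖ ^ 2 ≤ 2 * E φ + 2 * E ψ := by
    intro φ ψ hφ hψ hφs hψs
    refine le_trans (le_of_eq ?_) (X.cov_sub_self_le hd hκ hF hφ hφs hψ hψs)
    rw [norm_toLp_sub_sq, GFF.cov]
    refine integral_congr_ae ?_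
    filter_upwards [(hLp hψ).coeFn_toLp, X.lin_add φ ((-1 : ℝ) • ψ) hφ (hψ.smul _),
      X.lin_smul (-1) ψ hψ] with ω h1 h2 h3
    rw [h1, sub_eq_add_neg φ ψ, ← neg_one_smul ℝ ψ, h2, h3]
    ring
  have hEf : Tendsto (fun n => E (fs n)) atTop (𝓝 0) := by simpa using hfconv.const_mul κ
  have hEg : Tendsto (fun n => E (gs n)) atTop (𝓝 0) := by simpa using hgconv.const_mul κ
  set Y : ℕ → Lp ℝ 2 X.P := fun n => (hLp (hfs n).1).toLp _ with hY
  set Z : ℕ → Lp ℝ 2 X.P := fun n => (hLp (hgs n).1).toLp _ with hZ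
  have hcauchy : CauchySeq Y := by
    refine Metric.cauchySeq_iff.2 fun ε hε => ?_
    obtain ⟨N, hN⟩ := eventually_atTop.1
      (hEf.eventually_lt_const (show (0 : ℝ) < ε ^ 2 / 4 by positivity))
    refine ⟨N, fun m hm n hn => ?_⟩
    rw [dist_eq_norm]
    refine lt_of_pow_lt_pow_left₀ 2 hε.le ((key (hfs m).1 (hfs n).1 (hfs m).2 (hfs n).2).trans_lt ?_)
    linarith [hN m hm, hN n hn]
  obtain ⟨L, hL⟩ := cauchySeq_tendsto_of_complete hcauchy
  have hYZ : Tendsto (fun n => ‖Z n - Y n‖ ^ 2) atTop (𝓝 0) :=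
    squeeze_zero (fun n => sq_nonneg _) (fun n => key (hgs n).1 (hfs n).1 (hgs n).2 (hfs n).2)
      (by simpa using (hEg.const_mul 2).add (hEf.const_mul 2))
  have hYL : Tendsto (fun n => ‖Y n - L‖ ^ 2) atTop (𝓝 0) := by
    simpa using (tendsto_iff_norm_sub_tendsto_zero.1 hL).pow 2
  refine ⟨L, (Lp.stronglyMeasurable L).measurable, ?_, ?_⟩
  · simpa only [hY, norm_toLp_sub_sq] using hYL
  · have hZL : Tendsto (fun n => ‖Z n - L‖ ^ 2) atTop (𝓝 0) := by
      refine squeeze_zero (fun n => sq_nonneg _) (fun n => ?_)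
        (by simpa using (hYZ.const_mul 2).add (hYL.const_mul 2))
      have h1 := norm_add_le (Z n - Y n) (Y n - L)
      rw [sub_add_sub_cancel] at h1
      nlinarith [norm_nonneg (Z n - L), sq_nonneg (‖Z n - Y n‖ - ‖Y n - L‖)]
    simpa only [hZ, norm_toLp_sub_sq] using hZL
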